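/- There exists a universal constant C > 0 such that for every n, every isotropic log-concave random vector X in ℝⁿ, every integer 1 ≤ m ≤ n, and every p ≥ 1, one has (E[max_{|I|=m} |P_I X|^p])^{1/p} ≤ C·(√m·log(en/m) + σ_X(p)), where the maximum is over all subsets I ⊆ {1,…,n} of cardinality m and P_I denotes the coordinate projection from ℝⁿ onto ℝ^I. -/

import Mathlib

open MeasureTheory ProbabilityTheory Real
open scoped Pointwise ENNReal RealInnerProductSpace

noncomputable section

variable {Ω : Type*} [MeasurableSpace Ω]

/-- A random vector `X` in `ℝⁿ` is log-concave: for all nonempty compact sets `K, L` and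
`a ∈ [0,1]`, `P(X ∈ aK + (1-a)L) ≥ P(X ∈ K)^a * P(X ∈ L)^(1-a)`. -/
def IsLogConcave {n : ℕ} (μ : Measure Ω) (X : Ω → EuclideanSpace ℝ (Fin n)) : Prop :=
  ∀ K L : Set (EuclideanSpace ℝ (Fin n)), K.Nonempty → L.Nonempty →
    IsCompact K → IsCompact L → ∀ a : ℝ, 0 ≤ a → a ≤ 1 →
      (μ (X ⁻¹' K)).toReal ^ a * (μ (X ⁻¹' L)).toReal ^ (1 - a) ≤
        (μ (X ⁻¹' (a • K + (1 - a) • L))).toReal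

/-- `X` is isotropic: centered with identity covariance matrix. -/
def IsIsotropic {n : ℕ} (μ : Measure Ω) (X : Ω → EuclideanSpace ℝ (Fin n)) : Prop :=
  (∀ i, ∫ ω, X ω i ∂μ = 0) ∧
  ∀ i j, ∫ ω, X ω i * X ω j ∂μ = if i = j then (1 : ℝ) else 0

/-- `σ_X(p) = sup_{|t| = 1} (E|⟨t,X⟩|^p)^(1/p)`. -/
def sigmaX {n : ℕ} (μ : Measure Ω) (X : Ω → EuclideanSpace ℝ (Fin n)) (p : ℝ) : ℝ :=
  ⨆ t : {t : EuclideanSpace ℝ (Fin n) // ‖t‖ = 1},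
    (∫ ω, |⟪t.1, X ω⟫| ^ p ∂μ) ^ (1 / p)

/-- Generalized inverse of `σ_X`. -/
def sigmaXInv {n : ℕ} (μ : Measure Ω) (X : Ω → EuclideanSpace ℝ (Fin n)) (s : ℝ) : ℝ :=
  sSup {p : ℝ | 1 ≤ p ∧ sigmaX μ X p ≤ s}

/-- Log-concavity of a measure, tested on closed sets `K`, `L` and a closed set `C` containing
`a K + (1 - a) L`. -/
def LogConcaveMeasure {E : Type*} [NormedAddCommGroup E] [NormedSpace ℝ E] [MeasurableSpace E]
    (ν : Measure E) : Prop :=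
  ∀ K L C : Set E, IsClosed K → IsClosed L → IsClosed C → ∀ a : ℝ, 0 < a → a < 1 →
    (∀ x ∈ K, ∀ y ∈ L, a • x + (1 - a) • y ∈ C) →
      ν.real K ^ a * ν.real L ^ (1 - a) ≤ ν.real C

theorem tendsto_real_inter_closedBall {E : Type*} [NormedAddCommGroup E] [MeasurableSpace E]
    (ν : Measure E) [IsFiniteMeasure ν] (K : Set E) :
    Filter.Tendsto (fun N : ℕ => ν.real (K ∩ Metric.closedBall 0 N)) Filter.atTop
      (nhds (ν.real K)) := by
  have h1 : Monotone fun N : ℕ => K ∩ Metric.closedBall (0 : E) N := fun i j hij =>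
    Set.inter_subset_inter_right _ (Metric.closedBall_subset_closedBall (by exact_mod_cast hij))
  have h2 : (⋃ N : ℕ, K ∩ Metric.closedBall (0 : E) N) = K := by
    rw [← Set.inter_iUnion, Metric.iUnion_closedBall_nat, Set.inter_univ]
  have h3 := tendsto_measure_iUnion_atTop (μ := ν) h1
  rw [h2] at h3
  exact (ENNReal.tendsto_toReal (measure_ne_top ν K)).comp h3

theorem IsLogConcave.logConcaveMeasure_map {Ω : Type*} [MeasurableSpace Ω] {μ : Measure Ω}
    [IsProbabilityMeasure μ] {n : ℕ} {X : Ω → EuclideanSpace ℝ (Fin n)} (hX : Measurable X)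
    (h : IsLogConcave μ X) : LogConcaveMeasure (μ.map X) := by
  intro K L C hK hL hC a ha0 ha1 hsub
  have := Measure.isProbabilityMeasure_map (μ := μ) hX.aemeasurable
  have key : ∀ N : ℕ, (μ.map X).real (K ∩ Metric.closedBall 0 N) ^ a *
      (μ.map X).real (L ∩ Metric.closedBall 0 N) ^ (1 - a) ≤ (μ.map X).real C := by
    intro N
    rcases Set.eq_empty_or_nonempty (K ∩ Metric.closedBall 0 (N : ℝ)) with hKe | hKn
    · rw [hKe]; simp [Real.zero_rpow ha0.ne']
    rcases Set.eq_empty_or_nonempty (L ∩ Metric.closedBall 0 (N : ℝ)) with hLe | hLn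
    · rw [hLe]; simp [Real.zero_rpow (sub_pos.2 ha1).ne']
    have hKc := (isCompact_closedBall (0 : EuclideanSpace ℝ (Fin n)) N).inter_left hK
    have hLc := (isCompact_closedBall (0 : EuclideanSpace ℝ (Fin n)) N).inter_left hL
    have h1 := h _ _ hKn hLn hKc hLc a ha0.le ha1.le
    simp only [Measure.real]
    rw [Measure.map_apply hX hKc.isClosed.measurableSet,
      Measure.map_apply hX hLc.isClosed.measurableSet, Measure.map_apply hX hC.measurableSet]
    refine h1.trans (ENNReal.toReal_mono (measure_ne_top _ _) (measure_mono ?_))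
    refine Set.preimage_mono ?_
    rintro _ ⟨_, ⟨x, hx, rfl⟩, _, ⟨y, hy, rfl⟩, rfl⟩
    exact hsub x hx.1 y hy.1
  refine le_of_tendsto' (x := Filter.atTop) (Filter.Tendsto.mul ?_ ?_) key
  · exact (tendsto_real_inter_closedBall _ K).rpow_const (Or.inr ha0.le)
  · exact (tendsto_real_inter_closedBall _ L).rpow_const (Or.inr (sub_pos.2 ha1).le)

namespace LogConcaveMeasure

variable {E F : Type*} [NormedAddCommGroup E] [NormedSpace ℝ E] [MeasurableSpace E] [BorelSpace E]
  [NormedAddCommGroup F] [NormedSpace ℝ F] [MeasurableSpace F] [BorelSpace F] {ν : Measure E}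

theorem map (h : LogConcaveMeasure ν) (T : E →L[ℝ] F) : LogConcaveMeasure (ν.map T) := by
  intro K L C hK hL hC a ha0 ha1 hsub
  have hT : Measurable T := T.continuous.measurable
  simp only [Measure.real]
  rw [Measure.map_apply hT hK.measurableSet, Measure.map_apply hT hL.measurableSet,
    Measure.map_apply hT hC.measurableSet]
  refine h _ _ _ (hK.preimage T.continuous) (hL.preimage T.continuous) (hC.preimage T.continuous)
    a ha0 ha1 fun x hx y hy => ?_
  simpa using hsub _ hx _ hy

theorem cond [IsProbabilityMeasure ν] (h : LogConcaveMeasure ν) {A : Set E} (hA : IsClosed A)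
    (hconv : Convex ℝ A) : LogConcaveMeasure (ν[|A]) := by
  intro K L C hK hL hC a ha0 ha1 hsub
  have hc : ∀ s : Set E, (ν[|A]).real s = (ν.real A)⁻¹ * ν.real (A ∩ s) := fun s => by
    simp [Measure.real, cond_apply hA.measurableSet]
  simp only [hc]
  have h1 := h (A ∩ K) (A ∩ L) (A ∩ C) (hA.inter hK) (hA.inter hL) (hA.inter hC) a ha0 ha1
    fun x hx y hy => ⟨hconv hx.1 hy.1 ha0.le (sub_pos.2 ha1).le (by ring), hsub _ hx.2 _ hy.2⟩
  have h0 : 0 ≤ (ν.real A)⁻¹ := by positivity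
  rw [Real.mul_rpow h0 measureReal_nonneg, Real.mul_rpow h0 measureReal_nonneg]
  rcases h0.eq_or_lt with h0' | h0'
  · rw [← h0']; simp [Real.zero_rpow ha0.ne']
  calc _ = ((ν.real A)⁻¹ ^ a * (ν.real A)⁻¹ ^ (1 - a)) *
        (ν.real (A ∩ K) ^ a * ν.real (A ∩ L) ^ (1 - a)) := by ring
    _ = (ν.real A)⁻¹ * (ν.real (A ∩ K) ^ a * ν.real (A ∩ L) ^ (1 - a)) := by
      rw [← Real.rpow_add h0']; simp
    _ ≤ _ := mul_le_mul_of_nonneg_left h1 h0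

end LogConcaveMeasure

namespace LogConcaveMeasure

/-- Markov's inequality for moments, in real form. -/
theorem real_le_abs_le_of_moment {ν : Measure ℝ} [IsFiniteMeasure ν] {q a b : ℝ}
    (hq : 0 < q) (ha : 0 ≤ a) (hb : 0 < b)
    (hm : ∫⁻ x, ENNReal.ofReal (|x| ^ q) ∂ν ≤ ENNReal.ofReal (a ^ q)) :
    ν.real {x | b ≤ |x|} ≤ (a / b) ^ q := by
  have h1 := mul_meas_ge_le_lintegral (μ := ν) (f := fun x : ℝ => ENNReal.ofReal (|x| ^ q))
    (by fun_prop) (ENNReal.ofReal (b ^ q))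
  have h2 : {x : ℝ | b ≤ |x|} ⊆ {x | ENNReal.ofReal (b ^ q) ≤ ENNReal.ofReal (|x| ^ q)} :=
    fun x hx => ENNReal.ofReal_le_ofReal (Real.rpow_le_rpow hb.le hx hq.le)
  have h3 : ENNReal.ofReal (b ^ q) * ν {x | b ≤ |x|} ≤ ENNReal.ofReal (a ^ q) :=
    (mul_le_mul_right (measure_mono h2) _).trans (h1.trans hm)
  have h4 := ENNReal.toReal_mono ENNReal.ofReal_ne_top h3
  rw [ENNReal.toReal_mul, ENNReal.toReal_ofReal (by positivity),
    ENNReal.toReal_ofReal (by positivity)] at h4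
  rw [Real.div_rpow ha hb.le, le_div_iff₀ (by positivity), mul_comm]
  exact h4

/-- Borell's lemma on the line: exponential decay at the scale of the `q`-th moment. -/
theorem real_tail_le {ν : Measure ℝ} [IsProbabilityMeasure ν] (h : LogConcaveMeasure ν)
    {q a s : ℝ} (hq : 1 ≤ q) (ha : 0 < a)
    (hm : ∫⁻ x, ENNReal.ofReal (|x| ^ q) ∂ν ≤ ENNReal.ofReal (a ^ q)) :
    ν.real {x | s ≤ |x|} ≤ exp (q * (1 - s / (exp 3 * a))) := by
  set b := exp 3 * a with hb
  have hb0 : 0 < b := by positivity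
  have hq0 : 0 < q := by linarith
  rcases le_or_gt s b with hsb | hsb
  · refine measureReal_le_one.trans (Real.one_le_exp (mul_nonneg hq0.le ?_))
    rw [sub_nonneg, div_le_one hb0]; exact hsb
  have hπ : ν.real {x | b ≤ |x|} ≤ exp (-3 * q) := by
    refine (real_le_abs_le_of_moment hq0 ha.le hb0 hm).trans_eq ?_
    have : a / b = exp (-3) := by rw [hb, Real.exp_neg]; field_simp
    rw [this, ← Real.exp_mul]
  have he1 : (2 : ℝ) ≤ exp 1 := by
    have := Real.add_one_le_exp (1 : ℝ); linarith
  have hπ2 : ν.real {x | b ≤ |x|} ≤ 1 / 2 := by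
    refine hπ.trans ((Real.exp_le_exp.2 (by linarith : -3 * q ≤ -1)).trans ?_)
    rw [Real.exp_neg, one_div]
    exact inv_anti₀ (by norm_num) he1
  have hL : 1 / 2 ≤ ν.real {x | |x| ≤ b} := by
    have h1 : ν.real {x | |x| ≤ b}ᶜ ≤ ν.real {x | b ≤ |x|} :=
      measureReal_mono fun x hx => by
        simp only [Set.mem_compl_iff, Set.mem_ofPred_eq, not_le] at hx ⊢; exact hx.le
    rw [probReal_compl_eq_one_sub (measurableSet_le (by fun_prop) (by fun_prop))] at h1
    linarith
  set t := s / b with ht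
  have ht1 : 1 < t := by rw [ht, lt_div_iff₀ hb0]; linarith
  have hst : s = t * b := by rw [ht]; field_simp
  have hα0 : 0 < 2 / (t + 1) := by positivity
  have hα1 : 2 / (t + 1) < 1 := by rw [div_lt_one (by linarith)]; linarith
  have key := h {x | s ≤ |x|} {x | |x| ≤ b} {x | b ≤ |x|}
    (isClosed_le continuous_const continuous_abs) (isClosed_le continuous_abs continuous_const)
    (isClosed_le continuous_const continuous_abs) (2 / (t + 1)) hα0 hα1 (by
      intro x hx y hy
      simp only [Set.mem_ofPred_eq, smul_eq_mul] at hx hy ⊢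
      have e1 : |2 / (t + 1) * x| - |(1 - 2 / (t + 1)) * y| ≤
          |2 / (t + 1) * x + (1 - 2 / (t + 1)) * y| := by
        have := abs_sub_abs_le_abs_sub (2 / (t + 1) * x) (-((1 - 2 / (t + 1)) * y))
        rwa [abs_neg, sub_neg_eq_add] at this
      rw [abs_mul, abs_mul, abs_of_pos hα0, abs_of_pos (sub_pos.2 hα1)] at e1
      have e2 : 2 / (t + 1) * (t * b) ≤ 2 / (t + 1) * |x| :=
        mul_le_mul_of_nonneg_left (hst ▸ hx) hα0.le
      have e3 : (1 - 2 / (t + 1)) * |y| ≤ (1 - 2 / (t + 1)) * b :=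
        mul_le_mul_of_nonneg_left hy (sub_pos.2 hα1).le
      have e4 : 2 / (t + 1) * (t * b) - (1 - 2 / (t + 1)) * b = b := by
        field_simp; ring
      linarith)
  have hL2 : (1 / 2 : ℝ) ≤ ν.real {x | |x| ≤ b} ^ (1 - 2 / (t + 1)) := by
    refine hL.trans ?_
    have := Real.rpow_le_rpow_of_exponent_ge (by linarith : 0 < ν.real {x | |x| ≤ b})
      measureReal_le_one (by linarith : 1 - 2 / (t + 1) ≤ 1)
    rwa [Real.rpow_one] at this
  set m := ν.real {x | s ≤ |x|} with hmdef
  have hm0 : 0 ≤ m := measureReal_nonneg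
  have hmα : m ^ (2 / (t + 1)) ≤ exp (-2 * q) := by
    have h1 : m ^ (2 / (t + 1)) * (1 / 2) ≤ exp (-3 * q) :=
      (mul_le_mul_of_nonneg_left hL2 (by positivity)).trans (key.trans hπ)
    have h2 : exp (-3 * q) * 2 ≤ exp (-3 * q) * exp q :=
      mul_le_mul_of_nonneg_left (he1.trans (Real.exp_le_exp.2 hq)) (Real.exp_pos _).le
    rw [← Real.exp_add] at h2
    calc _ ≤ exp (-3 * q) * 2 := by linarith
      _ ≤ _ := h2.trans_eq (by ring_nf)
  have hfin := Real.rpow_le_rpow (by positivity) hmα (by positivity : 0 ≤ (t + 1) / 2)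
  rw [← Real.rpow_mul hm0, ← Real.exp_mul,
    show 2 / (t + 1) * ((t + 1) / 2) = 1 by field_simp, Real.rpow_one] at hfin
  refine hfin.trans (Real.exp_le_exp.2 ?_)
  nlinarith

/-- Regularity of moments of one-dimensional log-concave measures. -/
theorem lintegral_abs_pow_le {ν : Measure ℝ} [IsProbabilityMeasure ν] (h : LogConcaveMeasure ν)
    {q a : ℝ} (hq : 1 ≤ q) (ha : 0 < a)
    (hm : ∫⁻ x, ENNReal.ofReal (|x| ^ q) ∂ν ≤ ENNReal.ofReal (a ^ q)) {N : ℕ} (hN : q ≤ N) :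
    ∫⁻ x, ENNReal.ofReal (|x| ^ N) ∂ν ≤ ENNReal.ofReal ((exp 4 * a * N / q) ^ N) := by
  have hq0 : 0 < q := by linarith
  have hN0 : 0 < (N : ℝ) := by linarith
  set r := q / (exp 3 * a) with hr
  have hr0 : 0 < r := by positivity
  have h1 := lintegral_rpow_eq_lintegral_meas_le_mul (μ := ν) (f := fun x : ℝ => |x|)
    (Filter.Eventually.of_forall fun x => abs_nonneg x) (by fun_prop) hN0
  simp only [Real.rpow_natCast] at h1
  rw [h1]
  have key := Real.integral_rpow_mul_exp_neg_mul_Ioi hN0 hr0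
  have hint : IntegrableOn (fun x : ℝ => x ^ ((N : ℝ) - 1) * exp (-(r * x))) (Set.Ioi 0) :=
    .of_integral_ne_zero (by rw [key]; have := Real.Gamma_pos_of_pos hN0; positivity)
  have h2 : ∫⁻ t in Set.Ioi (0 : ℝ), ν {x : ℝ | t ≤ |x|} * ENNReal.ofReal (t ^ ((N : ℝ) - 1)) ≤
      ∫⁻ t in Set.Ioi (0 : ℝ), ENNReal.ofReal (exp q) *
        ENNReal.ofReal (t ^ ((N : ℝ) - 1) * exp (-(r * t))) := by
    refine setLIntegral_mono (by fun_prop) fun t ht => ?_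
    have h3 : ν {x : ℝ | t ≤ |x|} ≤ ENNReal.ofReal (exp q * exp (-(r * t))) := by
      rw [← ENNReal.ofReal_toReal (measure_ne_top ν {x : ℝ | t ≤ |x|})]
      refine ENNReal.ofReal_le_ofReal ((h.real_tail_le (s := t) hq ha hm).trans_eq ?_)
      rw [← Real.exp_add]; congr 1; rw [hr]; field_simp; ring
    refine (mul_le_mul_left h3 _).trans_eq ?_
    rw [← ENNReal.ofReal_mul (by positivity), ← ENNReal.ofReal_mul (by positivity)]
    congr 1; ring
  have h4 : ∫⁻ t in Set.Ioi (0 : ℝ), ENNReal.ofReal (t ^ ((N : ℝ) - 1) * exp (-(r * t))) =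
      ENNReal.ofReal ((1 / r) ^ (N : ℝ) * Real.Gamma N) := by
    rw [← key, ofReal_integral_eq_lintegral_ofReal hint]
    filter_upwards [ae_restrict_mem measurableSet_Ioi] with t ht
    have : (0 : ℝ) < t := ht
    positivity
  have h5 : (N : ℝ) * Real.Gamma N ≤ (N : ℝ) ^ N := by
    rw [← Real.Gamma_add_one hN0.ne', Real.Gamma_nat_eq_factorial]
    exact_mod_cast N.factorial_le_pow
  calc _ ≤ ENNReal.ofReal N * ∫⁻ t in Set.Ioi (0 : ℝ), ENNReal.ofReal (exp q) *
        ENNReal.ofReal (t ^ ((N : ℝ) - 1) * exp (-(r * t))) := mul_le_mul_right h2 _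
    _ = ENNReal.ofReal (exp q * (1 / r) ^ N * (N * Real.Gamma N)) := by
      rw [lintegral_const_mul _ (by fun_prop), h4, ← ENNReal.ofReal_mul (by positivity),
        ← ENNReal.ofReal_mul (by positivity), Real.rpow_natCast]
      congr 1; ring
    _ ≤ _ := by
      refine ENNReal.ofReal_le_ofReal ?_
      calc _ ≤ exp N * (1 / r) ^ N * (N : ℝ) ^ N := by gcongr
        _ = (exp 1 * (1 / r) * N) ^ N := by
          rw [mul_pow, mul_pow, ← Real.exp_nat_mul]; simp
        _ = _ := by
          congr 1
          rw [hr, show (4 : ℝ) = 1 + 3 by norm_num, Real.exp_add]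
          field_simp

end LogConcaveMeasure

section SmallBallVolume

variable {E : Type*} [NormedAddCommGroup E] [InnerProductSpace ℝ E] [FiniteDimensional ℝ E]
  [MeasurableSpace E] [BorelSpace E]

theorem lintegral_measure_norm_sub_le {S : Type*} [MeasurableSpace S] (ρ : Measure S) [SFinite ρ]
    {φ : S → E} (hφ : Measurable φ) (R : ℝ) :
    ∫⁻ y, ρ {s | ‖φ s - y‖ ≤ R} = ρ Set.univ * volume (Metric.closedBall (0 : E) R) := by
  have hD : MeasurableSet {p : S × E | ‖φ p.1 - p.2‖ ≤ R} :=
    measurableSet_le ((hφ.comp measurable_fst).sub measurable_snd).norm measurable_const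
  have h1 := Measure.prod_apply (μ := ρ) (ν := (volume : Measure E)) hD
  have h2 := Measure.prod_apply_symm (μ := ρ) (ν := (volume : Measure E)) hD
  have h3 : ∀ s : S, volume (Prod.mk s ⁻¹' {p : S × E | ‖φ p.1 - p.2‖ ≤ R}) =
      volume (Metric.closedBall (0 : E) R) := by
    intro s
    rw [← Measure.addHaar_closedBall_center volume (φ s) R]
    congr 1
    ext y
    simp [dist_eq_norm, norm_sub_rev]
  simp only [h3, lintegral_const] at h1
  rw [mul_comm, ← h1, h2]
  rfl

namespace LogConcaveMeasure

variable {ν : Measure E} [IsProbabilityMeasure ν]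

omit [FiniteDimensional ℝ E] [BorelSpace E] [IsProbabilityMeasure ν] in
theorem closedBall_rpow_le (h : LogConcaveMeasure ν) (r : ℝ) (x y : E) {a : ℝ} (ha0 : 0 < a)
    (ha1 : a < 1) :
    ν.real (Metric.closedBall x r) ^ a * ν.real (Metric.closedBall y r) ^ (1 - a) ≤
      ν.real (Metric.closedBall (a • x + (1 - a) • y) r) := by
  refine h _ _ _ Metric.isClosed_closedBall Metric.isClosed_closedBall Metric.isClosed_closedBall
    a ha0 ha1 fun u hu v hv => ?_
  rw [mem_closedBall_iff_norm] at hu hv ⊢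
  calc ‖a • u + (1 - a) • v - (a • x + (1 - a) • y)‖ = ‖a • (u - x) + (1 - a) • (v - y)‖ := by
        congr 1; module
    _ ≤ a * ‖u - x‖ + (1 - a) * ‖v - y‖ := by
        refine (norm_add_le _ _).trans_eq ?_
        rw [norm_smul, norm_smul, Real.norm_of_nonneg ha0.le, Real.norm_of_nonneg (by linarith)]
    _ ≤ a * r + (1 - a) * r := by gcongr
    _ = r := by ring

omit [FiniteDimensional ℝ E] [BorelSpace E] [IsProbabilityMeasure ν] in
theorem convex_setOf_le_closedBall (h : LogConcaveMeasure ν) (r : ℝ) {δ : ℝ} (hδ : 0 < δ) :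
    Convex ℝ {y : E | δ ≤ ν.real (Metric.closedBall y r)} := by
  rw [convex_iff_forall_pos]
  intro x hx y hy a b ha hb hab
  obtain rfl : b = 1 - a := by linarith
  refine le_trans ?_ (h.closedBall_rpow_le r x y ha (by linarith))
  calc δ = δ ^ a * δ ^ (1 - a) := by rw [← Real.rpow_add hδ]; simp
    _ ≤ _ := by
      gcongr
      · exact hx
      · exact hy

/-- A region all of whose `r`-balls have small mass has small mass. -/
theorem real_le_of_closedBall_le (h : LogConcaveMeasure ν) {r : ℝ} (hr : 0 < r)
    (hball : 1 / 2 ≤ ν.real (Metric.closedBall 0 r)) {δ : ℝ} (hδ : 0 ≤ δ) {H H' : Set E}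
    (hHH : ∀ z ∈ H, Metric.closedBall z r ⊆ H')
    (hH' : ∀ y ∈ H', ν.real (Metric.closedBall y r) ≤ δ) :
    ν.real H ≤ √(2 * δ) * 2 ^ Module.finrank ℝ E := by
  have h1 := lintegral_measure_norm_sub_le (E := E) (ν.restrict H) measurable_id r
  have h2 := lintegral_measure_norm_sub_le (E := E) ν (φ := fun z => (2 : ℝ) • z)
    (by fun_prop) (2 * r)
  have h3 : ∀ y : E, ν.restrict H {z | ‖id z - y‖ ≤ r} ≤
      ENNReal.ofReal √(2 * δ) * ν {z | ‖(2 : ℝ) • z - y‖ ≤ 2 * r} := by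
    intro y
    have hset : {z : E | ‖id z - y‖ ≤ r} = Metric.closedBall y r := by
      ext z; simp [dist_eq_norm]
    have hset2 : {z : E | ‖(2 : ℝ) • z - y‖ ≤ 2 * r} =
        Metric.closedBall ((1 / 2 : ℝ) • y + (1 - 1 / 2 : ℝ) • 0) r := by
      ext z
      rw [mem_closedBall_iff_norm, Set.mem_ofPred_eq,
        show (2 : ℝ) • z - y = (2 : ℝ) • (z - ((1 / 2 : ℝ) • y + (1 - 1 / 2 : ℝ) • 0)) by module,
        norm_smul, Real.norm_of_nonneg (by norm_num : (0 : ℝ) ≤ 2)]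
      constructor <;> intro h <;> linarith
    rw [hset, hset2]
    by_cases hy : y ∈ H'
    · refine (Measure.restrict_apply_le _ _).trans ?_
      have hlc := h.closedBall_rpow_le r y 0 (a := 1 / 2) (by norm_num) (by norm_num)
      rw [← ofReal_measureReal, ← ofReal_measureReal, ← ENNReal.ofReal_mul (by positivity)]
      refine ENNReal.ofReal_le_ofReal (le_trans ?_ (mul_le_mul_of_nonneg_left hlc (by positivity)))
      norm_num only
      rw [← Real.sqrt_eq_rpow, ← Real.sqrt_eq_rpow, ← Real.sqrt_mul measureReal_nonneg,
        ← Real.sqrt_mul (by positivity)]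
      refine Real.le_sqrt_of_sq_le ?_
      have := hH' y hy
      have h0 : 0 ≤ ν.real (Metric.closedBall y r) := measureReal_nonneg
      calc _ = ν.real (Metric.closedBall y r) * ν.real (Metric.closedBall y r) := sq _
        _ ≤ ν.real (Metric.closedBall y r) * δ := by gcongr
        _ = 2 * δ * (ν.real (Metric.closedBall y r) * (1 / 2)) := by ring
        _ ≤ _ := by gcongr
    · rw [Measure.restrict_apply Metric.isClosed_closedBall.measurableSet]
      have : Metric.closedBall y r ∩ H = ∅ := by
        ext z
        simp only [Set.mem_inter_iff, Set.mem_empty_iff_false, iff_false, not_and]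
        intro hz hzH
        exact hy (hHH z hzH (Metric.mem_closedBall_comm.1 hz))
      rw [this]; simp
  have h4 := lintegral_mono (μ := volume) h3
  rw [lintegral_const_mul' _ _ ENNReal.ofReal_ne_top, h1, h2, Measure.restrict_apply_univ,
    measure_univ, one_mul, Measure.addHaar_closedBall' _ _ hr.le,
    Measure.addHaar_closedBall' _ _ (by positivity : (0:ℝ) ≤ 2 * r)] at h4
  have h5 := ENNReal.toReal_mono (ENNReal.mul_ne_top ENNReal.ofReal_ne_top
    (ENNReal.mul_ne_top ENNReal.ofReal_ne_top
      (isCompact_closedBall (0 : E) 1).measure_lt_top.ne)) h4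
  simp only [ENNReal.toReal_mul, ENNReal.toReal_ofReal (Real.sqrt_nonneg _)] at h5
  rw [ENNReal.toReal_ofReal (by positivity), ENNReal.toReal_ofReal (by positivity)] at h5
  have hV : 0 < (volume (Metric.closedBall (0 : E) 1)).toReal :=
    ENNReal.toReal_pos (Metric.measure_closedBall_pos _ _ one_pos).ne'
      (isCompact_closedBall (0 : E) 1).measure_lt_top.ne
  have hrd : 0 < r ^ Module.finrank ℝ E := by positivity
  rw [mul_pow] at h5
  have h6 : ν.real H * (r ^ Module.finrank ℝ E * (volume (Metric.closedBall (0 : E) 1)).toReal) ≤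
      (√(2 * δ) * 2 ^ Module.finrank ℝ E) *
        (r ^ Module.finrank ℝ E * (volume (Metric.closedBall (0 : E) 1)).toReal) :=
    h5.trans_eq (by ring)
  exact le_of_mul_le_mul_right h6 (by positivity)

/-- If all two-sided tails at level `w` are at least `exp (-c d)` in dimension `d`, then `w` is at
most a multiple of any radius whose centred ball carries half of the mass. -/
theorem le_of_forall_exp_le_tail (h : LogConcaveMeasure ν) (hd : 1 ≤ Module.finrank ℝ E) {r : ℝ}
    (hr : 0 < r) (hball : 1 / 2 ≤ ν.real (Metric.closedBall 0 r)) {c w : ℝ} (hc : 0 ≤ c)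
    (hw : ∀ θ : E, ‖θ‖ = 1 →
      exp (-c * Module.finrank ℝ E) ≤ ν.real {y | w ≤ |⟪θ, y⟫|}) :
    w ≤ (1 + 12 * exp 2 * (2 * c + 8)) * r := by
  set d := Module.finrank ℝ E with hdd
  set L := 2 * c + 8 with hL
  have hL0 : 0 < L := by positivity
  have hd1 : (1 : ℝ) ≤ d := by exact_mod_cast hd
  have he1 : (2 : ℝ) ≤ exp 1 := by
    have := Real.add_one_le_exp (1 : ℝ); linarith
  by_contra! hcon
  have hpos : 0 < 12 * exp 2 * L := by positivity
  have hwr : r < w := by nlinarith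
  set δ := exp (-L * d) with hδ
  have hδ0 : 0 < δ := Real.exp_pos _
  have hδ2 : δ ≤ 1 / 2 := by
    have : δ ≤ exp (-1) := Real.exp_le_exp.2 (by nlinarith)
    refine this.trans ?_
    rw [Real.exp_neg, one_div]
    exact inv_anti₀ (by norm_num) he1
  have hsmall : √(2 * δ) * 2 ^ d < exp (-c * d) / 2 := by
    have e1 : √(2 * δ) ≤ 2 * exp (-c * d - 4 * d) := by
      refine Real.sqrt_le_iff.2 ⟨by positivity, ?_⟩
      rw [mul_pow, ← Real.exp_nat_mul, hδ,
        show ((2 : ℕ) : ℝ) * (-c * d - 4 * d) = -L * d by rw [hL]; push_cast; ring]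
      have := Real.exp_pos (-L * d)
      linarith
    have e2 : (16 : ℝ) ^ d ≤ exp (4 * d) := by
      rw [mul_comm, Real.exp_nat_mul]
      gcongr
      calc (16 : ℝ) = 2 ^ 4 := by norm_num
        _ ≤ exp 1 ^ 4 := by gcongr
        _ = exp 4 := by rw [← Real.exp_nat_mul]; norm_num
    have e3 : (8 : ℝ) ≤ 8 ^ d := by
      calc (8 : ℝ) = 8 ^ 1 := by norm_num
        _ ≤ 8 ^ d := pow_le_pow_right₀ (by norm_num) hd
    have e4 : (16 : ℝ) ^ d = 8 ^ d * 2 ^ d := by rw [← mul_pow]; norm_num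
    rw [Real.exp_sub] at e1
    have e5 := Real.exp_pos (-c * d)
    have e6 : (0 : ℝ) < 2 ^ d := by positivity
    calc √(2 * δ) * 2 ^ d ≤ 2 * (exp (-c * d) / exp (4 * d)) * 2 ^ d := by gcongr
      _ ≤ 2 * (exp (-c * d) / (8 * 2 ^ d)) * 2 ^ d := by
        gcongr
        exact (by rw [e4]; gcongr : 8 * (2 : ℝ) ^ d ≤ 16 ^ d).trans e2
      _ = exp (-c * d) / 4 := by field_simp; norm_num
      _ < _ := by linarith
  set K := {y : E | δ ≤ ν.real (Metric.closedBall y r)} with hK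
  have hKconv : Convex ℝ K := h.convex_setOf_le_closedBall r hδ0
  have hK0 : (0 : E) ∈ K := hδ2.trans hball
  -- every half-space meets `K` as soon as it carries enough mass
  have hhalf : ∀ θ : E, ‖θ‖ = 1 → exp (-c * d) / 2 ≤ ν.real {y | w ≤ ⟪θ, y⟫} →
      ∃ y ∈ K, w - r ≤ ⟪θ, y⟫ := by
    intro θ hθ hm
    by_contra! hno
    have := h.real_le_of_closedBall_le hr hball hδ0.le (H := {y | w ≤ ⟪θ, y⟫})
      (H' := {y | w - r ≤ ⟪θ, y⟫}) (by
        intro z hz y hy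
        rw [mem_closedBall_iff_norm] at hy
        have h1 : |⟪θ, y - z⟫| ≤ ‖θ‖ * ‖y - z‖ := abs_real_inner_le_norm _ _
        rw [hθ, one_mul, inner_sub_right] at h1
        have h2 := (abs_le.1 (h1.trans hy)).1
        simp only [Set.mem_ofPred_eq] at hz ⊢
        linarith) (by
        intro y hy
        by_contra! hlt
        exact absurd (hno y hlt.le) (not_lt.2 hy))
    linarith
  have hdir : ∀ θ : E, ‖θ‖ = 1 → ∃ y ∈ K - K, w - r ≤ ⟪θ, y⟫ := by
    intro θ hθ
    have h1 : exp (-c * d) ≤ ν.real {y | w ≤ ⟪θ, y⟫} + ν.real {y | w ≤ ⟪-θ, y⟫} := by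
      refine (hw θ hθ).trans ((measureReal_mono ?_).trans (measureReal_union_le _ _))
      intro y hy
      simp only [Set.mem_ofPred_eq, Set.mem_union, inner_neg_left] at hy ⊢
      exact le_abs.1 hy
    rcases le_total (exp (-c * d) / 2) (ν.real {y | w ≤ ⟪θ, y⟫}) with h2 | h2
    · obtain ⟨y, hy, hy2⟩ := hhalf θ hθ h2
      exact ⟨y - 0, Set.sub_mem_sub hy hK0, by simpa using hy2⟩
    · obtain ⟨y, hy, hy2⟩ := hhalf (-θ) (by simpa using hθ) (by linarith)
      exact ⟨0 - y, Set.sub_mem_sub hK0 hy, by simpa using hy2⟩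
  have hclos : ∀ y : E, ‖y‖ < w - r → y ∈ closure (K - K) := by
    intro y hy
    by_contra hyc
    obtain ⟨f, u, hf1, hf2⟩ := geometric_hahn_banach_closed_point (hKconv.sub hKconv).closure
      isClosed_closure hyc
    set v := (InnerProductSpace.toDual ℝ E).symm f with hv
    have hfv : ∀ x, f x = ⟪v, x⟫ := fun x => by
      rw [hv, InnerProductSpace.toDual_symm_apply]
    have h0 : (0 : E) ∈ K - K := by simpa using Set.sub_mem_sub hK0 hK0
    have hu : 0 < u := by simpa using hf1 0 (subset_closure h0)
    have hv0 : v ≠ 0 := by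
      intro hv0
      have := hfv y
      rw [hv0, inner_zero_left] at this
      linarith
    have hvn : 0 < ‖v‖ := norm_pos_iff.2 hv0
    obtain ⟨x, hx, hx2⟩ := hdir (‖v‖⁻¹ • v) (by rw [norm_smul]; simp [hvn.ne'])
    rw [inner_smul_left, ← hfv] at hx2
    simp only [map_inv₀, conj_trivial] at hx2
    rw [inv_mul_eq_div, le_div_iff₀ hvn] at hx2
    have h3 := hf1 x (subset_closure hx)
    have h4 : f y ≤ ‖v‖ * ‖y‖ := by rw [hfv]; exact real_inner_le_norm _ _
    nlinarith
  have hmass : ∀ a ∈ K, exp (-d) / 2 ≤ ν.real (Metric.closedBall ((1 / L) • a) r) := by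
    intro a ha
    have hL1 : 1 / L < 1 := by rw [div_lt_one hL0]; linarith
    have h1 := h.closedBall_rpow_le r a 0 (a := 1 / L) (by positivity) hL1
    rw [smul_zero, add_zero] at h1
    refine le_trans ?_ h1
    have h2 : exp (-d) ≤ ν.real (Metric.closedBall a r) ^ (1 / L) := by
      refine le_trans ?_ (Real.rpow_le_rpow hδ0.le ha (by positivity))
      rw [hδ, ← Real.exp_mul]
      exact Real.exp_le_exp.2 (by field_simp; rfl)
    have h3 : (1 / 2 : ℝ) ≤ ν.real (Metric.closedBall (0 : E) r) ^ (1 - 1 / L) := by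
      refine hball.trans ?_
      have := Real.rpow_le_rpow_of_exponent_ge
        (by linarith : 0 < ν.real (Metric.closedBall (0 : E) r)) measureReal_le_one
        (by linarith [(by positivity : 0 < 1 / L)] : 1 - 1 / L ≤ 1)
      rwa [Real.rpow_one] at this
    calc exp (-d) / 2 = exp (-d) * (1 / 2) := by ring
      _ ≤ _ := by gcongr
  have hI := lintegral_measure_norm_sub_le (E := E) (ν.prod ν) (φ := fun p => p.1 - p.2)
    (by fun_prop) (3 * r)
  rw [measure_univ, one_mul] at hI
  set R := (1 / L) * (w - r) with hR
  have hR0 : 0 < R := mul_pos (by positivity) (by linarith)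
  have hlow : ∀ z ∈ Metric.ball (0 : E) R, ENNReal.ofReal ((exp (-d) / 2) ^ 2) ≤
      ν.prod ν {p | ‖p.1 - p.2 - z‖ ≤ 3 * r} := by
    intro z hz
    rw [mem_ball_zero_iff] at hz
    have h1 := hclos (L • z) (by
      rw [norm_smul, Real.norm_of_nonneg hL0.le]
      rw [hR, one_div, inv_mul_eq_div, lt_div_iff₀ hL0] at hz
      linarith)
    obtain ⟨y, hy, hyz⟩ := Metric.mem_closure_iff.1 h1 r hr
    obtain ⟨a, ha, b, hb, rfl⟩ := hy
    have hsub : Metric.closedBall ((1 / L) • a) r ×ˢ Metric.closedBall ((1 / L) • b) r ⊆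
        {p : E × E | ‖p.1 - p.2 - z‖ ≤ 3 * r} := by
      rintro ⟨p, q⟩ ⟨hp, hq⟩
      simp only [mem_closedBall_iff_norm] at hp hq
      have h2 : ‖(1 / L) • (L • z - (a - b))‖ ≤ r := by
        rw [norm_smul, Real.norm_of_nonneg (by positivity), ← dist_eq_norm]
        have : 1 / L ≤ 1 := by rw [div_le_one hL0]; linarith
        calc 1 / L * dist (L • z) (a - b) ≤ 1 * r := by gcongr
          _ = r := one_mul r
      have h3 : p - q - z = (p - (1 / L) • a) - (q - (1 / L) • b) -
          (1 / L) • (L • z - (a - b)) := by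
        have : (1 / L) • (L • z) = z := by
          rw [smul_smul, one_div, inv_mul_cancel₀ hL0.ne', one_smul]
        rw [smul_sub, this, smul_sub]; abel
      simp only [Set.mem_ofPred_eq]
      rw [h3]
      refine (norm_sub_le _ _).trans ?_
      have := norm_sub_le (p - (1 / L) • a) (q - (1 / L) • b)
      linarith
    refine le_trans ?_ (measure_mono hsub)
    rw [Measure.prod_prod, sq, ENNReal.ofReal_mul (by positivity), ← ofReal_measureReal,
      ← ofReal_measureReal]
    exact mul_le_mul' (ENNReal.ofReal_le_ofReal (hmass a ha))
      (ENNReal.ofReal_le_ofReal (hmass b hb))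
  have hfin : ENNReal.ofReal ((exp (-d) / 2) ^ 2) * volume (Metric.ball (0 : E) R) ≤
      volume (Metric.closedBall (0 : E) (3 * r)) := by
    rw [← hI, ← setLIntegral_const]
    exact (setLIntegral_mono' measurableSet_ball hlow).trans (setLIntegral_le_lintegral _ _)
  rw [Measure.addHaar_ball_of_pos _ _ hR0, ← Measure.addHaar_unitClosedBall_eq_addHaar_unitBall,
    Measure.addHaar_closedBall' _ _ (by positivity : (0:ℝ) ≤ 3 * r)] at hfin
  have h5 := ENNReal.toReal_mono (ENNReal.mul_ne_top ENNReal.ofReal_ne_top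
      (isCompact_closedBall (0 : E) 1).measure_lt_top.ne) hfin
  simp only [ENNReal.toReal_mul] at h5
  rw [ENNReal.toReal_ofReal (by positivity), ENNReal.toReal_ofReal (by positivity),
    ENNReal.toReal_ofReal (by positivity), ← mul_assoc] at h5
  have hV : 0 < (volume (Metric.closedBall (0 : E) 1)).toReal :=
    ENNReal.toReal_pos (Metric.measure_closedBall_pos _ _ one_pos).ne'
      (isCompact_closedBall (0 : E) 1).measure_lt_top.ne
  have h6 := le_of_mul_le_mul_right h5 hV
  rw [← hdd] at h6
  have h7 : (exp (-2) / 4 * R) ^ d ≤ (3 * r) ^ d := by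
    refine le_trans ?_ h6
    rw [mul_pow, div_pow, div_pow, ← Real.exp_nat_mul, ← Real.exp_nat_mul]
    have e3 : (4 : ℝ) ≤ 4 ^ d := by
      calc (4 : ℝ) = 4 ^ 1 := by norm_num
        _ ≤ 4 ^ d := pow_le_pow_right₀ (by norm_num) hd
    rw [show (d : ℝ) * -2 = ((2 : ℕ) : ℝ) * -d by push_cast; ring]
    gcongr
    norm_num [e3]
  have h8 := (pow_le_pow_iff_left₀ (by positivity) (by positivity) (by omega)).1 h7
  rw [Real.exp_neg, hR] at h8
  have h9 : w - r ≤ 12 * exp 2 * L * r := by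
    have := mul_le_mul_of_nonneg_left h8 (by positivity : 0 ≤ 4 * exp 2 * L)
    field_simp at this
    linarith
  linarith

end LogConcaveMeasure

end SmallBallVolume

section SignCube

open scoped BigOperators

/-- The sign `±1` encoded by a Boolean. -/
def boolSign (b : Bool) : ℝ := if b then 1 else -1

theorem boolSign_sq (b : Bool) : boolSign b ^ 2 = 1 := by cases b <;> simp [boolSign]

theorem boolSign_not (b : Bool) : boolSign (!b) = -boolSign b := by cases b <;> simp [boolSign]

theorem expect_fin_succ_bool {n : ℕ} (g : (Fin (n + 1) → Bool) → ℝ) :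
    𝔼 ε, g ε = ((𝔼 ε, g (Fin.cons true ε)) + 𝔼 ε, g (Fin.cons false ε)) / 2 := by
  rw [Fintype.expect_equiv (Fin.consEquiv fun _ => Bool).symm g
    (fun q => g (Fin.cons q.1 q.2)) fun ε => by simp [Fin.consEquiv]]
  rw [← Finset.univ_product_univ, Finset.expect_product, Fintype.expect_eq_sum_div_card]
  simp [add_comm]

theorem exp_mul_two_sub_le {x : ℝ} (h0 : 0 ≤ x) (h1 : x ≤ 1) :
    exp x * (2 - x) ≤ 2 + x := by
  have h := Real.hasSum_log_sub_log_of_abs_lt_one (x := x / 2) (by rw [abs_of_nonneg] <;> linarith)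
  have h2 := h.summable.le_tsum 0 fun k _ => by positivity
  rw [h.tsum_eq, ← Real.log_div (by linarith) (by linarith)] at h2
  have h3 : x ≤ log ((1 + x / 2) / (1 - x / 2)) := by norm_num at h2; linarith
  have h4 := (Real.le_log_iff_exp_le (div_pos (by linarith) (by linarith))).1 h3
  rw [le_div_iff₀ (by linarith)] at h4
  linarith

theorem neg_mul_log_le {r : ℝ} (h0 : 0 < r) (h1 : r ≤ 1) : -(r * log r) ≤ (1 - r ^ 2) / 2 := by
  have h := Real.self_le_sinh_iff.2 (neg_nonneg.2 (Real.log_nonpos h0.le h1))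
  rw [Real.sinh_eq, neg_neg, Real.exp_neg, Real.exp_log h0] at h
  have := mul_le_mul_of_nonneg_left h h0.le
  have e : r * ((r⁻¹ - r) / 2) = (1 - r ^ 2) / 2 := by field_simp
  linarith

theorem two_point_bound {u v G G' : ℝ} (hv : 0 < v) (huv : v ≤ u) (hG : G ≤ 1 / u)
    (hG' : ∀ a, 0 ≤ a → a ≤ 1 → G' ≤ exp (a ^ 2 / 2 - (1 - a) * log v - a * log u)) :
    (G + G') / 2 * ((u + v) / 2) ≤ 1 := by
  have hu : 0 < u := by linarith
  set r := v / u with hr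
  have hr0 : 0 < r := by positivity
  have hr1 : r ≤ 1 := (div_le_one hu).2 huv
  have hlog : log r = log v - log u := Real.log_div hv.ne' hu.ne'
  have h1 := hG' (1 - r) (by linarith) (by linarith)
  have h2 := neg_mul_log_le hr0 hr1
  have h3 : G' ≤ exp (1 - r) / u := by
    refine h1.trans ?_
    rw [show exp (1 - r) / u = exp (1 - r - log u) by
      rw [Real.exp_sub (1 - r), Real.exp_log hu]]
    refine Real.exp_le_exp.2 ?_
    rw [hlog] at h2
    nlinarith
  have h4 := exp_mul_two_sub_le (x := 1 - r) (by linarith) (by linarith)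
  have hv' : v = r * u := by rw [hr]; field_simp
  calc (G + G') / 2 * ((u + v) / 2) ≤ (1 / u + exp (1 - r) / u) / 2 * ((u + v) / 2) := by gcongr
    _ = ((1 + r) + exp (1 - r) * (2 - (1 - r))) / 4 := by rw [hv']; field_simp; ring
    _ ≤ 1 := by linarith

/-- Talagrand's convex concentration on the sign cube, in infimum-convolution form. -/
theorem expect_exp_mul_expect_exp_neg_le_one {n : ℕ} {f : (Fin n → ℝ) → ℝ}
    (hf : ConvexOn ℝ Set.univ f) (hf0 : ∀ y, 0 ≤ f y) {g : (Fin n → Bool) → ℝ}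
    (hg : ∀ ε y, g ε ≤ f y + (∑ i, (boolSign (ε i) - y i) ^ 2) / 8) :
    (𝔼 ε, exp (g ε)) * 𝔼 ε : Fin n → Bool, exp (-f fun i => boolSign (ε i)) ≤ 1 := by
  induction n with
  | zero =>
    have h := hg default (fun i => boolSign ((default : Fin 0 → Bool) i))
    rw [Fintype.expect_eq_sum_div_card, Fintype.expect_eq_sum_div_card]
    simp only [Fintype.sum_unique, Fintype.card_unique, Nat.cast_one, div_one]
    rw [← Real.exp_add, Real.exp_le_one_iff]
    simp only [Finset.univ_eq_empty, Finset.sum_empty, zero_div, add_zero] at h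
    rw [← sub_eq_add_neg, sub_nonpos]
    convert h
  | succ n ih =>
    set F : Bool → (Fin n → ℝ) → ℝ := fun b y => f (Fin.cons (boolSign b) y) with hF
    have hconv : ∀ b, ConvexOn ℝ Set.univ (F b) := by
      intro b
      refine ⟨convex_univ, fun x _ y _ α β hα hβ hαβ => ?_⟩
      have := hf.2 (Set.mem_univ (Fin.cons (boolSign b) x : Fin (n + 1) → ℝ))
        (Set.mem_univ (Fin.cons (boolSign b) y : Fin (n + 1) → ℝ)) hα hβ hαβ
      refine le_trans (le_of_eq ?_) this
      simp only [hF]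
      congr 1
      ext i
      refine Fin.cases ?_ (fun j => ?_) i
      · simp [← add_mul, hαβ]
      · simp
    set q : Bool → (Fin n → Bool) → ℝ := fun b ε =>
      ⨅ y, (F b y + (∑ i, (boolSign (ε i) - y i) ^ 2) / 8) with hq
    have hbdd : ∀ (b : Bool) (ε : Fin n → Bool), BddBelow (Set.range fun y : Fin n → ℝ =>
        F b y + (∑ i, (boolSign (ε i) - y i) ^ 2) / 8) := by
      rintro b ε
      refine ⟨0, ?_⟩
      rintro _ ⟨y, rfl⟩
      have : 0 ≤ F b y := hf0 _
      simp only
      positivity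
    set U : Bool → ℝ := fun b => 𝔼 ε : Fin n → Bool, exp (-F b fun i => boolSign (ε i)) with hU
    have hUpos : ∀ b, 0 < U b := fun b =>
      Finset.expect_pos (fun _ _ => Real.exp_pos _) Finset.univ_nonempty
    have hih : ∀ b, (𝔼 ε, exp (q b ε)) * U b ≤ 1 := fun b =>
      ih (hconv b) (fun _ => hf0 _) fun ε y => ciInf_le (hbdd b ε) y
    have hgq : ∀ b ε a, 0 ≤ a → a ≤ 1 →
        g (Fin.cons b ε) ≤ a ^ 2 / 2 + (1 - a) * q b ε + a * q (!b) ε := by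
      intro b ε a ha0 ha1
      have key : ∀ y₀ y₁ : Fin n → ℝ, g (Fin.cons b ε) ≤ a ^ 2 / 2 +
          (1 - a) * (F b y₀ + (∑ i, (boolSign (ε i) - y₀ i) ^ 2) / 8) +
          a * (F (!b) y₁ + (∑ i, (boolSign (ε i) - y₁ i) ^ 2) / 8) := by
        intro y₀ y₁
        refine (hg (Fin.cons b ε) ((1 - a) • (Fin.cons (boolSign b) y₀ : Fin (n + 1) → ℝ) +
          a • (Fin.cons (boolSign (!b)) y₁ : Fin (n + 1) → ℝ))).trans ?_
        have h1 := hf.2 (Set.mem_univ (Fin.cons (boolSign b) y₀ : Fin (n + 1) → ℝ))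
          (Set.mem_univ (Fin.cons (boolSign (!b)) y₁ : Fin (n + 1) → ℝ))
          (sub_nonneg.2 ha1) ha0 (by ring)
        have h2 : ∑ i, (boolSign (ε i) - ((1 - a) * y₀ i + a * y₁ i)) ^ 2 ≤
            (1 - a) * ∑ i, (boolSign (ε i) - y₀ i) ^ 2 +
              a * ∑ i, (boolSign (ε i) - y₁ i) ^ 2 := by
          rw [Finset.mul_sum, Finset.mul_sum, ← Finset.sum_add_distrib]
          refine Finset.sum_le_sum fun i _ => ?_
          nlinarith [mul_nonneg (mul_nonneg ha0 (sub_nonneg.2 ha1)) (sq_nonneg (y₀ i - y₁ i))]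
        rw [Fin.sum_univ_succ]
        simp only [Fin.cons_zero, Fin.cons_succ, Pi.add_apply, Pi.smul_apply, smul_eq_mul,
          boolSign_not] at h1 ⊢
        have h3 : (boolSign b - ((1 - a) * boolSign b + a * -boolSign b)) ^ 2 = 4 * a ^ 2 := by
          have := boolSign_sq b
          linear_combination 4 * a ^ 2 * this
        rw [h3]
        simp only [hF, boolSign_not]
        linarith
      rcases ha0.eq_or_lt with rfl | ha0'
      · have : g (Fin.cons b ε) ≤ q b ε := le_ciInf fun y => by
          have := key y y
          linarith
        linarith
      rcases ha1.eq_or_lt with rfl | ha1'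
      · have : g (Fin.cons b ε) - 1 / 2 ≤ q (!b) ε := le_ciInf fun y => by
          have := key y y
          linarith
        linarith
      have hb0 : 0 < 1 - a := by linarith
      have h1 : ∀ y₁ : Fin n → ℝ, (g (Fin.cons b ε) - a ^ 2 / 2 -
          a * (F (!b) y₁ + (∑ i, (boolSign (ε i) - y₁ i) ^ 2) / 8)) / (1 - a) ≤ q b ε :=
        fun y₁ => le_ciInf fun y₀ => by
          rw [div_le_iff₀ hb0]
          linarith [key y₀ y₁]
      have h2 : (g (Fin.cons b ε) - a ^ 2 / 2 - (1 - a) * q b ε) / a ≤ q (!b) ε :=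
        le_ciInf fun y₁ => by
          have := h1 y₁
          rw [div_le_iff₀ hb0] at this
          rw [div_le_iff₀ ha0']
          linarith
      rw [div_le_iff₀ ha0'] at h2
      linarith
    have hG : ∀ b a, 0 ≤ a → a ≤ 1 → 𝔼 ε, exp (g (Fin.cons b ε)) ≤
        exp (a ^ 2 / 2 - (1 - a) * log (U b) - a * log (U (!b))) := by
      intro b a ha0 ha1
      have h1 : ∀ ε : Fin n → Bool, exp (g (Fin.cons b ε)) ≤
          exp (a ^ 2 / 2 - (1 - a) * log (U b) - a * log (U (!b))) *
            ((1 - a) * (exp (q b ε) * U b) + a * (exp (q (!b) ε) * U (!b))) := by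
        intro ε
        have hA : ∀ c, exp (q c ε) * U c = exp (q c ε + log (U c)) := fun c => by
          rw [Real.exp_add, Real.exp_log (hUpos c)]
        have hcx := convexOn_exp.2 (Set.mem_univ (q b ε + log (U b)))
          (Set.mem_univ (q (!b) ε + log (U (!b)))) (sub_nonneg.2 ha1) ha0 (by ring)
        rw [hA, hA]
        simp only [smul_eq_mul] at hcx
        refine le_trans ?_ (mul_le_mul_of_nonneg_left hcx (Real.exp_pos _).le)
        rw [← Real.exp_add]
        refine Real.exp_le_exp.2 ((hgq b ε a ha0 ha1).trans_eq ?_)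
        ring
      refine (Finset.expect_le_expect fun ε _ => h1 ε).trans ?_
      rw [← Finset.mul_expect, Finset.expect_add_distrib, ← Finset.mul_expect, ← Finset.mul_expect,
        ← Finset.expect_mul, ← Finset.expect_mul]
      refine mul_le_of_le_one_right (Real.exp_pos _).le ?_
      have := mul_le_mul_of_nonneg_left (hih b) (sub_nonneg.2 ha1)
      have := mul_le_mul_of_nonneg_left (hih (!b)) ha0
      linarith
    have hG0 : ∀ b, 𝔼 ε, exp (g (Fin.cons b ε)) ≤ 1 / U b := fun b => by
      have := hG b 0 le_rfl zero_le_one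
      simpa [Real.exp_neg, Real.exp_log (hUpos b)] using this
    have hsplit : 𝔼 ε : Fin (n + 1) → Bool, exp (-f fun i => boolSign (ε i)) =
        (U true + U false) / 2 := by
      rw [expect_fin_succ_bool]
      have : ∀ (b : Bool) (ε : Fin n → Bool), (fun i => boolSign ((Fin.cons b ε :
          Fin (n + 1) → Bool) i)) = Fin.cons (boolSign b) fun i => boolSign (ε i) := by
        intro b ε
        ext i
        refine Fin.cases ?_ (fun j => ?_) i <;> simp
      simp only [this, hU, hF]
    rw [hsplit, expect_fin_succ_bool]
    rcases le_total (U false) (U true) with h | h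
    · exact two_point_bound (hUpos false) h (hG0 true) (hG false)
    · rw [add_comm (𝔼 ε, _), add_comm (U true)]
      exact two_point_bound (hUpos true) h (hG0 false) (hG true)

end SignCube

section SignMoments

open scoped BigOperators

theorem expect_pow_le_of_expect_exp_le {S : Type*} [Fintype S] {G : S → ℝ} {V : ℝ}
    (hV : 0 < V) (hG : ∀ θ, 𝔼 ε, exp (θ * G ε) ≤ exp (2 * θ ^ 2 * V ^ 2)) {k : ℕ} (hk : 1 ≤ k) :
    𝔼 ε, G ε ^ (2 * k) ≤ (8 * exp 2 * k * V ^ 2) ^ k := by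
  have hk0 : (0 : ℝ) < k := by exact_mod_cast hk
  set θ := √k / V with hθ
  have hθ0 : 0 < θ := by positivity
  have hθ2 : θ ^ 2 * V ^ 2 = k := by
    rw [hθ, div_pow, Real.sq_sqrt hk0.le]; field_simp
  have hθ3 : (θ ^ 2)⁻¹ = V ^ 2 / k := by
    rw [← hθ2]; field_simp
  have h1 : ∀ ε, G ε ^ (2 * k) ≤ (2 * k).factorial * (θ⁻¹) ^ (2 * k) *
      (exp (θ * G ε) + exp (-θ * G ε)) := by
    intro ε
    have h2 := Real.pow_div_factorial_le_exp |θ * G ε| (abs_nonneg _) (2 * k)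
    rw [div_le_iff₀ (by positivity), pow_mul, sq_abs, ← pow_mul, mul_pow] at h2
    have h3 : exp |θ * G ε| ≤ exp (θ * G ε) + exp (-θ * G ε) := by
      rcases abs_cases (θ * G ε) with ⟨h, _⟩ | ⟨h, _⟩ <;> rw [h]
      · linarith [Real.exp_pos (-θ * G ε)]
      · rw [neg_mul]; linarith [Real.exp_pos (θ * G ε)]
    have h4 : θ ^ (2 * k) * G ε ^ (2 * k) ≤ (exp (θ * G ε) + exp (-θ * G ε)) *
        (2 * k).factorial := h2.trans (by gcongr)
    rw [inv_pow]
    calc G ε ^ (2 * k) = (θ ^ (2 * k))⁻¹ * (θ ^ (2 * k) * G ε ^ (2 * k)) := by field_simp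
      _ ≤ (θ ^ (2 * k))⁻¹ * ((exp (θ * G ε) + exp (-θ * G ε)) * (2 * k).factorial) := by gcongr
      _ = _ := by ring
  refine (Finset.expect_le_expect fun ε _ => h1 ε).trans ?_
  rw [← Finset.mul_expect, Finset.expect_add_distrib]
  have h5 := hG θ
  have h6 := hG (-θ)
  rw [neg_sq] at h6
  have h7 : ((2 * k).factorial : ℝ) ≤ (2 * k) ^ (2 * k) := by
    exact_mod_cast Nat.factorial_le_pow (2 * k)
  calc ((2 * k).factorial : ℝ) * (θ⁻¹) ^ (2 * k) *
        ((𝔼 ε, exp (θ * G ε)) + 𝔼 ε, exp (-θ * G ε))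
      ≤ (2 * k) ^ (2 * k) * (θ⁻¹) ^ (2 * k) *
        (exp (2 * θ ^ 2 * V ^ 2) + exp (2 * θ ^ 2 * V ^ 2)) := by gcongr
    _ = 2 * (4 * exp 2 * k * V ^ 2) ^ k := by
      rw [show 2 * θ ^ 2 * V ^ 2 = k * 2 by linear_combination 2 * hθ2, Real.exp_nat_mul, pow_mul,
        pow_mul, inv_pow, hθ3, ← two_mul, mul_left_comm, ← mul_pow, ← mul_pow]
      congr 2
      field_simp
      ring
    _ ≤ 2 ^ k * (4 * exp 2 * k * V ^ 2) ^ k := by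
      gcongr
      exact le_self_pow₀ (by norm_num) (by omega)
    _ = _ := by rw [← mul_pow]; ring

variable {T : Type*} [Fintype T]

theorem expect_exp_sum_boolSign_le [DecidableEq T] (a : T → ℝ) :
    𝔼 ε : T → Bool, exp (∑ i, a i * boolSign (ε i)) ≤ exp ((∑ i, a i ^ 2) / 2) := by
  have h1 : ∑ ε : T → Bool, exp (∑ i, a i * boolSign (ε i)) = ∏ i, (2 * cosh (a i)) := by
    have := Finset.prod_univ_sum (fun _ : T => (Finset.univ : Finset Bool))
      (fun i b => exp (a i * boolSign b))
    rw [Fintype.piFinset_univ] at this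
    simp only [← Real.exp_sum] at this
    rw [← this]
    refine Finset.prod_congr rfl fun i _ => ?_
    rw [Real.cosh_eq]
    simp [boolSign]
    ring
  rw [Fintype.expect_eq_sum_div_card, h1, Finset.prod_mul_distrib, Finset.sum_div, Real.exp_sum]
  simp only [Finset.prod_const, Finset.card_univ, Fintype.card_pi, Fintype.card_bool, Nat.cast_pow,
    Nat.cast_ofNat]
  rw [mul_div_cancel_left₀ _ (by positivity)]
  exact Finset.prod_le_prod (fun i _ => (Real.cosh_pos _).le) fun i _ =>
    Real.cosh_le_exp_half_sq _

theorem expect_sum_boolSign_pow_le [DecidableEq T] (a : T → ℝ) {k : ℕ} (hk : 1 ≤ k) :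
    𝔼 ε : T → Bool, (∑ i, a i * boolSign (ε i)) ^ (2 * k) ≤
      (8 * exp 2 * k * ∑ i, a i ^ 2) ^ k := by
  have h0 : 0 ≤ ∑ i, a i ^ 2 := Finset.sum_nonneg fun i _ => sq_nonneg _
  rcases h0.eq_or_lt with h | h
  · have ha : ∀ i, a i = 0 := fun i => by
      have := (Finset.sum_eq_zero_iff_of_nonneg (fun i _ => sq_nonneg (a i))).1 h.symm i
        (Finset.mem_univ i)
      exact pow_eq_zero_iff (two_ne_zero) |>.1 this
    simp [ha, show k ≠ 0 by omega]
  · have hs := Real.sq_sqrt h0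
    rw [← hs]
    refine expect_pow_le_of_expect_exp_le (Real.sqrt_pos.2 h) (fun θ => ?_) hk
    have := expect_exp_sum_boolSign_le fun i => θ * a i
    simp only [mul_assoc, ← Finset.mul_sum, mul_pow] at this
    refine this.trans (Real.exp_le_exp.2 ?_)
    rw [hs]
    nlinarith [mul_nonneg (sq_nonneg θ) h0]

theorem expect_boolSign_mul_boolSign [DecidableEq T] (s t : T) :
    𝔼 ε : T → Bool, boolSign (ε s) * boolSign (ε t) = if s = t then 1 else 0 := by
  split_ifs with h
  · subst h
    simp [← sq, boolSign_sq]
  · have hinv : Function.Involutive fun (ε : T → Bool) => Function.update ε s (!ε s) := by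
      intro ε
      simp
    have := Fintype.expect_equiv hinv.toPerm (fun ε => boolSign (ε s) * boolSign (ε t))
      (fun ε => -(boolSign (ε s) * boolSign (ε t))) fun ε => by
        simp [Function.update_of_ne (Ne.symm h), boolSign_not]
    rw [Finset.expect_neg_distrib] at this
    linarith

theorem expect_sum_boolSign_sq [DecidableEq T] (a : T → ℝ) :
    𝔼 ε : T → Bool, (∑ i, a i * boolSign (ε i)) ^ 2 = ∑ i, a i ^ 2 := by
  have h1 : ∀ ε : T → Bool, (∑ i, a i * boolSign (ε i)) ^ 2 =
      ∑ i, ∑ j, a i * a j * (boolSign (ε i) * boolSign (ε j)) := by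
    intro ε
    rw [sq, Finset.sum_mul_sum]
    refine Finset.sum_congr rfl fun i _ => Finset.sum_congr rfl fun j _ => ?_
    ring
  simp only [h1, Finset.expect_sum_comm, ← Finset.mul_expect, expect_boolSign_mul_boolSign]
  simp [sq]

theorem expect_exp_mul_expect_exp_neg_seminorm_le [DecidableEq T] (F : Seminorm ℝ (T → ℝ))
    {σ : ℝ} (hF : ∀ z, F z ≤ σ * √(∑ i, z i ^ 2)) {θ : ℝ} (hθ : 0 ≤ θ) :
    (𝔼 ε : T → Bool, exp (θ * F fun i => boolSign (ε i))) *
      (𝔼 ε : T → Bool, exp (-(θ * F fun i => boolSign (ε i)))) ≤ exp (2 * θ ^ 2 * σ ^ 2) := by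
  set e := Fintype.equivFin T
  have hconv : ConvexOn ℝ Set.univ fun y : Fin (Fintype.card T) → ℝ => θ * F fun t => y (e t) := by
    refine ⟨convex_univ, fun x _ y _ a b ha hb hab => ?_⟩
    have h1 := map_add_le_add F (a • fun t => x (e t)) (b • fun t => y (e t))
    rw [map_smul_eq_mul, map_smul_eq_mul, Real.norm_of_nonneg ha, Real.norm_of_nonneg hb] at h1
    have h2 := mul_le_mul_of_nonneg_left h1 hθ
    refine le_trans (le_of_eq ?_) (h2.trans_eq ?_)
    · rfl
    · simp only [smul_eq_mul]; ring
  have h := expect_exp_mul_expect_exp_neg_le_one hconv (fun y => mul_nonneg hθ (apply_nonneg _ _))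
    (g := fun ε => θ * (F fun t => boolSign (ε (e t))) - 2 * θ ^ 2 * σ ^ 2) fun ε y => by
      have h1 := map_add_le_add F (fun t => y (e t)) (fun t => boolSign (ε (e t)) - y (e t))
      have h2 : ((fun t => y (e t)) + fun t => boolSign (ε (e t)) - y (e t)) =
          fun t => boolSign (ε (e t)) := by ext; simp
      have h3 := hF fun t => boolSign (ε (e t)) - y (e t)
      rw [e.sum_comp fun i => (boolSign (ε i) - y i) ^ 2] at h3
      have h4 : 0 ≤ ∑ i, (boolSign (ε i) - y i) ^ 2 := Finset.sum_nonneg fun i _ => sq_nonneg _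
      have h5 := Real.sq_sqrt h4
      rw [h2] at h1
      have h6 := mul_le_mul_of_nonneg_left (h1.trans (add_le_add_right h3 _)) hθ
      nlinarith [sq_nonneg (4 * θ * σ - √(∑ i, (boolSign (ε i) - y i) ^ 2))]
  have ht : ∀ G : (T → ℝ) → ℝ, 𝔼 ε : Fin (Fintype.card T) → Bool, G (fun t => boolSign (ε (e t))) =
      𝔼 ε : T → Bool, G fun i => boolSign (ε i) := fun G =>
    Fintype.expect_equiv (e.arrowCongr (Equiv.refl Bool)).symm _ _ fun ε => rfl
  rw [ht fun z => exp (θ * F z - 2 * θ ^ 2 * σ ^ 2), ht fun z => exp (-(θ * F z))] at h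
  simp only [Real.exp_sub, div_eq_mul_inv, ← Finset.expect_mul] at h
  have := mul_le_mul_of_nonneg_right h (Real.exp_pos (2 * θ ^ 2 * σ ^ 2)).le
  refine le_trans (le_of_eq ?_) (this.trans_eq (one_mul _))
  field_simp

theorem exp_expect_le {S : Type*} [Fintype S] [Nonempty S] (G : S → ℝ) :
    exp (𝔼 ε, G ε) ≤ 𝔼 ε, exp (G ε) := by
  have : ∀ ε, exp (𝔼 ε, G ε) * (1 + (G ε - 𝔼 ε, G ε)) ≤ exp (G ε) := fun ε => by
    have h := Real.add_one_le_exp (G ε - 𝔼 ε, G ε)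
    calc _ ≤ exp (𝔼 ε, G ε) * exp (G ε - 𝔼 ε, G ε) := by gcongr; linarith
      _ = exp (G ε) := by rw [← Real.exp_add]; ring_nf
  refine le_trans (le_of_eq ?_) (Finset.expect_le_expect fun ε _ => this ε)
  rw [← Finset.mul_expect, Finset.expect_add_distrib, Finset.expect_sub_distrib]
  simp

theorem expect_exp_seminorm_sub_le [DecidableEq T] (F : Seminorm ℝ (T → ℝ))
    {σ : ℝ} (hF : ∀ z, F z ≤ σ * √(∑ i, z i ^ 2)) (θ : ℝ) :
    𝔼 ε : T → Bool, exp (θ * ((F fun i => boolSign (ε i)) -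
      𝔼 ε : T → Bool, F fun i => boolSign (ε i))) ≤ exp (2 * θ ^ 2 * σ ^ 2) := by
  set m := 𝔼 ε : T → Bool, F fun i => boolSign (ε i) with hm
  have hJ : ∀ c : ℝ, exp (c * m) ≤ 𝔼 ε : T → Bool, exp (c * F fun i => boolSign (ε i)) := by
    intro c
    rw [hm, Finset.mul_expect]
    exact exp_expect_le _
  have hsplit : 𝔼 ε : T → Bool, exp (θ * ((F fun i => boolSign (ε i)) - m)) =
      (𝔼 ε : T → Bool, exp (θ * F fun i => boolSign (ε i))) * exp (-θ * m) := by
    rw [Finset.expect_mul]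
    refine Finset.expect_congr rfl fun ε _ => ?_
    rw [← Real.exp_add]; ring_nf
  rw [hsplit]
  have hpos : ∀ c : ℝ, 0 ≤ 𝔼 ε : T → Bool, exp (c * F fun i => boolSign (ε i)) := fun c =>
    Finset.expect_nonneg fun _ _ => (Real.exp_pos _).le
  refine (mul_le_mul_of_nonneg_left (hJ (-θ)) (hpos θ)).trans ?_
  rcases le_total 0 θ with h | h
  · simpa only [neg_mul] using expect_exp_mul_expect_exp_neg_seminorm_le F hF h
  · have := expect_exp_mul_expect_exp_neg_seminorm_le F hF (neg_nonneg.2 h)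
    rw [mul_comm]
    simpa only [neg_mul, neg_neg, neg_sq] using this

theorem expect_indicator_seminorm_le [DecidableEq T] (F : Seminorm ℝ (T → ℝ))
    {σ : ℝ} (hσ : 0 < σ) (hF : ∀ z, F z ≤ σ * √(∑ i, z i ^ 2)) {u : ℝ} (hu : 0 ≤ u) :
    𝔼 ε : T → Bool, (if u ≤ |(F fun i => boolSign (ε i)) -
      𝔼 ε : T → Bool, F fun i => boolSign (ε i)| then (1 : ℝ) else 0) ≤
        2 * exp (-(u ^ 2 / (8 * σ ^ 2))) := by
  set m := 𝔼 ε : T → Bool, F fun i => boolSign (ε i) with hm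
  set θ := u / (4 * σ ^ 2) with hθ
  have hθ0 : 0 ≤ θ := by positivity
  have h1 : ∀ ε : T → Bool, (if u ≤ |(F fun i => boolSign (ε i)) - m| then (1 : ℝ) else 0) ≤
      exp (-(θ * u)) * (exp (θ * ((F fun i => boolSign (ε i)) - m)) +
        exp (-θ * ((F fun i => boolSign (ε i)) - m))) := by
    intro ε
    rw [mul_add, ← Real.exp_add, ← Real.exp_add]
    split_ifs with h
    · rcases le_abs.1 h with h | h
      · have : 1 ≤ exp (-(θ * u) + θ * ((F fun i => boolSign (ε i)) - m)) :=
          Real.one_le_exp (by nlinarith)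
        linarith [Real.exp_pos (-(θ * u) + -θ * ((F fun i => boolSign (ε i)) - m))]
      · have : 1 ≤ exp (-(θ * u) + -θ * ((F fun i => boolSign (ε i)) - m)) :=
          Real.one_le_exp (by nlinarith)
        linarith [Real.exp_pos (-(θ * u) + θ * ((F fun i => boolSign (ε i)) - m))]
    · positivity
  refine (Finset.expect_le_expect fun ε _ => h1 ε).trans ?_
  rw [← Finset.mul_expect, Finset.expect_add_distrib]
  have h2 := expect_exp_seminorm_sub_le F hF θ
  have h3 := expect_exp_seminorm_sub_le F hF (-θ)
  rw [neg_sq] at h3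
  calc _ ≤ exp (-(θ * u)) * (exp (2 * θ ^ 2 * σ ^ 2) + exp (2 * θ ^ 2 * σ ^ 2)) := by gcongr
    _ = 2 * (exp (-(θ * u)) * exp (2 * θ ^ 2 * σ ^ 2)) := by ring
    _ = _ := by
      rw [← Real.exp_add]
      congr 2
      rw [hθ]
      field_simp
      ring

theorem choose_two_mul_le_pow_add_pow (S x : ℝ) (j : ℕ) :
    ((2 * j + 2).choose 2 : ℝ) * (S ^ (2 * j) * x ^ 2) ≤
      ((S + x) ^ (2 * j + 2) + (S + -x) ^ (2 * j + 2)) / 2 := by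
  rw [add_pow, add_pow, ← Finset.sum_add_distrib, Finset.sum_div]
  have h0 : ∀ i ∈ Finset.range (2 * j + 2 + 1), 0 ≤ (S ^ i * x ^ (2 * j + 2 - i) *
      ((2 * j + 2).choose i) + S ^ i * (-x) ^ (2 * j + 2 - i) * ((2 * j + 2).choose i)) / 2 := by
    intro i hi
    have hi' : i ≤ 2 * j + 2 := by simpa [Nat.lt_succ_iff] using hi
    rcases Nat.even_or_odd i with he | ho
    · have he' : Even (2 * j + 2 - i) := by
        rw [Nat.even_sub hi']; exact iff_of_true ⟨j + 1, by ring⟩ he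
      rw [he'.neg_pow]
      have := he.pow_nonneg S
      have := he'.pow_nonneg x
      positivity
    · have ho' : Odd (2 * j + 2 - i) := by
        rw [Nat.odd_sub hi']
        exact iff_of_false (by simp [Nat.not_odd_iff_even]; exact ⟨j + 1, by ring⟩)
          (by simpa using ho)
      rw [ho'.neg_pow]
      exact le_of_eq (by ring)
  refine le_trans (le_of_eq ?_) (Finset.single_le_sum h0 (a := 2 * j) (by simp))
  rw [show 2 * j + 2 - 2 * j = 2 by omega, neg_sq,
    Nat.choose_symm_of_eq_add (show 2 * j + 2 = 2 + 2 * j by ring)]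
  ring

/-- Moments of a sum of `j` independent symmetric variables: the multilinear term. -/
theorem factorial_mul_le_expect_sum_pow {S : Type*} [Fintype S] [Nonempty S] {ξ : S → ℝ}
    {τ : S → S} (hτ : Function.Involutive τ) (hξ : ∀ s, ξ (τ s) = -ξ s) (j : ℕ) :
    ((2 * j).factorial : ℝ) / 2 ^ j * (𝔼 s, ξ s ^ 2) ^ j ≤
      𝔼 ω : Fin j → S, (∑ l, ξ (ω l)) ^ (2 * j) := by
  induction j with
  | zero => simp
  | succ j ih =>
    have hcons : 𝔼 ω : Fin (j + 1) → S, (∑ l, ξ (ω l)) ^ (2 * (j + 1)) =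
        𝔼 s, 𝔼 ω : Fin j → S, ((∑ l, ξ (ω l)) + ξ s) ^ (2 * j + 2) := by
      rw [Fintype.expect_equiv (Fin.consEquiv fun _ => S).symm _
        (fun q => ((∑ l, ξ (q.2 l)) + ξ q.1) ^ (2 * j + 2)) fun ω => by
          rw [Fin.sum_univ_succ, add_comm]; rfl]
      rw [← Finset.univ_product_univ, Finset.expect_product]
    have hflip : 𝔼 s, 𝔼 ω : Fin j → S, ((∑ l, ξ (ω l)) + ξ s) ^ (2 * j + 2) =
        𝔼 s, 𝔼 ω : Fin j → S, ((∑ l, ξ (ω l)) + -ξ s) ^ (2 * j + 2) :=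
      Fintype.expect_equiv hτ.toPerm _ _ fun s => by simp [hξ]
    have hfac : ((2 * (j + 1)).factorial : ℝ) / 2 ^ (j + 1) =
        (2 * j + 2).choose 2 * ((2 * j).factorial / 2 ^ j) := by
      rw [Nat.cast_choose_two, show 2 * (j + 1) = 2 * j + 1 + 1 by ring, Nat.factorial_succ,
        Nat.factorial_succ]
      push_cast
      field_simp
      ring
    rw [hcons, hfac]
    calc ((2 * j + 2).choose 2 : ℝ) * ((2 * j).factorial / 2 ^ j) * (𝔼 s, ξ s ^ 2) ^ (j + 1)
        = (2 * j + 2).choose 2 * (((2 * j).factorial / 2 ^ j * (𝔼 s, ξ s ^ 2) ^ j) *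
          𝔼 s, ξ s ^ 2) := by ring
      _ ≤ (2 * j + 2).choose 2 * ((𝔼 ω : Fin j → S, (∑ l, ξ (ω l)) ^ (2 * j)) *
          𝔼 s, ξ s ^ 2) := by
        have : 0 ≤ 𝔼 s, ξ s ^ 2 := Finset.expect_nonneg fun _ _ => sq_nonneg _
        gcongr
      _ = 𝔼 s, 𝔼 ω : Fin j → S, ((2 * j + 2).choose 2 : ℝ) *
          ((∑ l, ξ (ω l)) ^ (2 * j) * ξ s ^ 2) := by
        simp only [← Finset.mul_expect, ← Finset.expect_mul]
      _ ≤ 𝔼 s, 𝔼 ω : Fin j → S, (((∑ l, ξ (ω l)) + ξ s) ^ (2 * j + 2) +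
          ((∑ l, ξ (ω l)) + -ξ s) ^ (2 * j + 2)) / 2 :=
        Finset.expect_le_expect fun s _ => Finset.expect_le_expect fun ω _ =>
          choose_two_mul_le_pow_add_pow _ _ _
      _ = _ := by
        simp only [← Finset.expect_div, Finset.expect_add_distrib]
        rw [← hflip]
        ring

end SignMoments

section NetsAndMoments

section Net

variable {E : Type*} [NormedAddCommGroup E] [NormedSpace ℝ E]

theorem card_le_of_separated_unit [FiniteDimensional ℝ E] {δ : ℝ} (hδ : 0 < δ) (s : Finset E)
    (hs : ∀ c ∈ s, ‖c‖ = 1) (h : ∀ c ∈ s, ∀ d ∈ s, c ≠ d → δ ≤ ‖c - d‖) :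
    (s.card : ℝ) ≤ (1 + 2 / δ) ^ Module.finrank ℝ E := by
  borelize E
  let μ : Measure E := Measure.addHaar
  have hρ : 0 < 1 + δ / 2 := by positivity
  have hδ2 : 0 < δ / 2 := by positivity
  have hD : Set.Pairwise (s : Set E) (Function.onFun Disjoint fun c => Metric.ball c (δ / 2)) := by
    rintro c hc d hd hcd
    refine Metric.ball_disjoint_ball ?_
    rw [dist_eq_norm]
    linarith [h c hc d hd hcd]
  have hsub : (⋃ c ∈ s, Metric.ball c (δ / 2)) ⊆ Metric.ball (0 : E) (1 + δ / 2) := by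
    refine Set.iUnion₂_subset fun x hx => Metric.ball_subset_ball' ?_
    rw [dist_zero_right, hs x hx]
    linarith
  have h1 : (s.card : ℝ≥0∞) * ENNReal.ofReal ((δ / 2) ^ Module.finrank ℝ E) * μ (Metric.ball 0 1) ≤
      ENNReal.ofReal ((1 + δ / 2) ^ Module.finrank ℝ E) * μ (Metric.ball 0 1) := by
    rw [← Measure.addHaar_ball_of_pos μ 0 hρ]
    refine le_trans (le_of_eq ?_) (measure_mono hsub)
    rw [measure_biUnion_finset hD fun c _ => measurableSet_ball]
    simp only [μ.addHaar_ball_of_pos _ hδ2, Finset.sum_const, nsmul_eq_mul, mul_assoc]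
  have h2 := (ENNReal.mul_le_mul_iff_left (Metric.measure_ball_pos μ _ zero_lt_one).ne'
    measure_ball_lt_top.ne).1 h1
  have h3 := ENNReal.toReal_le_of_le_ofReal (by positivity) h2
  rw [ENNReal.toReal_mul, ENNReal.toReal_natCast, ENNReal.toReal_ofReal (by positivity)] at h3
  rw [← le_div_iff₀ (by positivity), ← div_pow] at h3
  refine h3.trans_eq ?_
  congr 1
  field_simp
  ring

theorem exists_finset_net_unit [FiniteDimensional ℝ E] {δ : ℝ} (hδ : 0 < δ) :
    ∃ N : Finset E, (∀ t ∈ N, ‖t‖ = 1) ∧ (∀ t, ‖t‖ = 1 → ∃ s ∈ N, ‖t - s‖ ≤ δ) ∧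
      (N.card : ℝ) ≤ (1 + 2 / δ) ^ Module.finrank ℝ E := by
  classical
  set P : ℕ → Prop := fun m => ∃ s : Finset E, (∀ c ∈ s, ‖c‖ = 1) ∧
    (∀ c ∈ s, ∀ d ∈ s, c ≠ d → δ ≤ ‖c - d‖) ∧ s.card = m with hP
  set B := ⌊(1 + 2 / δ) ^ Module.finrank ℝ E⌋₊ with hB
  have hPB : ∀ m, P m → m ≤ B := by
    rintro m ⟨s, h1, h2, rfl⟩
    exact Nat.le_floor (card_le_of_separated_unit hδ s h1 h2)
  have h0 : P 0 := ⟨∅, by simp, by simp, rfl⟩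
  obtain ⟨s, h1, h2, h3⟩ := Nat.findGreatest_spec (P := P) (Nat.zero_le B) h0
  refine ⟨s, h1, fun t ht => ?_, card_le_of_separated_unit hδ s h1 h2⟩
  by_contra! hno
  have hts : t ∉ s := fun h => by
    have := hno t h
    simp at this
    linarith
  have hbig : P (s.card + 1) := by
    refine ⟨insert t s, ?_, ?_, Finset.card_insert_of_notMem hts⟩
    · intro c hc
      rcases Finset.mem_insert.1 hc with rfl | hc
      · exact ht
      · exact h1 c hc
    · intro c hc d hd hcd
      rcases Finset.mem_insert.1 hc with hct | hcs <;>
        rcases Finset.mem_insert.1 hd with hdt | hds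
      · exact absurd (hct.trans hdt.symm) hcd
      · rw [hct]; exact (hno d hds).le
      · rw [hdt, norm_sub_rev]; exact (hno c hcs).le
      · exact h2 c hcs d hds hcd
  have := Nat.le_findGreatest (hPB _ hbig) hbig
  omega

theorem sub_le_seminorm_of_net (g : Seminorm ℝ E) {M a b δ : ℝ} (hM : ∀ t, g t ≤ M * ‖t‖)
    (hδ : δ ≤ 1 / 2) {N : Finset E} (hN : ∀ t, ‖t‖ = 1 → ∃ s ∈ N, ‖t - s‖ ≤ δ)
    (ha : ∀ t ∈ N, a ≤ g t) (hb : ∀ t ∈ N, g t ≤ b) {t : E} (ht : ‖t‖ = 1) :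
    a - 2 * b * δ ≤ g t := by
  set S := sSup (g '' Metric.sphere (0 : E) 1) with hS
  have hbdd : BddAbove (g '' Metric.sphere (0 : E) 1) := by
    refine ⟨M, ?_⟩
    rintro _ ⟨t, ht, rfl⟩
    have := hM t
    rwa [mem_sphere_zero_iff_norm.1 ht, mul_one] at this
  have hle : ∀ x : E, g x ≤ S * ‖x‖ := by
    intro x
    rcases eq_or_ne x 0 with rfl | hx
    · simp
    · have hx' : 0 < ‖x‖ := norm_pos_iff.2 hx
      have := le_csSup hbdd ⟨‖x‖⁻¹ • x, by
        rw [mem_sphere_zero_iff_norm, norm_smul]; simp [hx], rfl⟩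
      rw [map_smul_eq_mul, norm_inv, norm_norm, inv_mul_le_iff₀ hx'] at this
      linarith
  have hS0 : 0 ≤ S := by
    have h1 := hle t
    rw [ht, mul_one] at h1
    exact (apply_nonneg g t).trans h1
  have hδ0 : ∀ x : E, ‖x‖ ≤ δ → g x ≤ S * δ := fun x hx => (hle x).trans (by gcongr)
  have hS2 : S ≤ b + S * δ := by
    refine csSup_le ⟨g t, t, mem_sphere_zero_iff_norm.2 ht, rfl⟩ ?_
    rintro _ ⟨u, hu, rfl⟩
    obtain ⟨s, hs, hus⟩ := hN u (mem_sphere_zero_iff_norm.1 hu)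
    have h1 := map_add_le_add g s (u - s)
    rw [add_sub_cancel] at h1
    linarith [hb s hs, hδ0 _ hus]
  obtain ⟨s, hs, hus⟩ := hN t ht
  have h1 := map_add_le_add g t (s - t)
  rw [add_sub_cancel] at h1
  have h2 := hδ0 (s - t) (by rwa [norm_sub_rev])
  have h3 := ha s hs
  have hδn : 0 ≤ δ := (norm_nonneg _).trans hus
  have h4 : S ≤ 2 * b := by nlinarith
  have h5 := mul_le_mul_of_nonneg_right h4 hδn
  linarith

end Net

theorem paley_zygmund_pow {S : Type*} [MeasurableSpace S] {ν : Measure S} [IsProbabilityMeasure ν]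
    {ξ : S → ℝ} (hξ : Measurable ξ) {k : ℕ} (hk : 1 ≤ k) {b D : ℝ} (hb : 0 < b) (hD : 0 < D)
    (hi : Integrable (fun y => ξ y ^ (2 * k)) ν) (hi2 : Integrable (fun y => ξ y ^ (4 * k)) ν)
    (h1 : b ^ (2 * k) ≤ ∫ y, ξ y ^ (2 * k) ∂ν)
    (h2 : ∫ y, ξ y ^ (4 * k) ∂ν ≤ D * b ^ (4 * k)) :
    1 / (8 * D) ≤ ν.real {y | b / 2 ≤ |ξ y|} := by
  set β := b ^ (2 * k) with hβ
  have hβ0 : 0 < β := by positivity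
  set L := 4 * D * β with hL
  have hL0 : 0 < L := by positivity
  set A := {y | b / 2 ≤ |ξ y|} with hA
  have hAm : MeasurableSet A := measurableSet_le measurable_const hξ.abs
  have hpt : ∀ y, ξ y ^ (2 * k) ≤ (β / 4 + A.indicator (fun _ => L) y) + ξ y ^ (4 * k) / L := by
    intro y
    have hsq : ξ y ^ (4 * k) = (ξ y ^ (2 * k)) ^ 2 := by rw [← pow_mul]; ring_nf
    have h0 : 0 ≤ ξ y ^ (2 * k) := (even_two_mul k).pow_nonneg _
    rw [hsq]
    by_cases hy : y ∈ A
    · rw [Set.indicator_of_mem hy]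
      have : ξ y ^ (2 * k) ≤ L + (ξ y ^ (2 * k)) ^ 2 / L := by
        rw [← sub_nonneg]
        have e : L + (ξ y ^ (2 * k)) ^ 2 / L - ξ y ^ (2 * k) =
            ((L - ξ y ^ (2 * k)) ^ 2 + L * ξ y ^ (2 * k)) / L := by field_simp; ring
        rw [e]
        positivity
      linarith
    · rw [Set.indicator_of_notMem hy]
      have hlt : |ξ y| ≤ b / 2 := (not_le.1 hy).le
      have h3 : ξ y ^ (2 * k) ≤ β / 4 := by
        rw [← (even_two_mul k).pow_abs]
        calc |ξ y| ^ (2 * k) ≤ (b / 2) ^ (2 * k) := by gcongr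
          _ = β * (1 / 2) ^ (2 * k) := by rw [hβ, ← mul_pow]; ring
          _ ≤ β * (1 / 2) ^ 2 := by
            refine mul_le_mul_of_nonneg_left ?_ hβ0.le
            exact pow_le_pow_of_le_one (by norm_num) (by norm_num) (by omega)
          _ = β / 4 := by ring
      have : 0 ≤ (ξ y ^ (2 * k)) ^ 2 / L := by positivity
      linarith
  have hint := integral_mono hi (((integrable_const (β / 4)).add
    ((integrable_const L).indicator hAm)).add (hi2.div_const L)) hpt
  have hint' : ∫ y, ξ y ^ (2 * k) ∂ν ≤ β / 4 + ν.real A * L + (∫ y, ξ y ^ (4 * k) ∂ν) / L := by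
    have e1 := integral_add ((integrable_const (μ := ν) (β / 4)).add
      ((integrable_const L).indicator hAm)) (hi2.div_const L)
    have e2 := integral_add (integrable_const (μ := ν) (β / 4))
      ((integrable_const L).indicator hAm)
    rw [integral_indicator_const _ hAm, integral_const] at e2
    simp only [Pi.add_apply] at e1
    refine (hint.trans_eq e1).trans_eq ?_
    rw [e2, integral_div]
    simp
  have h3 : (∫ y, ξ y ^ (4 * k) ∂ν) / L ≤ β / 4 := by
    rw [div_le_iff₀ hL0]
    refine h2.trans_eq ?_
    rw [hL, hβ, show 4 * k = 2 * k + 2 * k by ring, pow_add]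
    ring
  have h4 : β / 2 ≤ ν.real A * L := by linarith
  rw [div_le_iff₀ (by positivity)]
  rw [hL] at h4
  have : β * 1 ≤ β * (ν.real A * (8 * D)) := by linarith
  exact le_of_mul_le_mul_left this hβ0

/-- The seminorm `x ↦ ‖⟪x, ·⟫‖_{L^p(ν)}`. -/
def marginalSeminorm {E : Type*} [NormedAddCommGroup E] [InnerProductSpace ℝ E]
    [MeasurableSpace E] (ν : Measure E) (p : ℝ≥0∞) (hp : 1 ≤ p) (h : MemLp id p ν) :
    Seminorm ℝ E :=
  Seminorm.of (fun x => lpNorm (fun y => ⟪x, y⟫) p ν)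
    (fun x y => by
      have := lpNorm_add_le (g := fun z => ⟪y, z⟫) (h.const_inner x) hp
      simp only [inner_add_left]
      exact this)
    fun a x => by
      have := lpNorm_const_smul (p := p) a (fun z => ⟪x, z⟫) ν
      simp only [inner_smul_left, conj_trivial]
      exact this

theorem marginalSeminorm_pow {E : Type*} [NormedAddCommGroup E] [InnerProductSpace ℝ E]
    [MeasurableSpace E] {ν : Measure E} {k : ℕ} (hk : 1 ≤ k) (hp : 1 ≤ ((2 * k : ℕ) : ℝ≥0∞))
    (h : MemLp id ((2 * k : ℕ) : ℝ≥0∞) ν) (x : E) :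
    marginalSeminorm ν _ hp h x ^ (2 * k) = ∫ y, ⟪x, y⟫ ^ (2 * k) ∂ν := by
  have h0 : ((2 * k : ℕ) : ℝ) ≠ 0 := by
    have : (2 * k : ℕ) ≠ 0 := by omega
    exact_mod_cast this
  change lpNorm (fun y => ⟪x, y⟫) ((2 * k : ℕ) : ℝ≥0∞) ν ^ (2 * k) = _
  rw [lpNorm_eq_integral_norm_rpow_toReal (by exact_mod_cast h0) (ENNReal.natCast_ne_top _)
    (h.const_inner x).1, ENNReal.toReal_natCast]
  simp only [Real.rpow_natCast, Real.norm_eq_abs, (even_two_mul k).pow_abs]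
  rw [← Real.rpow_natCast, ← Real.rpow_mul (integral_nonneg fun y => (even_two_mul k).pow_nonneg _),
    inv_mul_cancel₀ h0, Real.rpow_one]

end NetsAndMoments

section BlockMap

open scoped BigOperators

theorem LogConcaveMeasure.integral_abs_inner_pow_le {E : Type*} [NormedAddCommGroup E]
    [InnerProductSpace ℝ E] [MeasurableSpace E] [BorelSpace E] {ν : Measure E}
    [IsProbabilityMeasure ν] (h : LogConcaveMeasure ν) (x : E) {q a : ℝ} (hq : 1 ≤ q) (ha : 0 < a)
    (hi : Integrable (fun y => |⟪x, y⟫| ^ q) ν) (hm : ∫ y, |⟪x, y⟫| ^ q ∂ν ≤ a ^ q)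
    {N : ℕ} (hN : q ≤ N) :
    Integrable (fun y => |⟪x, y⟫| ^ N) ν ∧
      ∫ y, |⟪x, y⟫| ^ N ∂ν ≤ (exp 4 * a * N / q) ^ N := by
  have hT : Measurable (innerSL ℝ x) := (innerSL ℝ x).continuous.measurable
  have : IsProbabilityMeasure (ν.map (innerSL ℝ x)) :=
    Measure.isProbabilityMeasure_map hT.aemeasurable
  have key := (h.map (innerSL ℝ x)).lintegral_abs_pow_le hq ha (by
    rw [lintegral_map (by fun_prop) hT]
    simp only [innerSL_apply_apply]
    rw [← ofReal_integral_eq_lintegral_ofReal hi (ae_of_all _ fun y => by positivity)]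
    exact ENNReal.ofReal_le_ofReal hm) hN
  rw [lintegral_map (by fun_prop) hT] at key
  simp only [innerSL_apply_apply] at key
  have hmeas : Measurable fun y => |⟪x, y⟫| ^ N := by
    have : Measurable fun y => ⟪x, y⟫ := hT
    exact this.abs.pow_const N
  have hint : Integrable (fun y => |⟪x, y⟫| ^ N) ν := by
    refine ⟨hmeas.aestronglyMeasurable, ?_⟩
    rw [hasFiniteIntegral_iff_ofReal (ae_of_all _ fun y => by positivity)]
    exact key.trans_lt ENNReal.ofReal_lt_top
  refine ⟨hint, ?_⟩
  rw [← ofReal_integral_eq_lintegral_ofReal hint (ae_of_all _ fun y => by positivity)] at key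
  have hq0 : 0 < q := by linarith
  exact (ENNReal.ofReal_le_ofReal_iff (by positivity)).1 key

variable {ι : Type*} [Fintype ι] (k : ℕ)

/-- The sum of `k` matrices with entries `(√k)⁻¹ * z (l, i, j)`, as a bilinear map of the
entries and the argument. -/
def blockMap : (Fin k × (ι × Fin k) → ℝ) →ₗ[ℝ] EuclideanSpace ℝ (Fin k) →ₗ[ℝ]
    EuclideanSpace ℝ ι :=
  LinearMap.mk₂ ℝ (fun z t => WithLp.toLp 2 fun i => ∑ l, ∑ j, (√k)⁻¹ * z (l, i, j) * t j)
    (fun z w t => by ext i; simp [mul_add, add_mul, Finset.sum_add_distrib])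
    (fun c z t => by ext i; simp [Finset.mul_sum, mul_assoc, mul_left_comm])
    (fun z t s => by ext i; simp [mul_add, Finset.sum_add_distrib])
    (fun c z t => by ext i; simp [Finset.mul_sum, mul_assoc, mul_left_comm])

/-- The coefficient of `z (l, i, j)` in `⟪blockMap k z t, y⟫`. -/
def blockCoeff (t : EuclideanSpace ℝ (Fin k)) (y : EuclideanSpace ℝ ι)
    (s : Fin k × (ι × Fin k)) : ℝ := (√k)⁻¹ * (y s.2.1 * t s.2.2)

theorem inner_blockMap (z : Fin k × (ι × Fin k) → ℝ) (t : EuclideanSpace ℝ (Fin k))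
    (y : EuclideanSpace ℝ ι) :
    ⟪blockMap k z t, y⟫ = ∑ s, blockCoeff k t y s * z s := by
  simp only [blockMap, LinearMap.mk₂_apply, PiLp.inner_apply, blockCoeff, Fintype.sum_prod_type]
  rw [Finset.sum_comm]
  refine Finset.sum_congr rfl fun i _ => ?_
  simp only [Finset.mul_sum, conj_trivial, RCLike.inner_apply]
  exact Finset.sum_congr rfl fun l _ => Finset.sum_congr rfl fun j _ => by ring

theorem sum_sq_mul_sq (t : EuclideanSpace ℝ (Fin k)) (y : EuclideanSpace ℝ ι) :
    ∑ s : ι × Fin k, (y s.1 * t s.2) ^ 2 = ‖y‖ ^ 2 * ‖t‖ ^ 2 := by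
  rw [EuclideanSpace.real_norm_sq_eq, EuclideanSpace.real_norm_sq_eq, Finset.sum_mul_sum,
    Fintype.sum_prod_type]
  simp only [mul_pow]

theorem sum_blockCoeff_sq (hk : 1 ≤ k) (t : EuclideanSpace ℝ (Fin k)) (y : EuclideanSpace ℝ ι) :
    ∑ s, blockCoeff k t y s ^ 2 = ‖y‖ ^ 2 * ‖t‖ ^ 2 := by
  have hk0 : (0 : ℝ) < k := by exact_mod_cast hk
  simp only [blockCoeff, mul_pow, inv_pow, Real.sq_sqrt hk0.le]
  rw [Fintype.sum_prod_type]
  simp only [← mul_pow, ← Finset.mul_sum, sum_sq_mul_sq]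
  simp
  field_simp

theorem norm_blockMap_le (hk : 1 ≤ k) (z : Fin k × (ι × Fin k) → ℝ)
    (t : EuclideanSpace ℝ (Fin k)) : ‖blockMap k z t‖ ≤ √(∑ s, z s ^ 2) * ‖t‖ := by
  set y := blockMap k z t with hy
  have h1 : ‖y‖ ^ 2 ≤ ‖y‖ * (√(∑ s, z s ^ 2) * ‖t‖) := by
    rw [← real_inner_self_eq_norm_sq]
    nth_rewrite 1 [hy]
    rw [inner_blockMap]
    refine (Real.sum_mul_le_sqrt_mul_sqrt _ _ _).trans_eq ?_
    rw [sum_blockCoeff_sq k hk, ← mul_pow, Real.sqrt_sq (by positivity)]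
    ring
  rcases (norm_nonneg y).eq_or_lt with h | h
  · rw [← h]; positivity
  · rw [sq] at h1
    exact le_of_mul_le_mul_left h1 h

variable [DecidableEq ι]

theorem expect_inner_blockMap_sq (hk : 1 ≤ k) (t : EuclideanSpace ℝ (Fin k))
    (y : EuclideanSpace ℝ ι) :
    𝔼 ε : Fin k × (ι × Fin k) → Bool, ⟪blockMap k (fun s => boolSign (ε s)) t, y⟫ ^ 2 =
      ‖y‖ ^ 2 * ‖t‖ ^ 2 := by
  simp only [inner_blockMap]
  rw [expect_sum_boolSign_sq, sum_blockCoeff_sq k hk]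

theorem expect_inner_blockMap_pow_le (hk : 1 ≤ k) {t : EuclideanSpace ℝ (Fin k)} (ht : ‖t‖ = 1)
    (y : EuclideanSpace ℝ ι) :
    𝔼 ε : Fin k × (ι × Fin k) → Bool, ⟪blockMap k (fun s => boolSign (ε s)) t, y⟫ ^ (2 * k) ≤
      (8 * exp 2 * k) ^ k * ‖y‖ ^ (2 * k) := by
  simp only [inner_blockMap]
  refine (expect_sum_boolSign_pow_le _ hk).trans_eq ?_
  rw [sum_blockCoeff_sq k hk, ht, pow_mul, ← mul_pow]
  ring

theorem le_expect_inner_blockMap_pow (hk : 1 ≤ k) {t : EuclideanSpace ℝ (Fin k)} (ht : ‖t‖ = 1)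
    (y : EuclideanSpace ℝ ι) :
    (2 * k / exp 2) ^ k * ‖y‖ ^ (2 * k) ≤
    𝔼 ε : Fin k × (ι × Fin k) → Bool, ⟪blockMap k (fun s => boolSign (ε s)) t, y⟫ ^ (2 * k) := by
  have hk0 : (0 : ℝ) < k := by exact_mod_cast hk
  set ξ : (ι × Fin k → Bool) → ℝ := fun s => ∑ i, (y i.1 * t i.2) * boolSign (s i) with hξ
  have hξ2 : 𝔼 s, ξ s ^ 2 = ‖y‖ ^ 2 := by
    rw [hξ, expect_sum_boolSign_sq (fun i : ι × Fin k => y i.1 * t i.2), sum_sq_mul_sq, ht]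
    simp
  have h1 := factorial_mul_le_expect_sum_pow (ξ := ξ) (τ := fun s i => !s i)
    (fun s => by ext i; simp) (fun s => by simp [hξ, boolSign_not]) k
  rw [hξ2] at h1
  have h2 : 𝔼 ε : Fin k × (ι × Fin k) → Bool,
      ⟪blockMap k (fun s => boolSign (ε s)) t, y⟫ ^ (2 * k) =
      ((k : ℝ) ^ k)⁻¹ * 𝔼 ω : Fin k → ι × Fin k → Bool, (∑ l, ξ (ω l)) ^ (2 * k) := by
    rw [Finset.mul_expect]
    refine Fintype.expect_equiv (Equiv.curry _ _ _) _ _ fun ε => ?_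
    rw [inner_blockMap, Fintype.sum_prod_type]
    have : ∀ l, ∑ i : ι × Fin k, blockCoeff k t y (l, i) * boolSign (ε (l, i)) =
        (√k)⁻¹ * ξ (Equiv.curry _ _ _ ε l) := by
      intro l
      rw [hξ, Finset.mul_sum]
      refine Finset.sum_congr rfl fun i _ => ?_
      simp [blockCoeff, Function.curry]
      ring
    simp only [this, ← Finset.mul_sum]
    rw [mul_pow, pow_mul, inv_pow, Real.sq_sqrt hk0.le, inv_pow]
  rw [h2]
  refine le_trans ?_ (mul_le_mul_of_nonneg_left h1 (by positivity))
  have h3 : (2 * k / exp 1) ^ (2 * k) ≤ ((2 * k).factorial : ℝ) := by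
    have := Real.pow_div_factorial_le_exp (2 * k : ℝ) (by positivity) (2 * k)
    rw [div_le_iff₀ (by positivity)] at this
    rw [div_pow, div_le_iff₀ (by positivity), ← Real.exp_nat_mul]
    push_cast
    rw [mul_one]
    linarith
  calc _ = ((k : ℝ) ^ k)⁻¹ * ((2 * k / exp 1) ^ (2 * k) / 2 ^ k * (‖y‖ ^ 2) ^ k) := by
        rw [pow_mul (2 * k / exp 1), div_pow (2 * k : ℝ) (exp 1), ← Real.exp_nat_mul, ← pow_mul]
        have : (2 * (k : ℝ) / exp 2) ^ k = ((k : ℝ) ^ k)⁻¹ *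
            (((2 * k) ^ 2 / exp ((2 : ℕ) * 1)) ^ k / 2 ^ k) := by
          rw [← inv_pow, ← div_pow, ← mul_pow]
          congr 1
          push_cast
          rw [mul_one]
          field_simp
        rw [this]
        ring
    _ ≤ _ := by gcongr

end BlockMap

section Paouris

open scoped BigOperators

theorem expect_pow_mean_le {S : Type*} [Fintype S] [Nonempty S] {F : S → ℝ} (hF : ∀ s, 0 ≤ F s)
    (n : ℕ) : (𝔼 s, F s) ^ n ≤ 𝔼 s, F s ^ n := by
  have h := Real.pow_arith_mean_le_arith_mean_pow Finset.univ (fun _ : S => (Fintype.card S : ℝ)⁻¹)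
    F (fun _ _ => by positivity) (by simp) (fun s _ => hF s) n
  simp only [← Finset.mul_sum] at h
  simpa [Fintype.expect_eq_sum_div_card, div_eq_inv_mul] using h

variable {ι : Type*} [Fintype ι] [DecidableEq ι] {k : ℕ} {ν : Measure (EuclideanSpace ℝ ι)}

theorem MeasureTheory.MemLp.integrable_inner_pow (hk : 1 ≤ k) {E : Type*} [NormedAddCommGroup E]
    [InnerProductSpace ℝ E] [MeasurableSpace E] [OpensMeasurableSpace E] {ν : Measure E}
    (h : MemLp id ((2 * k : ℕ) : ℝ≥0∞) ν) (x : E) :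
    Integrable (fun y => ⟪x, y⟫ ^ (2 * k)) ν := by
  have h1 : MemLp (fun y => ⟪x, y⟫) ((2 * k : ℕ) : ℝ≥0∞) ν := h.const_inner x
  refine (h1.integrable_norm_pow (p := 2 * k) (by omega)).congr (ae_of_all _ fun y => ?_)
  simp [(even_two_mul k).pow_abs]

theorem expect_marginalSeminorm_pow (hk : 1 ≤ k) (hp : 1 ≤ ((2 * k : ℕ) : ℝ≥0∞))
    (h : MemLp id ((2 * k : ℕ) : ℝ≥0∞) ν) {t : EuclideanSpace ℝ (Fin k)} (ht : ‖t‖ = 1) :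
    (2 * k / exp 2) ^ k * ∫ y, ‖y‖ ^ (2 * k) ∂ν ≤
      𝔼 ε : Fin k × (ι × Fin k) → Bool,
        marginalSeminorm ν _ hp h (blockMap k (fun s => boolSign (ε s)) t) ^ (2 * k) ∧
    𝔼 ε : Fin k × (ι × Fin k) → Bool,
        marginalSeminorm ν _ hp h (blockMap k (fun s => boolSign (ε s)) t) ^ (2 * k) ≤
      (8 * exp 2 * k) ^ k * ∫ y, ‖y‖ ^ (2 * k) ∂ν := by
  have hin : Integrable (fun y : EuclideanSpace ℝ ι => ‖y‖ ^ (2 * k)) ν :=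
    h.integrable_norm_pow (p := 2 * k) (by omega)
  have hI : ∀ x, Integrable (fun y => ⟪x, y⟫ ^ (2 * k)) ν := h.integrable_inner_pow hk
  have e : 𝔼 ε : Fin k × (ι × Fin k) → Bool,
      marginalSeminorm ν _ hp h (blockMap k (fun s => boolSign (ε s)) t) ^ (2 * k) =
      ∫ y, 𝔼 ε : Fin k × (ι × Fin k) → Bool,
        ⟪blockMap k (fun s => boolSign (ε s)) t, y⟫ ^ (2 * k) ∂ν := by
    simp only [marginalSeminorm_pow hk, Fintype.expect_eq_sum_div_card]
    rw [integral_div, integral_finsetSum _ fun ε _ => hI _]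
  have hI' : Integrable (fun y => 𝔼 ε : Fin k × (ι × Fin k) → Bool,
        ⟪blockMap k (fun s => boolSign (ε s)) t, y⟫ ^ (2 * k)) ν := by
    simp only [Fintype.expect_eq_sum_div_card]
    exact (integrable_finsetSum _ fun ε _ => hI _).div_const _
  rw [e, ← integral_const_mul, ← integral_const_mul]
  exact ⟨integral_mono (hin.const_mul _) hI' fun y => le_expect_inner_blockMap_pow k hk ht y,
    integral_mono hI' (hin.const_mul _) fun y => expect_inner_blockMap_pow_le k hk ht y⟩

theorem expect_marginalSeminorm_bounds (hk : 1 ≤ k) {F : Seminorm ℝ (Fin k × (ι × Fin k) → ℝ)}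
    {σ H : ℝ} (hσ : 0 < σ) (hσH : 90 * σ ≤ H)
    (hF : ∀ z, F z ≤ σ * √(∑ i, z i ^ 2))
    (h1 : (2 * k / exp 2) ^ k * H ^ (2 * k) ≤
      𝔼 ε : Fin k × (ι × Fin k) → Bool, F (fun s => boolSign (ε s)) ^ (2 * k))
    (h2 : 𝔼 ε : Fin k × (ι × Fin k) → Bool, F (fun s => boolSign (ε s)) ^ (2 * k) ≤
      (8 * exp 2 * k) ^ k * H ^ (2 * k)) :
    √k * H / 5 ≤ 𝔼 ε : Fin k × (ι × Fin k) → Bool, F (fun s => boolSign (ε s)) ∧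
    𝔼 ε : Fin k × (ι × Fin k) → Bool, F (fun s => boolSign (ε s)) ≤ 8 * (√k * H) := by
  have hk0 : (0 : ℝ) < k := by exact_mod_cast hk
  have hH : 0 < H := by linarith
  set m := 𝔼 ε : Fin k × (ι × Fin k) → Bool, F (fun s => boolSign (ε s)) with hm
  have hm0 : 0 ≤ m := Finset.expect_nonneg fun _ _ => apply_nonneg _ _
  set W := √k * H with hW
  have hW0 : 0 < W := by positivity
  have hW2 : W ^ 2 = k * H ^ 2 := by rw [hW, mul_pow, Real.sq_sqrt hk0.le]
  have he : exp 2 < 7.4 := by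
    have : exp 2 = exp 1 ^ 2 := by rw [← Real.exp_nat_mul]; norm_num
    rw [this]
    have := Real.exp_one_lt_d9
    have := Real.exp_pos 1
    nlinarith
  have hk2 : k ≠ 0 := by omega
  constructor
  · by_contra! hlt
    have h3 := expect_pow_le_of_expect_exp_le (G := fun ε : Fin k × (ι × Fin k) → Bool =>
      F (fun s => boolSign (ε s)) - m) hσ (expect_exp_seminorm_sub_le F hF) hk
    have h4 : 𝔼 ε : Fin k × (ι × Fin k) → Bool, F (fun s => boolSign (ε s)) ^ (2 * k) ≤
        2 ^ (2 * k - 1) * (m ^ (2 * k) + (8 * exp 2 * k * σ ^ 2) ^ k) := by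
      calc _ ≤ 𝔼 ε : Fin k × (ι × Fin k) → Bool, 2 ^ (2 * k - 1) *
            (m ^ (2 * k) + (F (fun s => boolSign (ε s)) - m) ^ (2 * k)) := by
            refine Finset.expect_le_expect fun ε _ => ?_
            have := add_pow_le hm0 (abs_nonneg (F (fun s => boolSign (ε s)) - m)) (2 * k)
            rw [(even_two_mul k).pow_abs] at this
            refine le_trans (pow_le_pow_left₀ (apply_nonneg _ _) ?_ _) this
            linarith [le_abs_self (F (fun s => boolSign (ε s)) - m)]
        _ = 2 ^ (2 * k - 1) * (m ^ (2 * k) + 𝔼 ε : Fin k × (ι × Fin k) → Bool,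
            (F (fun s => boolSign (ε s)) - m) ^ (2 * k)) := by
            rw [← Finset.mul_expect, Finset.expect_add_distrib]
            simp
        _ ≤ _ := by gcongr
    have h5 : (2 * k / exp 2) ^ k * H ^ (2 * k) = (2 / exp 2 * W ^ 2) ^ k := by
      rw [pow_mul, ← mul_pow, hW2]
      congr 1
      ring
    have h6 : m ^ (2 * k) ≤ (W ^ 2 / 25) ^ k := by
      rw [pow_mul]
      refine pow_le_pow_left₀ (by positivity) ?_ k
      nlinarith
    have h7 : (8 * exp 2 * k * σ ^ 2) ^ k ≤ (W ^ 2 / 25) ^ k := by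
      refine pow_le_pow_left₀ (by positivity) ?_ k
      have : 8100 * σ ^ 2 ≤ H ^ 2 := by nlinarith
      rw [hW2]
      have h8 : k * (8100 * σ ^ 2) ≤ k * H ^ 2 := by gcongr
      have h9 : exp 2 * (k * σ ^ 2) ≤ 7.4 * (k * σ ^ 2) := by gcongr
      nlinarith
    have h8 : (4 : ℝ) ^ k = 2 ^ (2 * k - 1) * 2 := by
      rw [← pow_succ, show 2 * k - 1 + 1 = 2 * k by omega, pow_mul]
      norm_num
    have h9 : (2 / exp 2 * W ^ 2) ^ k ≤ (4 * (W ^ 2 / 25)) ^ k := by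
      rw [mul_pow 4, h8]
      calc _ ≤ 2 ^ (2 * k - 1) * (m ^ (2 * k) + (8 * exp 2 * k * σ ^ 2) ^ k) := by
            rw [← h5]; exact h1.trans h4
        _ ≤ 2 ^ (2 * k - 1) * ((W ^ 2 / 25) ^ k + (W ^ 2 / 25) ^ k) := by gcongr
        _ = _ := by ring
    have h10 := le_of_pow_le_pow_left₀ hk2 (by positivity) h9
    have h11 : 2 / exp 2 ≤ 4 / 25 := by
      have : 0 < W ^ 2 := by positivity
      refine le_of_mul_le_mul_right ?_ this
      linarith
    rw [div_le_iff₀ (by positivity)] at h11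
    linarith
  · have h3 := (expect_pow_mean_le (fun ε : Fin k × (ι × Fin k) → Bool =>
      apply_nonneg F (fun s => boolSign (ε s))) (2 * k)).trans h2
    refine le_of_pow_le_pow_left₀ (n := 2 * k) (by omega) (by positivity) (h3.trans ?_)
    rw [pow_mul, pow_mul, ← mul_pow]
    refine pow_le_pow_left₀ (by positivity) ?_ k
    rw [mul_pow, hW2]
    have : 0 < k * H ^ 2 := by positivity
    nlinarith

theorem exists_good_signs {S V : Type*} [Fintype S] [Nonempty S] (N : Finset V) {f : V → S → ℝ}
    {m : V → ℝ} {u c : ℝ} (hf : ∀ t ∈ N, 𝔼 s, (if u ≤ |f t s - m t| then (1 : ℝ) else 0) ≤ c)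
    (hc : N.card * c < 1 / 2) {G : S → ℝ} (hG0 : ∀ s, 0 ≤ G s) {R : ℝ} (hR : 0 < R)
    (hG : 𝔼 s, G s ≤ R) : ∃ s, (∀ t ∈ N, |f t s - m t| < u) ∧ G s ≤ 2 * R := by
  have h : 𝔼 s, (∑ t ∈ N, (if u ≤ |f t s - m t| then (1 : ℝ) else 0) + G s / (2 * R)) < 1 := by
    rw [Finset.expect_add_distrib, Finset.expect_sum_comm, ← Finset.expect_div]
    have h1 := Finset.sum_le_card_nsmul N _ c hf
    rw [nsmul_eq_mul] at h1
    have h2 : (𝔼 s, G s) / (2 * R) ≤ 1 / 2 := by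
      rw [div_le_iff₀ (by positivity)]
      linarith
    linarith
  obtain ⟨s, -, hs⟩ := Finset.exists_lt_of_expect_lt Finset.univ_nonempty h
  have h3 : 0 ≤ G s / (2 * R) := div_nonneg (hG0 s) (by positivity)
  refine ⟨s, fun t ht => ?_, ?_⟩
  · by_contra! hlt
    have h4 := Finset.single_le_sum
      (f := fun t => if u ≤ |f t s - m t| then (1 : ℝ) else 0)
      (fun t _ => by split_ifs <;> norm_num) ht
    simp only [hlt, if_true] at h4
    linarith
  · have h4 : 0 ≤ ∑ t ∈ N, (if u ≤ |f t s - m t| then (1 : ℝ) else 0) :=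
      Finset.sum_nonneg fun t _ => by split_ifs <;> norm_num
    have h5 : G s / (2 * R) ≤ 1 := by linarith
    rwa [div_le_one (by positivity)] at h5

theorem card_net_mul_exp_lt {c : ℝ} (hk : 1 ≤ k) (hc : c ≤ 961 ^ k) {x : ℝ} (hx : 10 * k ≤ x) :
    c * (2 * exp (-x)) < 1 / 2 := by
  have hk1 : (1 : ℝ) ≤ k := by exact_mod_cast hk
  have he := Real.exp_one_gt_d9
  have h1 : (961 : ℝ) ^ k ≤ exp (7 * k) := by
    have : (961 : ℝ) ≤ exp 7 := by
      have e : exp 7 = exp 1 ^ 7 := by rw [← Real.exp_nat_mul]; norm_num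
      rw [e]
      exact le_trans (by norm_num) (pow_le_pow_left₀ (by norm_num) he.le 7)
    calc (961 : ℝ) ^ k ≤ exp 7 ^ k := by gcongr
      _ = exp (7 * k) := by rw [← Real.exp_nat_mul]; ring_nf
  have h3 : exp (-3) < 1 / 4 := by
    rw [Real.exp_neg, inv_lt_comm₀ (by positivity) (by norm_num)]
    have := Real.add_one_lt_exp (x := 3) (by norm_num)
    linarith
  calc c * (2 * exp (-x)) ≤ exp (7 * k) * (2 * exp (-(10 * k))) := by gcongr; exact hc.trans h1
    _ = 2 * exp (-3 * k) := by
        rw [mul_left_comm, ← Real.exp_add]; ring_nf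
    _ ≤ 2 * exp (-3) := by gcongr; linarith
    _ < _ := by linarith

omit [DecidableEq ι] in
theorem norm_sq_adjoint_eq (A : EuclideanSpace ℝ (Fin k) →ₗ[ℝ] EuclideanSpace ℝ ι)
    (y : EuclideanSpace ℝ ι) :
    ‖LinearMap.adjoint A y‖ ^ 2 = ∑ j, ⟪A (EuclideanSpace.single j 1), y⟫ ^ 2 := by
  rw [EuclideanSpace.real_norm_sq_eq]
  refine Finset.sum_congr rfl fun j _ => ?_
  rw [← LinearMap.adjoint_inner_right, EuclideanSpace.inner_single_left]
  simp

theorem exists_good_blockMap (hk : 1 ≤ k) [IsProbabilityMeasure ν]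
    (hp : 1 ≤ ((2 * k : ℕ) : ℝ≥0∞)) (h : MemLp id ((2 * k : ℕ) : ℝ≥0∞) ν)
    {σ H R : ℝ} (hσ : 0 < σ) (hσH : 90 * σ ≤ H) (hR : 0 < R)
    (hnorm : ∀ x, marginalSeminorm ν _ hp h x ≤ σ * ‖x‖)
    (hH : H ^ (2 * k) = ∫ y, ‖y‖ ^ (2 * k) ∂ν) (hR2 : ∫ y, ‖y‖ ^ 2 ∂ν ≤ R ^ 2) :
    ∃ A : EuclideanSpace ℝ (Fin k) →ₗ[ℝ] EuclideanSpace ℝ ι,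
      (∀ t, ‖t‖ = 1 → √k * H / 20 ≤ marginalSeminorm ν _ hp h (A t)) ∧
      ∫ y, ‖LinearMap.adjoint A y‖ ^ 2 ∂ν ≤ 2 * (k * R ^ 2) := by
  have hk0 : (0 : ℝ) < k := by exact_mod_cast hk
  set g := marginalSeminorm ν _ hp h with hg
  have hp2 : MemLp id 2 ν := h.mono_exponent (by
    have : 2 ≤ 2 * k := by omega
    exact_mod_cast this)
  set W := √k * H with hW
  have hH0 : 0 < H := by linarith
  have hW0 : 0 < W := by positivity
  have hW2 : W ^ 2 = k * H ^ 2 := by rw [hW, mul_pow, Real.sq_sqrt hk0.le]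
  obtain ⟨N, hN1, hN2, hN3⟩ := exists_finset_net_unit (E := EuclideanSpace ℝ (Fin k))
    (δ := 1 / 480) (by norm_num)
  rw [finrank_euclideanSpace_fin] at hN3
  set f : EuclideanSpace ℝ (Fin k) → (Fin k × (ι × Fin k) → Bool) → ℝ :=
    fun t ε => g (blockMap k (fun s => boolSign (ε s)) t) with hf
  have hFle : ∀ t : EuclideanSpace ℝ (Fin k), ‖t‖ = 1 → ∀ z : Fin k × (ι × Fin k) → ℝ,
      g.comp ((blockMap (ι := ι) k).flip t) z ≤ σ * √(∑ i, z i ^ 2) := by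
    intro t ht z
    refine (hnorm _).trans (mul_le_mul_of_nonneg_left ?_ hσ.le)
    simpa [ht] using norm_blockMap_le k hk z t
  have hmean : ∀ t ∈ N, W / 5 ≤ 𝔼 ε, f t ε ∧ 𝔼 ε, f t ε ≤ 8 * W := by
    intro t ht
    obtain ⟨h1, h2⟩ := expect_marginalSeminorm_pow hk hp h (hN1 t ht)
    rw [← hH] at h1 h2
    exact expect_marginalSeminorm_bounds hk hσ hσH (hFle t (hN1 t ht)) h1 h2
  have hI : ∀ x : EuclideanSpace ℝ ι, Integrable (fun y => ⟪x, y⟫ ^ 2) ν :=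
    MemLp.integrable_inner_pow (k := 1) le_rfl (by simpa using hp2)
  obtain ⟨ε, hε1, hε2⟩ := exists_good_signs N (f := f) (m := fun t => 𝔼 ε, f t ε) (u := W / 10)
    (fun t ht => expect_indicator_seminorm_le _ hσ (hFle t (hN1 t ht)) (by positivity))
    (card_net_mul_exp_lt hk (hN3.trans_eq (by norm_num)) (by
      rw [le_div_iff₀ (by positivity)]
      have h1 : 8100 * σ ^ 2 ≤ H ^ 2 := by nlinarith
      rw [div_pow, hW2]
      have h2 : k * (8100 * σ ^ 2) ≤ k * H ^ 2 := by gcongr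
      have h3 : 0 < k * σ ^ 2 := by positivity
      linarith))
    (G := fun ε => ∫ y, ‖LinearMap.adjoint (blockMap (ι := ι) k
      (fun s => boolSign (ε s))) y‖ ^ 2 ∂ν)
    (fun ε => integral_nonneg fun y => by positivity) (R := k * R ^ 2) (by positivity) (by
      simp only [norm_sq_adjoint_eq]
      simp_rw [integral_finsetSum _ fun j _ => hI _]
      rw [Finset.expect_sum_comm]
      have : ∀ j : Fin k, 𝔼 ε : Fin k × (ι × Fin k) → Bool, ∫ y, ⟪blockMap k
          (fun s => boolSign (ε s)) (EuclideanSpace.single j 1), y⟫ ^ 2 ∂ν ≤ R ^ 2 := by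
        intro j
        refine le_trans (le_of_eq ?_) hR2
        rw [Fintype.expect_eq_sum_div_card, ← integral_finsetSum _ fun ε _ => hI _,
          ← integral_div]
        refine integral_congr_ae (ae_of_all _ fun y => ?_)
        have := expect_inner_blockMap_sq k hk (EuclideanSpace.single j 1) y
        rw [Fintype.expect_eq_sum_div_card] at this
        simpa using this
      refine (Finset.sum_le_card_nsmul _ _ _ fun j _ => this j).trans_eq ?_
      simp)
  refine ⟨blockMap k (fun s => boolSign (ε s)), fun t ht => ?_, hε2⟩
  have hnet := sub_le_seminorm_of_net (g.comp (blockMap (ι := ι) k (fun s => boolSign (ε s))))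
    (M := σ * √(∑ s, boolSign (ε s) ^ 2)) (a := W / 10) (b := 12 * W) (δ := 1 / 480)
    (fun t => by
      refine (hnorm _).trans ?_
      rw [mul_assoc]
      exact mul_le_mul_of_nonneg_left (norm_blockMap_le k hk _ t) hσ.le)
    (by norm_num) hN2
    (fun t ht => by
      have h1 := abs_lt.1 (hε1 t ht)
      have h2 := hmean t ht
      change W / 10 ≤ f t ε
      linarith)
    (fun t ht => by
      have h1 := abs_lt.1 (hε1 t ht)
      have h2 := hmean t ht
      change f t ε ≤ 12 * W
      linarith) ht
  refine le_trans (le_of_eq ?_) hnet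
  ring

end Paouris

section PaourisInequality

variable {ι : Type*} [Fintype ι] {k : ℕ} {ν : Measure (EuclideanSpace ℝ ι)}

theorem real_norm_le_of_integral_sq_le {E : Type*} [NormedAddCommGroup E] [MeasurableSpace E]
    [BorelSpace E] {ν : Measure E} [IsProbabilityMeasure ν] {g : E → ℝ}
    (hg : Measurable g) (hi : Integrable (fun y => g y ^ 2) ν) {r : ℝ} (hr : 0 < r)
    (h : ∫ y, g y ^ 2 ∂ν ≤ r ^ 2 / 2) : 1 / 2 ≤ ν.real {y | g y ≤ r} := by
  have h1 := mul_meas_ge_le_integral_of_nonneg (ae_of_all ν fun y => sq_nonneg (g y)) hi (r ^ 2)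
  have h2 : ν.real {y | r ^ 2 ≤ g y ^ 2} ≤ 1 / 2 := by
    have : 0 < r ^ 2 := by positivity
    refine le_of_mul_le_mul_left ?_ this
    linarith
  have h3 : ν.real {y | g y ≤ r}ᶜ ≤ ν.real {y | r ^ 2 ≤ g y ^ 2} :=
    measureReal_mono fun y hy => by
      simp only [Set.mem_compl_iff, Set.mem_ofPred_eq, not_le] at hy ⊢
      gcongr
  rw [probReal_compl_eq_one_sub (measurableSet_le hg measurable_const)] at h3
  linarith

theorem exp_neg_mul_le_one_div (hk : 1 ≤ k) :
    exp (-23 * k) ≤ 1 / (8 * (2 * exp 4) ^ (4 * k)) := by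
  have hk1 : (1 : ℝ) ≤ k := by exact_mod_cast hk
  have h2 : (2 : ℝ) ≤ exp 1 := by linarith [Real.exp_one_gt_d9]
  have e7 : exp 7 = exp 1 ^ 7 := by rw [← Real.exp_nat_mul]; norm_num
  have h3 : (128 : ℝ) ≤ exp 7 := by
    rw [e7]
    exact le_trans (by norm_num) (pow_le_pow_left₀ (by norm_num) h2 7)
  have h4 : 8 * (2 * exp 4) ^ (4 * k) ≤ exp (23 * k) := by
    calc 8 * (2 * exp 4) ^ (4 * k) ≤ 8 ^ k * (2 * exp 4) ^ (4 * k) := by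
          gcongr
          exact le_self_pow₀ (by norm_num) (by omega)
      _ = (128 * exp 16) ^ k := by
          rw [pow_mul, ← mul_pow, mul_pow 2, ← Real.exp_nat_mul]
          norm_num
          ring_nf
      _ ≤ (exp 7 * exp 16) ^ k := by gcongr
      _ = _ := by rw [← Real.exp_add, ← Real.exp_nat_mul]; ring_nf
  rw [neg_mul, Real.exp_neg, ← one_div]
  exact one_div_le_one_div_of_le (by positivity) h4

theorem LogConcaveMeasure.real_abs_inner_ge [IsProbabilityMeasure ν] (h : LogConcaveMeasure ν)
    (hk : 1 ≤ k) (hp : 1 ≤ ((2 * k : ℕ) : ℝ≥0∞))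
    (hL : MemLp id ((2 * k : ℕ) : ℝ≥0∞) ν) {x : EuclideanSpace ℝ ι}
    (hx : 0 < marginalSeminorm ν _ hp hL x) :
    exp (-23 * k) ≤ ν.real {y | marginalSeminorm ν _ hp hL x / 2 ≤ |⟪x, y⟫|} := by
  set a := marginalSeminorm ν _ hp hL x with ha
  have hk0 : (0 : ℝ) < k := by exact_mod_cast hk
  have hk1 : (1 : ℝ) ≤ k := by exact_mod_cast hk
  have hI := hL.integrable_inner_pow hk x
  have ha2 : a ^ (2 * k) = ∫ y, ⟪x, y⟫ ^ (2 * k) ∂ν := marginalSeminorm_pow hk hp hL x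
  have e : (fun y => |⟪x, y⟫| ^ ((2 * k : ℕ) : ℝ)) = fun y => ⟪x, y⟫ ^ (2 * k) := by
    ext y
    rw [Real.rpow_natCast, (even_two_mul k).pow_abs]
  have h4 := h.integral_abs_inner_pow_le x (q := (2 * k : ℕ)) (a := a) (N := 4 * k)
    (by push_cast; linarith) hx (by rw [e]; exact hI)
    (by rw [e, Real.rpow_natCast, ha2]) (by push_cast; linarith)
  have hev : Even (4 * k) := ⟨2 * k, by ring⟩
  simp only [hev.pow_abs] at h4
  refine (exp_neg_mul_le_one_div hk).trans (paley_zygmund_pow (by fun_prop) hk hx (by positivity)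
    hI h4.1 ha2.le (h4.2.trans_eq ?_))
  rw [← mul_pow]
  congr 1
  push_cast
  field_simp
  ring

/-- **Paouris' inequality** for even moments. -/
theorem LogConcaveMeasure.integral_norm_pow_le [IsProbabilityMeasure ν] (h : LogConcaveMeasure ν)
    (hk : 1 ≤ k) (hL : MemLp id ((2 * k : ℕ) : ℝ≥0∞) ν) {σ R : ℝ} (hσ : 0 < σ) (hR : 0 < R)
    (hσx : ∀ x, ∫ y, ⟪x, y⟫ ^ (2 * k) ∂ν ≤ (σ * ‖x‖) ^ (2 * k))
    (hR2 : ∫ y, ‖y‖ ^ 2 ∂ν ≤ R ^ 2) :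
    ∫ y, ‖y‖ ^ (2 * k) ∂ν ≤ (500000 * (R + σ)) ^ (2 * k) := by
  classical
  have hk0 : (0 : ℝ) < k := by exact_mod_cast hk
  have hp : 1 ≤ ((2 * k : ℕ) : ℝ≥0∞) := by
    have : 1 ≤ 2 * k := by omega
    exact_mod_cast this
  have hJ : 0 ≤ ∫ y, ‖y‖ ^ (2 * k) ∂ν := integral_nonneg fun y => by positivity
  set H := (∫ y, ‖y‖ ^ (2 * k) ∂ν) ^ (((2 * k : ℕ) : ℝ)⁻¹) with hHdef
  have hH0 : 0 ≤ H := by positivity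
  have hH : H ^ (2 * k) = ∫ y, ‖y‖ ^ (2 * k) ∂ν := Real.rpow_inv_natCast_pow hJ (by omega)
  rw [← hH]
  refine pow_le_pow_left₀ hH0 ?_ _
  rcases le_or_gt H (90 * σ) with h90 | h90
  · linarith
  have hHpos : 0 < H := by linarith
  have hnorm : ∀ x, marginalSeminorm ν _ hp hL x ≤ σ * ‖x‖ := fun x => by
    refine le_of_pow_le_pow_left₀ (n := 2 * k) (by omega) (by positivity) ?_
    rw [marginalSeminorm_pow hk]
    exact hσx x
  obtain ⟨A, hA1, hA2⟩ := exists_good_blockMap hk hp hL hσ h90.le hR hnorm hH hR2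
  set T := LinearMap.toContinuousLinearMap (LinearMap.adjoint A) with hT
  have hTm : Measurable T := T.continuous.measurable
  have hTi : ∀ θ y, ⟪θ, T y⟫ = ⟪A θ, y⟫ := fun θ y => LinearMap.adjoint_inner_right A θ y
  have : IsProbabilityMeasure (ν.map T) := Measure.isProbabilityMeasure_map hTm.aemeasurable
  have hp2 : MemLp id 2 ν := hL.mono_exponent (by
    have : 2 ≤ 2 * k := by omega
    exact_mod_cast this)
  have hk1 : 1 ≤ √(k : ℝ) := by
    rw [Real.one_le_sqrt]
    exact_mod_cast hk
  have key := (h.map T).le_of_forall_exp_le_tail (r := 2 * √k * R) (c := 23)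
    (w := √k * H / 40) (by simpa using hk) (by positivity)
    (by
      rw [map_measureReal_apply hTm Metric.isClosed_closedBall.measurableSet]
      have := real_norm_le_of_integral_sq_le (ν := ν) (g := fun y => ‖T y‖) (r := 2 * √k * R)
        (by fun_prop) ((T.comp_memLp' hp2).integrable_norm_pow (by norm_num)) (by positivity)
        (by
          refine hA2.trans_eq ?_
          rw [mul_pow, mul_pow, Real.sq_sqrt hk0.le]
          ring)
      refine this.trans_eq ?_
      congr 1
      ext y
      simp)
    (by norm_num)
    (fun θ hθ => by
      have h1 := hA1 θ hθ
      have h2 : 0 < √k * H / 20 := by positivity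
      have h3 := h.real_abs_inner_ge hk hp hL (h2.trans_le h1)
      rw [map_measureReal_apply hTm (measurableSet_le measurable_const (by fun_prop)),
        finrank_euclideanSpace_fin]
      refine h3.trans (measureReal_mono fun y hy => ?_)
      simp only [Set.mem_ofPred_eq, Set.preimage_ofPred_eq, hTi] at hy ⊢
      linarith)
  have he : exp 2 < 7.4 := by
    have e : exp 2 = exp 1 ^ 2 := by rw [← Real.exp_nat_mul]; norm_num
    rw [e]
    have := Real.exp_one_lt_d9
    have := Real.exp_pos 1
    nlinarith
  have h5 : √k * H ≤ √k * (80 * (1 + 12 * exp 2 * (2 * 23 + 8)) * R) := by linarith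
  have h6 := le_of_mul_le_mul_left h5 (by positivity)
  have h7 : exp 2 * R ≤ 7.4 * R := by gcongr
  linarith

end PaourisInequality

section IsotropicMoments

variable {ι : Type*} [Fintype ι] [DecidableEq ι] {ν : Measure (EuclideanSpace ℝ ι)}

/-- The matrix of second moments of `ν` is the identity. -/
def HasIdentitySecondMoments (ν : Measure (EuclideanSpace ℝ ι)) : Prop :=
  ∀ i j, ∫ y, y i * y j ∂ν = if i = j then (1 : ℝ) else 0

namespace HasIdentitySecondMoments

theorem memLp_coord (h : HasIdentitySecondMoments ν) (i : ι) : MemLp (fun y => y i) 2 ν := by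
  rw [memLp_two_iff_integrable_sq (by fun_prop)]
  by_contra hn
  have := h i i
  simp only [← sq, if_true] at this
  rw [integral_undef hn] at this
  exact zero_ne_one this

omit [Fintype ι] in
theorem integral_sq (h : HasIdentitySecondMoments ν) (i : ι) : ∫ y, y i ^ 2 ∂ν = 1 := by
  simpa [sq] using h i i

theorem memLp_two (h : HasIdentitySecondMoments ν) : MemLp id 2 ν :=
  MemLp.of_eval_piLp fun i => h.memLp_coord i

theorem integral_inner_sq (h : HasIdentitySecondMoments ν) (x : EuclideanSpace ℝ ι) :
    ∫ y, ⟪x, y⟫ ^ 2 ∂ν = ‖x‖ ^ 2 := by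
  have e : ∀ y : EuclideanSpace ℝ ι, ⟪x, y⟫ ^ 2 = ∑ i, ∑ j, x i * x j * (y i * y j) := by
    intro y
    rw [PiLp.inner_apply, sq, Finset.sum_mul_sum]
    refine Finset.sum_congr rfl fun i _ => Finset.sum_congr rfl fun j _ => ?_
    simp only [RCLike.inner_apply, conj_trivial]
    ring
  have hI : ∀ i j, Integrable (fun y : EuclideanSpace ℝ ι => x i * x j * (y i * y j)) ν :=
    fun i j => ((h.memLp_coord i).integrable_mul (h.memLp_coord j)).const_mul _
  simp only [e]
  rw [integral_finsetSum _ fun i _ => integrable_finsetSum _ fun j _ => hI i j,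
    EuclideanSpace.real_norm_sq_eq]
  refine Finset.sum_congr rfl fun i _ => ?_
  rw [integral_finsetSum _ fun j _ => hI i j]
  simp only [integral_const_mul]
  simp [h i, sq]

variable [IsProbabilityMeasure ν]

theorem integrable_abs_inner_pow (h : HasIdentitySecondMoments ν) (hc : LogConcaveMeasure ν)
    (x : EuclideanSpace ℝ ι) {N : ℕ} (hN : 2 ≤ N) : Integrable (fun y => |⟪x, y⟫| ^ N) ν := by
  have e : (fun y : EuclideanSpace ℝ ι => |⟪x, y⟫| ^ (2 : ℝ)) = fun y => ⟪x, y⟫ ^ 2 := by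
    ext y
    rw [Real.rpow_two, sq_abs]
  refine (hc.integral_abs_inner_pow_le x (q := 2) (a := ‖x‖ + 1) (by norm_num) (by positivity)
    ?_ ?_ (by exact_mod_cast hN)).1
  · rw [e]
    exact MemLp.integrable_inner_pow (k := 1) le_rfl (by simpa using h.memLp_two) x
  · rw [e, h.integral_inner_sq, Real.rpow_two]
    gcongr
    linarith

theorem memLp (h : HasIdentitySecondMoments ν) (hc : LogConcaveMeasure ν) {N : ℕ} (hN : 2 ≤ N) :
    MemLp id (N : ℝ≥0∞) ν := by
  refine MemLp.of_eval_piLp fun i => ?_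
  have hN0 : ((N : ℕ) : ℝ≥0∞) ≠ 0 := by
    have : N ≠ 0 := by omega
    exact_mod_cast this
  rw [← integrable_norm_rpow_iff (by fun_prop) hN0 (ENNReal.natCast_ne_top _)]
  have := h.integrable_abs_inner_pow hc (EuclideanSpace.single i 1) hN
  simpa [EuclideanSpace.inner_single_left] using this

theorem integrable_abs_inner_rpow (h : HasIdentitySecondMoments ν) (hc : LogConcaveMeasure ν)
    (x : EuclideanSpace ℝ ι) {p : ℝ} (hp : 0 ≤ p) : Integrable (fun y => |⟪x, y⟫| ^ p) ν := by
  refine Integrable.mono' ((integrable_const 1).add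
    (h.integrable_abs_inner_pow hc x (N := ⌈p⌉₊ + 2) (by omega))) (by fun_prop)
    (ae_of_all _ fun y => ?_)
  rw [Real.norm_of_nonneg (by positivity), Pi.add_apply]
  rcases le_total |⟪x, y⟫| 1 with h1 | h1
  · have := Real.rpow_le_one (abs_nonneg _) h1 hp
    have h2 : 0 ≤ |⟪x, y⟫| ^ (⌈p⌉₊ + 2) := by positivity
    linarith
  · have := Real.rpow_le_rpow_of_exponent_le h1 (show p ≤ ((⌈p⌉₊ + 2 : ℕ) : ℝ) by
      push_cast
      linarith [Nat.le_ceil p])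
    rw [Real.rpow_natCast] at this
    linarith

/-- Comparison of weak moments. -/
theorem integral_inner_pow_le (h : HasIdentitySecondMoments ν) (hc : LogConcaveMeasure ν)
    {p B : ℝ} (hp : 1 ≤ p) (hB : 0 < B)
    (hw : ∀ x : EuclideanSpace ℝ ι, ‖x‖ = 1 → ∫ y, |⟪x, y⟫| ^ p ∂ν ≤ B ^ p) {q : ℕ}
    (hq : p ≤ q) (x : EuclideanSpace ℝ ι) :
    ∫ y, ⟪x, y⟫ ^ (2 * q) ∂ν ≤ (exp 4 * B * (2 * q) / p * ‖x‖) ^ (2 * q) := by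
  have hq0 : q ≠ 0 := by
    rintro rfl
    simp at hq
    linarith
  rcases eq_or_ne x 0 with rfl | hx
  · simp [hq0]
  have hx0 : ‖x‖ ≠ 0 := norm_ne_zero_iff.2 hx
  set u := ‖x‖⁻¹ • x with hu
  have hu1 : ‖u‖ = 1 := by
    rw [hu, norm_smul, norm_inv, norm_norm, inv_mul_cancel₀ hx0]
  have h1 := (hc.integral_abs_inner_pow_le u hp hB
    (h.integrable_abs_inner_rpow hc u (by linarith)) (hw u hu1) (N := 2 * q) (by
      push_cast
      linarith)).2
  simp only [(even_two_mul q).pow_abs] at h1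
  have hxu : x = ‖x‖ • u := by rw [hu, smul_smul, mul_inv_cancel₀ hx0, one_smul]
  have e : ∀ y, ⟪x, y⟫ ^ (2 * q) = ‖x‖ ^ (2 * q) * ⟪u, y⟫ ^ (2 * q) := fun y => by
    nth_rewrite 1 [hxu]
    rw [real_inner_smul_left, mul_pow]
  simp only [e]
  rw [integral_const_mul, mul_pow _ ‖x‖, mul_comm]
  push_cast at h1
  gcongr

/-- The projection onto a set of coordinates. -/
def _root_.coordProj (I : Finset ι) : EuclideanSpace ℝ ι →L[ℝ] EuclideanSpace ℝ I :=
  (EuclideanSpace.equiv I ℝ).symm.toContinuousLinearMap.comp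
    (ContinuousLinearMap.pi fun i => EuclideanSpace.proj i.1)

omit [Fintype ι] [DecidableEq ι] in
theorem _root_.norm_coordProj_sq (I : Finset ι) (y : EuclideanSpace ℝ ι) :
    ‖coordProj I y‖ ^ 2 = ∑ i ∈ I, y i ^ 2 := by
  rw [EuclideanSpace.real_norm_sq_eq, ← Finset.sum_coe_sort I fun i => y i ^ 2]
  rfl

omit [DecidableEq ι] in
theorem _root_.norm_adjoint_coordProj_le (I : Finset ι) (x : EuclideanSpace ℝ I) :
    ‖ContinuousLinearMap.adjoint (coordProj I) x‖ ≤ ‖x‖ := by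
  refine (ContinuousLinearMap.le_opNorm _ _).trans ?_
  rw [LinearIsometryEquiv.norm_map]
  refine mul_le_of_le_one_left (norm_nonneg _)
    (ContinuousLinearMap.opNorm_le_bound _ zero_le_one fun y => ?_)
  rw [one_mul]
  refine le_of_pow_le_pow_left₀ two_ne_zero (norm_nonneg _) ?_
  rw [norm_coordProj_sq, EuclideanSpace.real_norm_sq_eq]
  exact Finset.sum_le_sum_of_subset_of_nonneg (Finset.subset_univ _) fun _ _ _ => sq_nonneg _

theorem integral_norm_coordProj_pow_le (h : HasIdentitySecondMoments ν)
    (hc : LogConcaveMeasure ν) {s : ℝ} (hs : 0 < s) {q : ℕ} (hq : 1 ≤ q)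
    (hw : ∀ x : EuclideanSpace ℝ ι, ∫ y, ⟪x, y⟫ ^ (2 * q) ∂ν ≤ (s * ‖x‖) ^ (2 * q))
    (I : Finset ι) :
    ∫ y, ‖coordProj I y‖ ^ (2 * q) ∂ν ≤ (1000000 * (√I.card + s)) ^ (2 * q) := by
  have hm : Measurable (coordProj I) := (coordProj I).continuous.measurable
  have : IsProbabilityMeasure (ν.map (coordProj I)) :=
    Measure.isProbabilityMeasure_map hm.aemeasurable
  have hL := h.memLp hc (N := 2 * q) (by omega)
  have key := (hc.map (coordProj I)).integral_norm_pow_le hq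
    (by
      rw [memLp_map_measure_iff (by fun_prop) hm.aemeasurable]
      exact (coordProj I).comp_memLp' hL) hs (R := √I.card + s) (by positivity)
    (fun x => by
      rw [integral_map hm.aemeasurable (by fun_prop)]
      simp only [← ContinuousLinearMap.adjoint_inner_left]
      refine (hw _).trans ?_
      gcongr
      exact norm_adjoint_coordProj_le I x)
    (by
      rw [integral_map hm.aemeasurable (by fun_prop)]
      simp only [norm_coordProj_sq]
      rw [integral_finsetSum _ fun i _ => (h.memLp_coord i).integrable_sq]
      simp only [h.integral_sq]
      have h1 : (0 : ℝ) ≤ I.card := by positivity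
      have h2 := Real.sq_sqrt h1
      have h3 := Real.sqrt_nonneg (I.card : ℝ)
      simp only [Finset.sum_const, nsmul_eq_mul, mul_one]
      nlinarith)
  rw [integral_map hm.aemeasurable (by fun_prop)] at key
  refine key.trans ?_
  have h3 := Real.sqrt_nonneg (I.card : ℝ)
  gcongr ?_ ^ _
  linarith

theorem sum_setIntegral_sq_le (h : HasIdentitySecondMoments ν)
    (hc : LogConcaveMeasure ν) {s : ℝ} (hs : 0 < s) {q : ℕ} (hq : 1 ≤ q)
    (hw : ∀ x : EuclideanSpace ℝ ι, ∫ y, ⟪x, y⟫ ^ (2 * q) ∂ν ≤ (s * ‖x‖) ^ (2 * q))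
    {A : Set (EuclideanSpace ℝ ι)} (hA : exp (-q) ≤ ν.real A) (I : Finset ι) :
    ∑ i ∈ I, ∫ y in A, y i ^ 2 ∂ν ≤ 12 * 10 ^ 12 * (I.card + s ^ 2) * ν.real A := by
  set b := 1000000 * (√I.card + s) with hb
  have hb0 : 0 < b := by positivity
  have hL := h.memLp hc (N := 2 * q) (by omega)
  have hI : Integrable (fun y => ‖coordProj I y‖ ^ (2 * q)) ν :=
    ((coordProj I).comp_memLp' hL).integrable_norm_pow (p := 2 * q) (by omega)
  have hI2 : Integrable (fun y => ‖coordProj I y‖ ^ 2) ν :=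
    ((coordProj I).comp_memLp' h.memLp_two).integrable_norm_pow (by norm_num)
  have hpt : ∀ y, ‖coordProj I y‖ ^ 2 ≤ exp 1 * b ^ 2 * (1 + ‖coordProj I y‖ ^ (2 * q) *
      (exp (-q) / b ^ (2 * q))) := by
    intro y
    set u := ‖coordProj I y‖ ^ 2 / (exp 1 * b ^ 2) with hu
    have hu0 : 0 ≤ u := by positivity
    have h1 : u ≤ 1 + u ^ q := by
      rcases le_total u 1 with h1 | h1
      · have : 0 ≤ u ^ q := by positivity
        linarith
      · have := le_self_pow₀ h1 (show q ≠ 0 by omega)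
        linarith
    have h2 : u ^ q = ‖coordProj I y‖ ^ (2 * q) * (exp (-q) / b ^ (2 * q)) := by
      rw [hu, div_pow, mul_pow, ← pow_mul, ← pow_mul, ← Real.exp_nat_mul, Real.exp_neg, mul_one]
      field_simp
    rw [h2] at h1
    rw [hu, div_le_iff₀ (by positivity)] at h1
    linarith
  have h1 : ∑ i ∈ I, ∫ y in A, y i ^ 2 ∂ν = ∫ y in A, ‖coordProj I y‖ ^ 2 ∂ν := by
    simp only [norm_coordProj_sq]
    rw [integral_finsetSum _ fun i _ => (h.memLp_coord i).integrable_sq.integrableOn]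
  have h2 : ∫ y in A, ‖coordProj I y‖ ^ (2 * q) ∂ν ≤ b ^ (2 * q) :=
    (setIntegral_le_integral hI (ae_of_all _ fun y => by positivity)).trans
      (h.integral_norm_coordProj_pow_le hc hs hq hw I)
  have h3 : ∫ y in A, ‖coordProj I y‖ ^ 2 ∂ν ≤ exp 1 * b ^ 2 * (ν.real A +
      (∫ y in A, ‖coordProj I y‖ ^ (2 * q) ∂ν) * (exp (-q) / b ^ (2 * q))) := by
    have h4 := setIntegral_mono (μ := ν) (s := A) hI2.integrableOn
      ((((integrable_const (1 : ℝ)).add (hI.mul_const _)).const_mul _).integrableOn) hpt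
    rw [integral_const_mul] at h4
    have h5 : ∫ y in A, (1 + ‖coordProj I y‖ ^ (2 * q) * (exp (-q) / b ^ (2 * q))) ∂ν =
        ν.real A + (∫ y in A, ‖coordProj I y‖ ^ (2 * q) ∂ν) * (exp (-q) / b ^ (2 * q)) := by
      rw [integral_add (integrable_const (1 : ℝ)).integrableOn (hI.mul_const _).integrableOn,
        integral_mul_const]
      simp
    exact h4.trans_eq (by rw [← h5]; rfl)
  have h6 : (∫ y in A, ‖coordProj I y‖ ^ (2 * q) ∂ν) * (exp (-q) / b ^ (2 * q)) ≤ ν.real A := by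
    calc _ ≤ b ^ (2 * q) * (exp (-q) / b ^ (2 * q)) := by gcongr
      _ = exp (-q) := by field_simp
      _ ≤ _ := hA
  have he : exp 1 ≤ 3 := by linarith [Real.exp_one_lt_d9]
  have hb2 : b ^ 2 ≤ 2 * 10 ^ 12 * (I.card + s ^ 2) := by
    have h1 : (0 : ℝ) ≤ I.card := by positivity
    have h2 := Real.sq_sqrt h1
    nlinarith [sq_nonneg (√(I.card : ℝ) - s)]
  rw [h1]
  calc _ ≤ exp 1 * b ^ 2 * (ν.real A + ν.real A) := by
        refine h3.trans ?_
        gcongr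
    _ ≤ 3 * (2 * 10 ^ 12 * (I.card + s ^ 2)) * (ν.real A + ν.real A) := by gcongr
    _ = _ := by ring

end HasIdentitySecondMoments

end IsotropicMoments

section LevelSets

theorem tsum_mul_exp_neg_le {z : ℝ} (hz : 0 < z) :
    Summable (fun κ : ℕ => ((κ : ℝ) + 1) * exp (-z * (κ + 1))) ∧
      ∑' κ : ℕ, ((κ : ℝ) + 1) * exp (-z * (κ + 1)) ≤ 16 * exp (-(z / 2)) / z ^ 2 := by
  set x := exp (-z) with hx
  have hx0 : 0 < x := Real.exp_pos _
  have hx1 : x < 1 := by rw [hx, Real.exp_lt_one_iff]; linarith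
  have hn : ‖x‖ < 1 := by rwa [Real.norm_of_nonneg hx0.le]
  have hs := hasSum_coe_mul_geometric_of_norm_lt_one hn
  have e : (fun κ : ℕ => ((κ : ℝ) + 1) * exp (-z * (κ + 1))) =
      fun κ : ℕ => ((κ + 1 : ℕ) : ℝ) * x ^ (κ + 1) := by
    ext κ
    rw [hx, ← Real.exp_nat_mul]
    push_cast
    ring_nf
  have hs' : HasSum (fun κ : ℕ => ((κ + 1 : ℕ) : ℝ) * x ^ (κ + 1)) (x / (1 - x) ^ 2) := by
    rw [hasSum_nat_add_iff (f := fun κ : ℕ => (κ : ℝ) * x ^ κ) 1]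
    simpa using hs
  rw [e]
  refine ⟨hs'.summable, ?_⟩
  rw [hs'.tsum_eq]
  have h1 : z / (1 + z) ≤ 1 - x := by
    have h2 : x * (1 + z) ≤ 1 := by
      calc x * (1 + z) ≤ x * exp z := by
            gcongr
            linarith [Real.add_one_le_exp z]
        _ = 1 := by rw [hx, ← Real.exp_add]; simp
    rw [div_le_iff₀ (by positivity)]
    linarith
  have h3 : (1 + z) ^ 2 ≤ 16 * exp (z / 2) := by
    have h4 : 1 + z ≤ 4 * exp (z / 4) := by
      linarith [Real.add_one_le_exp (z / 4)]
    calc (1 + z) ^ 2 ≤ (4 * exp (z / 4)) ^ 2 := by gcongr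
      _ = 16 * exp (z / 2) := by
        rw [mul_pow, ← Real.exp_nat_mul]
        ring_nf
  calc x / (1 - x) ^ 2 ≤ x / (z / (1 + z)) ^ 2 := by gcongr
    _ = x * (1 + z) ^ 2 / z ^ 2 := by field_simp
    _ ≤ x * (16 * exp (z / 2)) / z ^ 2 := by gcongr
    _ = _ := by
      rw [hx, mul_left_comm, ← Real.exp_add]
      ring_nf

variable {E : Type*} [MeasurableSpace E]

theorem setLIntegral_tsum_indicator_pow_le [TopologicalSpace E] [BorelSpace E] [AddCommMonoid E]
    [Module ℝ E] {ν : Measure E} {α : Type*} [Countable α] {H : α → Set E}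
    (hH : ∀ a, IsClosed (H a)) (hH' : ∀ a, Convex ℝ (H a)) {w : α → ℝ≥0∞} {K : ℝ≥0∞} {l : ℕ}
    (hl : 1 ≤ l)
    (hstep : ∀ A : Set E, IsClosed A → Convex ℝ A → ν A ≠ 0 → ∀ γ : ℝ, 3 / 4 ≤ γ → γ ≤ 1 →
      ∑' a, w a * ν (A ∩ H a) ^ γ ≤ K * ν A ^ (γ - 1 / (4 * l))) {j : ℕ} (hj : j ≤ l)
    {A : Set E} (hA : IsClosed A) (hA' : Convex ℝ A) :
    ∫⁻ y in A, (∑' a, (H a).indicator (fun _ => w a) y) ^ j ∂ν ≤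
      K ^ j * ν A ^ (1 - j / (4 * l) : ℝ) := by
  have hl0 : (0 : ℝ) < l := by exact_mod_cast hl
  induction j generalizing A with
  | zero => simp
  | succ j ih =>
    rcases eq_or_ne (ν A) 0 with h0 | h0
    · rw [Measure.restrict_eq_zero.2 h0]
      simp
    have hmH : ∀ a, Measurable ((H a).indicator fun _ => w a) := fun a =>
      measurable_const.indicator (hH a).measurableSet
    have hmS : Measurable fun y => ∑' a, (H a).indicator (fun _ => w a) y :=
      Measurable.tsum hmH
    have e1 : ∀ y, (∑' a, (H a).indicator (fun _ => w a) y) ^ (j + 1) =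
        ∑' a, (H a).indicator (fun y => w a *
          (∑' a, (H a).indicator (fun _ => w a) y) ^ j) y := by
      intro y
      rw [pow_succ, ← ENNReal.tsum_mul_left]
      refine tsum_congr fun a => ?_
      by_cases hy : y ∈ H a
      · simp only [Set.indicator_of_mem hy, mul_comm]
      · simp only [Set.indicator_of_notMem hy, mul_zero]
    simp only [e1]
    rw [lintegral_tsum fun a => (((hmS.pow_const j).const_mul _).indicator
      (hH a).measurableSet).aemeasurable]
    have e2 : ∀ a, ∫⁻ y in A, (H a).indicator (fun y => w a *
        (∑' a, (H a).indicator (fun _ => w a) y) ^ j) y ∂ν ≤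
        K ^ j * (w a * ν (A ∩ H a) ^ (1 - j / (4 * l) : ℝ)) := by
      intro a
      rw [lintegral_indicator (hH a).measurableSet, Measure.restrict_restrict (hH a).measurableSet,
        lintegral_const_mul _ (hmS.pow_const j), Set.inter_comm, mul_left_comm]
      gcongr
      exact ih (by omega) (hA.inter (hH a)) (hA'.inter (hH' a))
    refine (ENNReal.tsum_le_tsum e2).trans ?_
    have hjl : (j : ℝ) ≤ l := by exact_mod_cast (by omega : j ≤ l)
    rw [ENNReal.tsum_mul_left, pow_succ, mul_assoc]
    gcongr
    have hle : (j : ℝ) / (4 * l) ≤ 1 / 4 := by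
      rw [div_le_iff₀ (by positivity)]
      linarith
    have := hstep A hA hA' h0 (1 - j / (4 * l)) (by linarith)
      (by
        have : 0 ≤ (j : ℝ) / (4 * l) := by positivity
        linarith)
    refine this.trans_eq ?_
    congr 2
    push_cast
    ring

end LevelSets

section CoordinateTails

variable {ι : Type*} [Fintype ι] {ν : Measure (EuclideanSpace ℝ ι)} [IsProbabilityMeasure ν]

namespace LogConcaveMeasure

theorem measure_inter_coord_le (h : LogConcaveMeasure ν) {A : Set (EuclideanSpace ℝ ι)}
    (hA : IsClosed A) (hA' : Convex ℝ A) (hA0 : ν A ≠ 0) {i : ι} {V : ℝ} (hV : 0 < V)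
    (hi : Integrable (fun y => y i ^ 2) ν) (hiV : ∫ y in A, y i ^ 2 ∂ν ≤ V ^ 2 * ν.real A)
    (s : ℝ) :
    (ν[|A]) {y | s ≤ |y i|} ≤ ENNReal.ofReal (exp (2 * (1 - s / (exp 3 * V)))) := by
  have : IsProbabilityMeasure (ν[|A]) := cond_isProbabilityMeasure hA0
  set T : EuclideanSpace ℝ ι →L[ℝ] ℝ := EuclideanSpace.proj i with hT
  have hm : Measurable T :=
    T.continuous.measurable
  have : IsProbabilityMeasure ((ν[|A]).map T) :=
    Measure.isProbabilityMeasure_map hm.aemeasurable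
  have key := ((h.cond hA hA').map T).real_tail_le
    (q := 2) (a := V) (s := s) (by norm_num) hV (by
      rw [lintegral_map (by fun_prop) hm, ProbabilityTheory.cond, lintegral_smul_measure]
      have e : ∫⁻ y in A, ENNReal.ofReal (|T y| ^ (2 : ℝ)) ∂ν =
          ENNReal.ofReal (∫ y in A, y i ^ 2 ∂ν) := by
        rw [ofReal_integral_eq_lintegral_ofReal hi.integrableOn (ae_of_all _ fun y => sq_nonneg _)]
        simp [hT]
      rw [e, smul_eq_mul, ENNReal.inv_mul_le_iff hA0 (measure_ne_top _ _)]
      refine (ENNReal.ofReal_le_ofReal hiV).trans_eq ?_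
      rw [ENNReal.ofReal_mul (by positivity), mul_comm, ofReal_measureReal, Real.rpow_two])
  rw [map_measureReal_apply hm (measurableSet_le measurable_const (by fun_prop))] at key
  rw [← ofReal_measureReal]
  exact ENNReal.ofReal_le_ofReal key

theorem tsum_measure_inter_coord_le (h : LogConcaveMeasure ν) {A : Set (EuclideanSpace ℝ ι)}
    (hA : IsClosed A) (hA' : Convex ℝ A) (hA0 : ν A ≠ 0) {i : ι} {V : ℝ} (hV : 0 < V)
    (hi : Integrable (fun y => y i ^ 2) ν) (hiV : ∫ y in A, y i ^ 2 ∂ν ≤ V ^ 2 * ν.real A)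
    {t γ : ℝ} (ht : 0 < t) (hγ : 3 / 4 ≤ γ) :
    ∑' κ : ℕ, ENNReal.ofReal (8 * (κ + 1) * t ^ 2) *
        ν (A ∩ {y | (κ + 1) * t ≤ |y i|}) ^ γ ≤
      ENNReal.ofReal (128 * exp 8 * (V ^ 2 * exp (-(3 * t / (4 * exp 3 * V))))) * ν A ^ γ := by
  have : IsProbabilityMeasure (ν[|A]) := cond_isProbabilityMeasure hA0
  have hγ0 : 0 ≤ γ := by linarith
  set z := 3 * t / (2 * exp 3 * V) with hz
  have hz0 : 0 < z := by positivity
  have hterm : ∀ κ : ℕ, ENNReal.ofReal (8 * (κ + 1) * t ^ 2) *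
        ν (A ∩ {y | (κ + 1) * t ≤ |y i|}) ^ γ ≤
      ENNReal.ofReal (8 * t ^ 2 * exp (3 / 2) * ((κ + 1) * exp (-z * (κ + 1)))) * ν A ^ γ := by
    intro κ
    have h1 : ν (A ∩ {y | (κ + 1) * t ≤ |y i|}) = (ν[|A]) {y | (κ + 1) * t ≤ |y i|} * ν A := by
      rw [cond_mul_eq_inter hA.measurableSet]
    have h2 := h.measure_inter_coord_le hA hA' hA0 hV hi hiV ((κ + 1) * t)
    set r := (ν[|A]) {y | (κ + 1) * t ≤ |y i|} with hr
    have h3 : r ^ γ ≤ ENNReal.ofReal (exp (3 / 2) * exp (-z * (κ + 1))) := by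
      calc r ^ γ ≤ r ^ (3 / 4 : ℝ) := ENNReal.rpow_le_rpow_of_exponent_ge prob_le_one hγ
        _ ≤ ENNReal.ofReal (exp (2 * (1 - (κ + 1) * t / (exp 3 * V)))) ^ (3 / 4 : ℝ) :=
          ENNReal.rpow_le_rpow h2 (by norm_num)
        _ = _ := by
          rw [ENNReal.ofReal_rpow_of_pos (Real.exp_pos _), ← Real.exp_mul, ← Real.exp_add]
          congr 2
          rw [hz]
          field_simp
          ring
    rw [h1, ENNReal.mul_rpow_of_nonneg _ _ hγ0, ← mul_assoc]
    gcongr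
    calc _ ≤ ENNReal.ofReal (8 * (κ + 1) * t ^ 2) *
          ENNReal.ofReal (exp (3 / 2) * exp (-z * (κ + 1))) := by gcongr
      _ = _ := by
        rw [← ENNReal.ofReal_mul (by positivity)]
        ring_nf
  refine (ENNReal.tsum_le_tsum hterm).trans ?_
  rw [ENNReal.tsum_mul_right]
  gcongr
  obtain ⟨hs, hle⟩ := tsum_mul_exp_neg_le hz0
  rw [← ENNReal.ofReal_tsum_of_nonneg (fun κ => by positivity) (hs.mul_left _), tsum_mul_left]
  refine ENNReal.ofReal_le_ofReal ?_
  calc _ ≤ 8 * t ^ 2 * exp (3 / 2) * (16 * exp (-(z / 2)) / z ^ 2) := by gcongr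
    _ = 128 * (exp (3 / 2) * exp 3 ^ 2 * (4 / 9)) *
        (V ^ 2 * exp (-(3 * t / (4 * exp 3 * V)))) := by
      rw [show z / 2 = 3 * t / (4 * exp 3 * V) by rw [hz]; field_simp; norm_num, hz]
      field_simp
      norm_num
    _ ≤ _ := by
      gcongr
      rw [← Real.exp_nat_mul, ← Real.exp_add]
      have h1 : exp (3 / 2 + ((2 : ℕ) : ℝ) * 3) ≤ exp 8 := by
        refine Real.exp_le_exp.2 ?_
        norm_num
      linarith [Real.exp_pos (3 / 2 + ((2 : ℕ) : ℝ) * 3)]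

end LogConcaveMeasure

end CoordinateTails

section LevelStep

variable {ι : Type*} [Fintype ι] [DecidableEq ι] {ν : Measure (EuclideanSpace ℝ ι)}
  [IsProbabilityMeasure ν]

/-- The half-spaces `{y | ±y i ≥ (κ + 1) t}`. -/
def levelHalfSpace (t : ℝ) (a : ι × Bool × ℕ) : Set (EuclideanSpace ℝ ι) :=
  {y | (a.2.2 + 1) * t ≤ boolSign a.2.1 * y a.1}

omit [Fintype ι] [DecidableEq ι] in
theorem isClosed_levelHalfSpace (t : ℝ) (a : ι × Bool × ℕ) : IsClosed (levelHalfSpace t a) :=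
  isClosed_le continuous_const (by fun_prop)

omit [Fintype ι] [DecidableEq ι] in
theorem convex_levelHalfSpace (t : ℝ) (a : ι × Bool × ℕ) : Convex ℝ (levelHalfSpace t a) := by
  intro x hx y hy b c hb hc hbc
  simp only [levelHalfSpace, Set.mem_ofPred_eq, PiLp.add_apply, PiLp.smul_apply,
    smul_eq_mul] at hx hy ⊢
  calc (a.2.2 + 1) * t = b * ((a.2.2 + 1) * t) + c * ((a.2.2 + 1) * t) := by
        rw [← add_mul, hbc, one_mul]
    _ ≤ b * (boolSign a.2.1 * x a.1) + c * (boolSign a.2.1 * y a.1) := by gcongr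
    _ = _ := by ring

omit [Fintype ι] [DecidableEq ι] in
theorem levelHalfSpace_subset (t : ℝ) (a : ι × Bool × ℕ) :
    levelHalfSpace t a ⊆ {y | (a.2.2 + 1) * t ≤ |y a.1|} := by
  intro y hy
  simp only [levelHalfSpace, Set.mem_ofPred_eq] at hy ⊢
  refine hy.trans ?_
  obtain ⟨i, b, κ⟩ := a
  cases b
  · simpa [boolSign] using neg_le_abs (y i)
  · simpa [boolSign] using le_abs_self (y i)

/-- The weight of a half-space at level `κ + 1`. -/
def levelWeight (t : ℝ) (a : ι × Bool × ℕ) : ℝ≥0∞ := ENNReal.ofReal (8 * (a.2.2 + 1) * t ^ 2)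

omit [DecidableEq ι] in
theorem tsum_level_eq (f : ι × Bool × ℕ → ℝ≥0∞) :
    ∑' a, f a = ∑ i, ∑ b, ∑' κ, f (i, b, κ) := by
  rw [ENNReal.tsum_prod', tsum_fintype]
  refine Finset.sum_congr rfl fun i _ => ?_
  rw [ENNReal.tsum_prod', tsum_fintype]

omit [DecidableEq ι] in
theorem LogConcaveMeasure.tsum_levelHalfSpace_le (h : LogConcaveMeasure ν)
    {A : Set (EuclideanSpace ℝ ι)}
    (hA : IsClosed A) (hA' : Convex ℝ A) (hA0 : ν A ≠ 0) {V : ι → ℝ} (hV : ∀ i, 0 < V i)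
    (hi : ∀ i, Integrable (fun y => y i ^ 2) ν)
    (hiV : ∀ i, ∫ y in A, y i ^ 2 ∂ν ≤ V i ^ 2 * ν.real A)
    {t γ : ℝ} (ht : 0 < t) (hγ : 3 / 4 ≤ γ) :
    ∑' a, levelWeight t a * ν (A ∩ levelHalfSpace t a) ^ γ ≤
      ENNReal.ofReal (256 * exp 8 * ∑ i, V i ^ 2 * exp (-(3 * t / (4 * exp 3 * V i)))) *
        ν A ^ γ := by
  rw [tsum_level_eq]
  have h1 : ∀ i, ∀ b, ∑' κ : ℕ, levelWeight t (i, b, κ) *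
      ν (A ∩ levelHalfSpace t (i, b, κ)) ^ γ ≤
      ENNReal.ofReal (128 * exp 8 * (V i ^ 2 * exp (-(3 * t / (4 * exp 3 * V i))))) * ν A ^ γ := by
    intro i b
    refine le_trans (ENNReal.tsum_le_tsum fun κ => ?_)
      (h.tsum_measure_inter_coord_le hA hA' hA0 (hV i) (hi i) (hiV i) ht hγ)
    rw [levelWeight]
    gcongr
    exact levelHalfSpace_subset t (i, b, κ)
  refine (Finset.sum_le_sum fun i _ => Finset.sum_le_sum fun b _ => h1 i b).trans_eq ?_
  rw [Finset.mul_sum, ENNReal.ofReal_sum_of_nonneg fun i _ => by positivity, Finset.sum_mul]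
  refine Finset.sum_congr rfl fun i _ => ?_
  rw [Finset.sum_const, Finset.card_univ, Fintype.card_bool, ← smul_mul_assoc,
    ← ENNReal.ofReal_nsmul, nsmul_eq_mul]
  congr 2
  push_cast
  ring

theorem HasIdentitySecondMoments.exists_variance_bounds (h : HasIdentitySecondMoments ν)
    (hc : LogConcaveMeasure ν) {s : ℝ} (hs : 0 < s) {q : ℕ} (hq : 1 ≤ q)
    (hw : ∀ x : EuclideanSpace ℝ ι, ∫ y, ⟪x, y⟫ ^ (2 * q) ∂ν ≤ (s * ‖x‖) ^ (2 * q))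
    {A : Set (EuclideanSpace ℝ ι)} (hA : exp (-q) ≤ ν.real A) {D : ℝ}
    (hD : D ^ 2 = 24 * 10 ^ 12) (hD0 : 0 < D) {t : ℝ} (ht : 0 < t) :
    ∃ V : ι → ℝ, (∀ i, 0 < V i) ∧ (∀ i, ∫ y in A, y i ^ 2 ∂ν ≤ V i ^ 2 * ν.real A) ∧
      ∑ i, V i ^ 2 * exp (-(3 * t / (4 * exp 3 * V i))) ≤
        D ^ 2 * (s ^ 2 + Fintype.card ι * exp (-(3 * t / (4 * exp 3 * D)))) := by
  have hP : 0 < ν.real A := (Real.exp_pos _).trans_le hA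
  set v : ι → ℝ := fun i => (∫ y in A, y i ^ 2 ∂ν) / ν.real A with hv
  have hv0 : ∀ i, 0 ≤ v i := fun i =>
    div_nonneg (integral_nonneg fun y => sq_nonneg _) hP.le
  have hvP : ∀ i, v i * ν.real A = ∫ y in A, y i ^ 2 ∂ν := fun i => by
    rw [hv]
    field_simp
  set I : Finset ι := Finset.univ.filter fun i => D ^ 2 ≤ v i with hI
  have h1 : ∑ i ∈ I, v i ≤ D ^ 2 / 2 * (I.card + s ^ 2) := by
    refine le_of_mul_le_mul_right ?_ hP
    rw [Finset.sum_mul]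
    simp only [hvP]
    refine (h.sum_setIntegral_sq_le hc hs hq hw hA I).trans_eq ?_
    rw [hD]
    ring
  have h2 : I.card * D ^ 2 ≤ ∑ i ∈ I, v i := by
    have := Finset.card_nsmul_le_sum I v (D ^ 2) fun i hi => (Finset.mem_filter.1 hi).2
    simpa using this
  have h3 : ∑ i ∈ I, v i ≤ D ^ 2 * s ^ 2 := by linarith
  refine ⟨fun i => if D ^ 2 ≤ v i then √(v i) else D, fun i => ?_, fun i => ?_, ?_⟩
  · beta_reduce
    split_ifs with hi
    · exact Real.sqrt_pos.2 ((by positivity : 0 < D ^ 2).trans_le hi)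
    · exact hD0
  · rw [← hvP i]
    gcongr
    beta_reduce
    split_ifs with hi
    · rw [Real.sq_sqrt (hv0 i)]
    · exact (not_le.1 hi).le
  · rw [mul_add, ← Finset.sum_filter_add_sum_filter_not Finset.univ fun i => D ^ 2 ≤ v i]
    refine add_le_add (le_trans (Finset.sum_le_sum fun i hi => ?_) h3) ?_
    · have hi' := (Finset.mem_filter.1 hi).2
      beta_reduce
      rw [if_pos hi', Real.sq_sqrt (hv0 i)]
      refine mul_le_of_le_one_right (hv0 i) (Real.exp_le_one_iff.2 ?_)
      have : 0 ≤ √(v i) := Real.sqrt_nonneg _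
      have : 0 ≤ 3 * t / (4 * exp 3 * √(v i)) := by positivity
      linarith
    · calc _ = ∑ i ∈ Finset.univ.filter (fun i => ¬ D ^ 2 ≤ v i),
            D ^ 2 * exp (-(3 * t / (4 * exp 3 * D))) :=
            Finset.sum_congr rfl fun i hi => by
              beta_reduce
              rw [if_neg (Finset.mem_filter.1 hi).2]
        _ ≤ ∑ i : ι, D ^ 2 * exp (-(3 * t / (4 * exp 3 * D))) :=
            Finset.sum_le_sum_of_subset_of_nonneg (Finset.subset_univ _)
              fun _ _ _ => by positivity
        _ = _ := by
            rw [Finset.sum_const, Finset.card_univ, nsmul_eq_mul]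
            ring

end LevelStep

section Moments

/-- A one-sided `N`-th moment bound controls all lower moments; no measurability is needed. -/
theorem integral_rpow_le_of_lintegral_pow_le {Ω : Type*} [MeasurableSpace Ω] {μ : Measure Ω}
    [IsProbabilityMeasure μ] {f : Ω → ℝ} (hf : ∀ ω, 0 ≤ f ω) {R p : ℝ} (hR : 0 < R)
    (hp : 1 ≤ p) {N : ℕ} (hN : p ≤ N)
    (h : ∫⁻ ω, ENNReal.ofReal (f ω ^ N) ∂μ ≤ ENNReal.ofReal (R ^ N)) :
    (∫ ω, f ω ^ p ∂μ) ^ (1 / p) ≤ 2 * R := by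
  have hp0 : 0 < p := by linarith
  have h1 : ∀ ω, f ω ^ p ≤ R ^ p * (1 + (R ^ N)⁻¹ * f ω ^ N) := by
    intro ω
    have e : f ω = R * (f ω / R) := by field_simp
    have h0 : 0 ≤ f ω / R := div_nonneg (hf ω) hR.le
    have h2 : (f ω / R) ^ p ≤ 1 + (f ω / R) ^ N := by
      rcases le_total (f ω / R) 1 with h3 | h3
      · have := Real.rpow_le_one h0 h3 hp0.le
        have := pow_nonneg h0 N
        linarith
      · have := Real.rpow_le_rpow_of_exponent_le h3 hN
        rw [Real.rpow_natCast] at this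
        linarith
    calc f ω ^ p = R ^ p * (f ω / R) ^ p := by rw [← Real.mul_rpow hR.le h0, ← e]
      _ ≤ R ^ p * (1 + (f ω / R) ^ N) := by gcongr
      _ = _ := by rw [div_pow, div_eq_inv_mul]
  have h2 : ∫⁻ ω, ENNReal.ofReal ‖f ω ^ p‖ ∂μ ≤ ENNReal.ofReal (R ^ p * 2) := by
    calc ∫⁻ ω, ENNReal.ofReal ‖f ω ^ p‖ ∂μ
        ≤ ∫⁻ ω, ENNReal.ofReal (R ^ p) *
            (1 + ENNReal.ofReal (R ^ N)⁻¹ * ENNReal.ofReal (f ω ^ N)) ∂μ := by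
          refine lintegral_mono fun ω => ?_
          have := hf ω
          rw [Real.norm_of_nonneg (Real.rpow_nonneg this p), ← ENNReal.ofReal_one,
            ← ENNReal.ofReal_mul (by positivity),
            ← ENNReal.ofReal_add (by positivity) (by positivity),
            ← ENNReal.ofReal_mul (by positivity)]
          exact ENNReal.ofReal_le_ofReal (h1 ω)
      _ = ENNReal.ofReal (R ^ p) * (1 + ENNReal.ofReal (R ^ N)⁻¹ *
            ∫⁻ ω, ENNReal.ofReal (f ω ^ N) ∂μ) := by
          rw [lintegral_const_mul' _ _ ENNReal.ofReal_ne_top, lintegral_add_left measurable_const,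
            lintegral_const_mul' _ _ ENNReal.ofReal_ne_top]
          simp
      _ ≤ ENNReal.ofReal (R ^ p) * (1 + ENNReal.ofReal (R ^ N)⁻¹ * ENNReal.ofReal (R ^ N)) := by
          gcongr
      _ = ENNReal.ofReal (R ^ p * 2) := by
          rw [← ENNReal.ofReal_mul (by positivity), inv_mul_cancel₀ (by positivity),
            ENNReal.ofReal_one, one_add_one_eq_two, ENNReal.ofReal_mul (by positivity)]
          simp
  have h3 : ∫ ω, f ω ^ p ∂μ ≤ R ^ p * 2 := by
    refine (Real.le_norm_self _).trans ((norm_integral_le_lintegral_norm _).trans ?_)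
    exact ENNReal.toReal_le_of_le_ofReal (by positivity) h2
  have h4 : 0 ≤ ∫ ω, f ω ^ p ∂μ := integral_nonneg fun ω => Real.rpow_nonneg (hf ω) p
  have h5 : (2 : ℝ) ≤ 2 ^ p := by
    simpa using Real.rpow_le_rpow_of_exponent_le one_le_two hp
  calc (∫ ω, f ω ^ p ∂μ) ^ (1 / p) ≤ ((2 * R) ^ p) ^ (1 / p) := by
        refine Real.rpow_le_rpow h4 (h3.trans ?_) (by positivity)
        rw [Real.mul_rpow zero_le_two hR.le, mul_comm]
        gcongr
    _ = 2 * R := by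
        rw [← Real.rpow_mul (by positivity), mul_one_div_cancel hp0.ne', Real.rpow_one]

theorem sq_le_sq_add_sum_levels (x : ℝ) {t : ℝ} (ht : 0 < t) :
    x ^ 2 ≤ t ^ 2 + ∑ κ ∈ Finset.range ⌊|x| / t⌋₊, 8 * ((κ : ℝ) + 1) * t ^ 2 := by
  have hs : ∀ K : ℕ, ∑ κ ∈ Finset.range K, 8 * ((κ : ℝ) + 1) * t ^ 2 =
      4 * K * (K + 1) * t ^ 2 := by
    intro K
    induction K with
    | zero => simp
    | succ K ih =>
      rw [Finset.sum_range_succ, ih]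
      push_cast
      ring
  set K := ⌊|x| / t⌋₊
  have h1 : |x| ≤ (K + 1) * t := by
    rw [← div_le_iff₀ ht]
    exact (Nat.lt_floor_add_one _).le
  calc x ^ 2 = |x| ^ 2 := (sq_abs x).symm
    _ ≤ ((K + 1) * t) ^ 2 := by gcongr
    _ ≤ _ := by
      rw [hs]
      have : 0 ≤ (3 * (K : ℝ) ^ 2 + 2 * K) * t ^ 2 := by positivity
      nlinarith

end Moments

section LevelSum

variable {ι : Type*} [Fintype ι] {ν : Measure (EuclideanSpace ℝ ι)} [IsProbabilityMeasure ν]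

/-- The sum of the weights of the half-spaces containing a point. -/
def levelSum (t : ℝ) (y : EuclideanSpace ℝ ι) : ℝ≥0∞ :=
  ∑' a : ι × Bool × ℕ, (levelHalfSpace t a).indicator (fun _ => levelWeight t a) y

theorem ofReal_sum_sq_le (y : EuclideanSpace ℝ ι) (I : Finset ι) {t : ℝ} (ht : 0 < t) :
    ENNReal.ofReal (∑ i ∈ I, y i ^ 2) ≤ ENNReal.ofReal (I.card * t ^ 2) + levelSum t y := by
  have h1 : ∀ i, ENNReal.ofReal (y i ^ 2) ≤ ENNReal.ofReal (t ^ 2) +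
      ∑ b, ∑' κ : ℕ,
        (levelHalfSpace t (i, b, κ)).indicator (fun _ => levelWeight t (i, b, κ)) y := by
    intro i
    obtain ⟨b, hb⟩ : ∃ b, boolSign b * y i = |y i| := by
      rcases abs_choice (y i) with h | h
      · exact ⟨true, by simp [boolSign, h]⟩
      · exact ⟨false, by simp [boolSign, h]⟩
    refine (ENNReal.ofReal_le_ofReal (sq_le_sq_add_sum_levels (y i) ht)).trans ?_
    rw [ENNReal.ofReal_add (by positivity) (Finset.sum_nonneg fun _ _ => by positivity),
      ENNReal.ofReal_sum_of_nonneg fun _ _ => by positivity]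
    gcongr
    refine le_trans ?_ (Finset.single_le_sum (fun _ _ => zero_le) (Finset.mem_univ b))
    refine le_trans (Finset.sum_le_sum fun κ hκ => ?_) (ENNReal.sum_le_tsum (Finset.range _))
    have hκ' : ((κ : ℝ) + 1) * t ≤ |y i| := by
      rw [← le_div_iff₀ ht]
      have := Finset.mem_range.1 hκ
      calc (κ : ℝ) + 1 ≤ (⌊|y i| / t⌋₊ : ℝ) := by exact_mod_cast this
        _ ≤ _ := Nat.floor_le (by positivity)
    rw [Set.indicator_of_mem]
    · rfl
    · simpa only [levelHalfSpace, Set.mem_ofPred_eq, hb] using hκ'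
  rw [ENNReal.ofReal_sum_of_nonneg fun _ _ => sq_nonneg _, levelSum, tsum_level_eq]
  refine (Finset.sum_le_sum fun i _ => h1 i).trans ?_
  rw [Finset.sum_add_distrib]
  refine add_le_add (le_of_eq ?_) (Finset.sum_le_sum_of_subset (Finset.subset_univ I))
  rw [Finset.sum_const, ← ENNReal.ofReal_nsmul, nsmul_eq_mul]

variable [DecidableEq ι]

theorem HasIdentitySecondMoments.tsum_levelHalfSpace_le (h : HasIdentitySecondMoments ν)
    (hc : LogConcaveMeasure ν) {p B : ℝ} (hp : 1 ≤ p) (hB : 0 < B)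
    (hw : ∀ x : EuclideanSpace ℝ ι, ‖x‖ = 1 → ∫ y, |⟪x, y⟫| ^ p ∂ν ≤ B ^ p) {l : ℕ}
    (hl : p ≤ l) (hl' : l ≤ 2 * p) {D t : ℝ} (hD : D ^ 2 = 24 * 10 ^ 12) (hD0 : 0 < D)
    (ht : 0 < t) (hι : Fintype.card ι * exp (-(3 * t / (4 * exp 3 * D))) ≤ B ^ 2)
    {A : Set (EuclideanSpace ℝ ι)} (hA : IsClosed A) (hA' : Convex ℝ A) (hA0 : ν A ≠ 0)
    {γ : ℝ} (hγ : 3 / 4 ≤ γ) :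
    ∑' a, levelWeight t a * ν (A ∩ levelHalfSpace t a) ^ γ ≤
      ENNReal.ofReal (256 * exp 8 * (64 * D ^ 2 * (16 * exp 8 + 1) * B ^ 2)) *
        ν A ^ (γ - 1 / (4 * l)) := by
  have hp0 : 0 < p := by linarith
  have hl1 : (1 : ℝ) ≤ l := hp.trans hl
  have hl1' : 1 ≤ l := by exact_mod_cast hl1
  have hP : 0 < ν.real A := ENNReal.toReal_pos hA0 (measure_ne_top _ _)
  have hP1 : ν.real A ≤ 1 := measureReal_le_one
  set L := -log (ν.real A) with hL
  have hL0 : 0 ≤ L := by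
    have := Real.log_nonpos hP.le hP1
    linarith
  set q := max l ⌈L⌉₊ with hq
  have hlq : (l : ℝ) ≤ q := by exact_mod_cast le_max_left _ _
  have hLq : L ≤ q := (Nat.le_ceil L).trans (by exact_mod_cast le_max_right _ _)
  have hq' : (q : ℝ) ≤ l + L := by
    rw [hq, Nat.cast_max]
    have := Nat.ceil_lt_add_one hL0
    exact max_le (by linarith) (by linarith)
  have hq0 : (0 : ℝ) < q := by linarith
  have hAq : exp (-q) ≤ ν.real A := by
    calc exp (-q) ≤ exp (-L) := by gcongr
      _ = ν.real A := by rw [hL, neg_neg, Real.exp_log hP]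
  set s := exp 4 * B * (2 * q) / p with hs
  have hs0 : 0 < s := by positivity
  obtain ⟨V, hV, hiV, hVs⟩ := h.exists_variance_bounds hc hs0 (hl1'.trans (le_max_left _ _))
    (h.integral_inner_pow_le hc hp hB hw (hl.trans hlq)) hAq hD hD0 ht
  have hsl : s ≤ 4 * exp 4 * B * (1 + L / l) := by
    have : q / p ≤ 2 * (1 + L / l) := by
      rw [div_le_iff₀ hp0]
      calc (q : ℝ) ≤ l + L := hq'
        _ = l * (1 + L / l) := by field_simp
        _ ≤ 2 * p * (1 + L / l) := by gcongr
        _ = _ := by ring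
    calc s = 2 * exp 4 * B * (q / p) := by rw [hs]; ring
      _ ≤ 2 * exp 4 * B * (2 * (1 + L / l)) := by gcongr
      _ = _ := by ring
  have hy : 0 ≤ L / l := by positivity
  have hexp : (1 + L / l) ^ 2 ≤ 64 * exp (L / l / 4) := by
    have h1 : 1 + L / l ≤ 8 * exp (L / l / 8) := by
      have := Real.add_one_le_exp (L / l / 8)
      linarith
    calc (1 + L / l) ^ 2 ≤ (8 * exp (L / l / 8)) ^ 2 := by gcongr
      _ = _ := by
        rw [mul_pow, ← Real.exp_nat_mul]
        norm_num
        ring_nf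
  have hbound : D ^ 2 * (s ^ 2 + Fintype.card ι * exp (-(3 * t / (4 * exp 3 * D)))) ≤
      64 * D ^ 2 * (16 * exp 8 + 1) * B ^ 2 * exp (L / l / 4) := by
    have e8 : exp 4 ^ 2 = exp 8 := by
      rw [← Real.exp_nat_mul]
      norm_num
    calc _ ≤ D ^ 2 * ((4 * exp 4 * B * (1 + L / l)) ^ 2 + B ^ 2 * (1 + L / l) ^ 2) := by
          have h1 : 1 ≤ (1 + L / l) ^ 2 := one_le_pow₀ ((le_add_iff_nonneg_right 1).2 hy)
          have h2 := hι.trans (le_mul_of_one_le_right (sq_nonneg B) h1)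
          exact mul_le_mul_of_nonneg_left (add_le_add (pow_le_pow_left₀ hs0.le hsl 2) h2)
            (sq_nonneg D)
      _ = D ^ 2 * (16 * exp 8 + 1) * B ^ 2 * (1 + L / l) ^ 2 := by
          rw [← e8]
          ring
      _ ≤ D ^ 2 * (16 * exp 8 + 1) * B ^ 2 * (64 * exp (L / l / 4)) := by gcongr
      _ = _ := by ring
  have hpow : ENNReal.ofReal (exp (L / l / 4)) = ν A ^ (-(1 / (4 * l)) : ℝ) := by
    have : exp (L / l / 4) = ν.real A ^ (-(1 / (4 * l)) : ℝ) := by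
      rw [Real.rpow_def_of_pos hP, hL]
      congr 1
      field_simp
    rw [this, ← ENNReal.ofReal_rpow_of_pos hP, ofReal_measureReal]
  refine (hc.tsum_levelHalfSpace_le hA hA' hA0 hV (fun i => (h.memLp_coord i).integrable_sq) hiV
    ht hγ).trans ?_
  calc _ ≤ ENNReal.ofReal (256 * exp 8 *
        (64 * D ^ 2 * (16 * exp 8 + 1) * B ^ 2 * exp (L / l / 4))) * ν A ^ γ := by
        gcongr
        exact hVs.trans hbound
    _ = _ := by
        rw [← mul_assoc (256 * exp 8), ENNReal.ofReal_mul (by positivity), hpow, mul_assoc,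
          ← ENNReal.rpow_add _ _ hA0 (measure_ne_top _ _), neg_add_eq_sub]

theorem HasIdentitySecondMoments.lintegral_levelSum_pow_le (h : HasIdentitySecondMoments ν)
    (hc : LogConcaveMeasure ν) {p B : ℝ} (hp : 1 ≤ p) (hB : 0 < B)
    (hw : ∀ x : EuclideanSpace ℝ ι, ‖x‖ = 1 → ∫ y, |⟪x, y⟫| ^ p ∂ν ≤ B ^ p) {l : ℕ}
    (hl : p ≤ l) (hl' : l ≤ 2 * p) {D t : ℝ} (hD : D ^ 2 = 24 * 10 ^ 12) (hD0 : 0 < D)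
    (ht : 0 < t) (hι : Fintype.card ι * exp (-(3 * t / (4 * exp 3 * D))) ≤ B ^ 2) :
    ∫⁻ y, levelSum t y ^ l ∂ν ≤
      ENNReal.ofReal (256 * exp 8 * (64 * D ^ 2 * (16 * exp 8 + 1) * B ^ 2)) ^ l := by
  have hl1 : 1 ≤ l := by exact_mod_cast hp.trans hl
  have := setLIntegral_tsum_indicator_pow_le (ν := ν) (isClosed_levelHalfSpace t)
    (convex_levelHalfSpace t) hl1 (fun A hA hA' hA0 γ hγ _ =>
      h.tsum_levelHalfSpace_le hc hp hB hw hl hl' hD hD0 ht hι hA hA' hA0 hγ) le_rfl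
    isClosed_univ convex_univ
  simpa [levelSum] using this

end LevelSum

section Link

variable {μ : Measure Ω} {n : ℕ} {X : Ω → EuclideanSpace ℝ (Fin n)}

theorem IsIsotropic.hasIdentitySecondMoments_map (hX : Measurable X) (h : IsIsotropic μ X) :
    HasIdentitySecondMoments (μ.map X) := by
  intro i j
  rw [integral_map hX.aemeasurable (by fun_prop)]
  exact h.2 i j

theorem sigmaX_nonneg (μ : Measure Ω) (X : Ω → EuclideanSpace ℝ (Fin n)) (p : ℝ) :
    0 ≤ sigmaX μ X p :=
  Real.iSup_nonneg fun _ => Real.rpow_nonneg (integral_nonneg fun _ => by positivity) _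

variable [IsProbabilityMeasure μ]

theorem integral_abs_inner_rpow_le_sigmaX (hX : Measurable X) (hc : IsLogConcave μ X)
    (hi : IsIsotropic μ X) {p : ℝ} (hp : 1 ≤ p) {x : EuclideanSpace ℝ (Fin n)} (hx : ‖x‖ = 1) :
    ∫ y, |⟪x, y⟫| ^ p ∂(μ.map X) ≤ sigmaX μ X p ^ p := by
  have : IsProbabilityMeasure (μ.map X) := Measure.isProbabilityMeasure_map hX.aemeasurable
  have hν := hi.hasIdentitySecondMoments_map hX
  have hcν := hc.logConcaveMeasure_map hX
  have hp0 : 0 < p := by linarith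
  have e : ∀ x : EuclideanSpace ℝ (Fin n),
      ∫ ω, |⟪x, X ω⟫| ^ p ∂μ = ∫ y, |⟪x, y⟫| ^ p ∂(μ.map X) := fun x => by
    rw [integral_map hX.aemeasurable
      (hν.integrable_abs_inner_rpow hcν x hp0.le).aestronglyMeasurable]
  have h0 : ∀ x : EuclideanSpace ℝ (Fin n), 0 ≤ ∫ y, |⟪x, y⟫| ^ p ∂(μ.map X) := fun x =>
    integral_nonneg fun y => by positivity
  have hint : Integrable (fun y : EuclideanSpace ℝ (Fin n) => 1 + ‖y‖ ^ (⌈p⌉₊ + 2))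
      (μ.map X) := by
    have := (hν.memLp hcν (N := ⌈p⌉₊ + 2) (by omega)).integrable_norm_pow (by omega)
    exact (integrable_const 1).add this
  have hbdd : BddAbove (Set.range fun t : {t : EuclideanSpace ℝ (Fin n) // ‖t‖ = 1} =>
      (∫ ω, |⟪t.1, X ω⟫| ^ p ∂μ) ^ (1 / p)) := by
    refine ⟨(∫ y, (1 + ‖y‖ ^ (⌈p⌉₊ + 2)) ∂(μ.map X)) ^ (1 / p), ?_⟩
    rintro _ ⟨⟨x, hx⟩, rfl⟩
    simp only [e]
    refine Real.rpow_le_rpow (h0 x) (integral_mono (hν.integrable_abs_inner_rpow hcν x hp0.le)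
      hint fun y => ?_) (by positivity)
    have h1 : |⟪x, y⟫| ≤ ‖y‖ := by simpa [hx] using abs_real_inner_le_norm x y
    have h2 : p ≤ (⌈p⌉₊ + 2 : ℕ) := by
      push_cast
      linarith [Nat.le_ceil p]
    calc |⟪x, y⟫| ^ p ≤ ‖y‖ ^ p := by gcongr
      _ ≤ 1 + ‖y‖ ^ (⌈p⌉₊ + 2) := by
        rcases le_total ‖y‖ 1 with h3 | h3
        · have := Real.rpow_le_one (norm_nonneg y) h3 hp0.le
          have : 0 ≤ ‖y‖ ^ (⌈p⌉₊ + 2) := by positivity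
          linarith
        · have := Real.rpow_le_rpow_of_exponent_le h3 h2
          rw [Real.rpow_natCast] at this
          linarith
  have h1 : (∫ y, |⟪x, y⟫| ^ p ∂(μ.map X)) ^ (1 / p) ≤ sigmaX μ X p := by
    rw [← e]
    exact le_ciSup hbdd ⟨x, hx⟩
  calc ∫ y, |⟪x, y⟫| ^ p ∂(μ.map X) = ((∫ y, |⟪x, y⟫| ^ p ∂(μ.map X)) ^ (1 / p)) ^ p := by
        rw [← Real.rpow_mul (h0 x), one_div_mul_cancel hp0.ne', Real.rpow_one]
    _ ≤ _ := Real.rpow_le_rpow (Real.rpow_nonneg (h0 x) _) h1 hp0.le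

end Link

theorem measurable_levelSum {ι : Type*} [Fintype ι] (t : ℝ) :
    Measurable (levelSum (ι := ι) t) :=
  Measurable.tsum fun a =>
    measurable_const.indicator (isClosed_levelHalfSpace t a).measurableSet

theorem ENNReal.add_pow_le_two_pow_mul (a b : ℝ≥0∞) (l : ℕ) :
    (a + b) ^ l ≤ 2 ^ l * (a ^ l + b ^ l) := by
  rw [← ENNReal.rpow_natCast]
  calc (a + b) ^ (l : ℝ) ≤ (2 * max a b) ^ (l : ℝ) := by
        rw [two_mul]
        gcongr
        · exact le_max_left a b
        · exact le_max_right a b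
    _ = 2 ^ l * max a b ^ l := by rw [ENNReal.rpow_natCast, mul_pow]
    _ ≤ _ := by
        gcongr
        rcases le_total a b with h | h
        · rw [max_eq_right h]
          exact le_add_self
        · rw [max_eq_left h]
          exact le_self_add

/-- The moment bound with the level `t` and all constants explicit. -/
theorem integral_iSup_sqrt_rpow_le {μ : Measure Ω} [IsProbabilityMeasure μ] {n : ℕ}
    {X : Ω → EuclideanSpace ℝ (Fin n)} (hX : Measurable X) (hc : IsLogConcave μ X)
    (hi : IsIsotropic μ X) {m : ℕ} (hmn : m ≤ n) {p B : ℝ} (hp : 1 ≤ p) (hB : 0 < B)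
    (hσ : sigmaX μ X p ≤ B) {D t : ℝ} (hD : D ^ 2 = 24 * 10 ^ 12) (hD0 : 0 < D) (ht : 0 < t)
    (hn : n * exp (-(3 * t / (4 * exp 3 * D))) ≤ B ^ 2) :
    (∫ ω, (⨆ I : {I : Finset (Fin n) // I.card = m}, √(∑ i ∈ I.1, X ω i ^ 2)) ^ p ∂μ) ^ (1 / p) ≤
      4 * (√m * t + √(256 * exp 8 * (64 * D ^ 2 * (16 * exp 8 + 1))) * B) := by
  have : IsProbabilityMeasure (μ.map X) := Measure.isProbabilityMeasure_map hX.aemeasurable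
  have hν := hi.hasIdentitySecondMoments_map hX
  have hcν := hc.logConcaveMeasure_map hX
  have hp0 : 0 < p := by linarith
  set c := 256 * exp 8 * (64 * D ^ 2 * (16 * exp 8 + 1)) with hcdef
  have hc0 : 0 < c := by positivity
  set l := ⌈p⌉₊ with hldef
  have hl : p ≤ l := Nat.le_ceil p
  have hl' : l ≤ 2 * p := by linarith [Nat.ceil_lt_add_one hp0.le]
  have hS := hν.lintegral_levelSum_pow_le hcν hp hB
    (fun x hx => (integral_abs_inner_rpow_le_sigmaX hX hc hi hp hx).trans
      (Real.rpow_le_rpow (sigmaX_nonneg μ X p) hσ hp0.le)) hl hl' hD hD0 ht (by simpa using hn)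
  rw [show 256 * exp 8 * (64 * D ^ 2 * (16 * exp 8 + 1) * B ^ 2) = c * B ^ 2 by
    rw [hcdef]; ring, lintegral_map ((measurable_levelSum t).pow_const l) hX] at hS
  set F : Ω → ℝ := fun ω =>
    ⨆ I : {I : Finset (Fin n) // I.card = m}, √(∑ i ∈ I.1, X ω i ^ 2) with hF
  have hF0 : ∀ ω, 0 ≤ F ω := fun ω => Real.iSup_nonneg fun _ => Real.sqrt_nonneg _
  have hne : Nonempty {I : Finset (Fin n) // I.card = m} := by
    obtain ⟨I, -, hI⟩ := Finset.exists_subset_card_eq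
      (s := (Finset.univ : Finset (Fin n))) (n := m) (by simpa using hmn)
    exact ⟨⟨I, hI⟩⟩
  have hFS : ∀ ω, ENNReal.ofReal (F ω ^ 2) ≤ ENNReal.ofReal (m * t ^ 2) + levelSum t (X ω) := by
    intro ω
    obtain ⟨I, hI⟩ := exists_eq_ciSup_of_finite
      (f := fun I : {I : Finset (Fin n) // I.card = m} => √(∑ i ∈ I.1, X ω i ^ 2))
    have : F ω ^ 2 = ∑ i ∈ I.1, X ω i ^ 2 := by
      rw [hF]
      beta_reduce
      rw [← hI, Real.sq_sqrt (Finset.sum_nonneg fun _ _ => sq_nonneg _)]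
    rw [this]
    simpa only [I.2] using ofReal_sum_sq_le (X ω) I.1 ht
  set R := 2 * (√m * t + √c * B) with hR
  have hR0 : 0 < R := by positivity
  have hR2 : 2 * (m * t ^ 2 + c * B ^ 2) ≤ R ^ 2 := by
    have h1 : √(m : ℝ) ^ 2 = m := Real.sq_sqrt (Nat.cast_nonneg m)
    have h2 : √c ^ 2 = c := Real.sq_sqrt hc0.le
    have h3 : 0 ≤ √m * t * (√c * B) := by positivity
    have h4 : 0 ≤ m * t ^ 2 := by positivity
    have h5 : 0 ≤ c * B ^ 2 := by positivity
    calc _ ≤ 4 * (m * t ^ 2 + 2 * (√m * t * (√c * B)) + c * B ^ 2) := by linarith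
      _ = 4 * (√m ^ 2 * t ^ 2 + 2 * (√m * t * (√c * B)) + √c ^ 2 * B ^ 2) := by rw [h1, h2]
      _ = _ := by ring
  have hmom : ∫⁻ ω, ENNReal.ofReal (F ω ^ (2 * l)) ∂μ ≤ ENNReal.ofReal (R ^ (2 * l)) := by
    calc ∫⁻ ω, ENNReal.ofReal (F ω ^ (2 * l)) ∂μ
        ≤ ∫⁻ ω, 2 ^ l * (ENNReal.ofReal (m * t ^ 2) ^ l + levelSum t (X ω) ^ l) ∂μ := by
          refine lintegral_mono fun ω => ?_
          rw [pow_mul, ENNReal.ofReal_pow (sq_nonneg _)]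
          exact (pow_le_pow_left' (hFS ω) l).trans (ENNReal.add_pow_le_two_pow_mul _ _ l)
      _ = 2 ^ l * (ENNReal.ofReal (m * t ^ 2) ^ l + ∫⁻ ω, levelSum t (X ω) ^ l ∂μ) := by
          rw [lintegral_const_mul' _ _ (by finiteness), lintegral_add_left measurable_const]
          simp
      _ ≤ 2 ^ l * (ENNReal.ofReal (m * t ^ 2) ^ l + ENNReal.ofReal (c * B ^ 2) ^ l) := by
          gcongr
      _ = ENNReal.ofReal (2 ^ l * ((m * t ^ 2) ^ l + (c * B ^ 2) ^ l)) := by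
          rw [ENNReal.ofReal_mul (p := 2 ^ l) (by positivity), ENNReal.ofReal_add (by positivity)
            (by positivity), ENNReal.ofReal_pow (by positivity), ENNReal.ofReal_pow (by positivity),
            ENNReal.ofReal_pow (by positivity)]
          simp
      _ ≤ ENNReal.ofReal (R ^ (2 * l)) := by
          refine ENNReal.ofReal_le_ofReal ?_
          rw [pow_mul]
          have hl1 : l ≠ 0 := by
            rintro h0
            rw [h0, Nat.cast_zero] at hl
            linarith
          calc 2 ^ l * ((m * t ^ 2) ^ l + (c * B ^ 2) ^ l)
              ≤ 2 ^ l * (m * t ^ 2 + c * B ^ 2) ^ l := by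
                gcongr
                exact pow_add_pow_le (by positivity) (by positivity) hl1
            _ = (2 * (m * t ^ 2 + c * B ^ 2)) ^ l := (mul_pow _ _ _).symm
            _ ≤ (R ^ 2) ^ l := by gcongr
  have hN : p ≤ (2 * l : ℕ) := by
    push_cast
    linarith
  exact (integral_rpow_le_of_lintegral_pow_le hF0 hR0 hp hN hmom).trans_eq (by rw [hR]; ring)

/-- **Theorem 3 (uniform Paouris inequality).** There is a universal constant `C > 0` such
that for every isotropic log-concave random vector `X` in `ℝⁿ`, every `1 ≤ m ≤ n` and every
`p ≥ 1`, `(E[max_{|I|=m} |P_I X|^p])^(1/p) ≤ C·(√m·log(en/m) + σ_X(p))`, where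
`|P_I x| = √(∑_{i ∈ I} xᵢ²)`. -/
theorem uniform_paouris :
    ∃ C : ℝ, 0 < C ∧
      ∀ (Ω : Type) (_ : MeasurableSpace Ω) (μ : Measure Ω), IsProbabilityMeasure μ →
      ∀ (n : ℕ) (X : Ω → EuclideanSpace ℝ (Fin n)), Measurable X →
      IsLogConcave μ X → IsIsotropic μ X →
      ∀ m : ℕ, 1 ≤ m → m ≤ n →
      ∀ p : ℝ, 1 ≤ p →
        (∫ ω, (⨆ I : {I : Finset (Fin n) // I.card = m},
            Real.sqrt (∑ i ∈ I.1, (X ω i) ^ 2)) ^ p ∂μ) ^ (1 / p) ≤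
          C * (Real.sqrt m * Real.log (Real.exp 1 * n / m) + sigmaX μ X p) := by
  obtain ⟨D, hD0, hD⟩ : ∃ D : ℝ, 0 < D ∧ D ^ 2 = 24 * 10 ^ 12 :=
    ⟨√(24 * 10 ^ 12), by positivity, Real.sq_sqrt (by positivity)⟩
  set k := √(256 * exp 8 * (64 * D ^ 2 * (16 * exp 8 + 1)))
  have hk : 0 ≤ k := Real.sqrt_nonneg _
  refine ⟨4 * (4 * exp 3 * D / 3 + k), by positivity, ?_⟩
  intro Ω _ μ _ n X hX hc hi m hm hmn p hp
  have hm0 : (0 : ℝ) < m := by exact_mod_cast hm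
  have hm1 : (1 : ℝ) ≤ m := by exact_mod_cast hm
  have hmn' : (m : ℝ) ≤ n := by exact_mod_cast hmn
  have hn0 : (0 : ℝ) < n := hm0.trans_le hmn'
  have hσ := sigmaX_nonneg μ X p
  set L := log (exp 1 * n / m) with hL
  have hL1 : 1 ≤ L := by
    rw [hL, Real.le_log_iff_exp_le (by positivity), le_div_iff₀ hm0]
    gcongr
  have hexp : n * exp (-L) = m / exp 1 := by
    rw [hL, Real.exp_neg, Real.exp_log (by positivity)]
    field_simp
  have h1 := integral_iSup_sqrt_rpow_le hX hc hi hmn (B := sigmaX μ X p + √m)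
    (t := 4 * exp 3 * D / 3 * L) hp (by positivity) (le_add_of_nonneg_right (Real.sqrt_nonneg _))
    hD hD0 (by positivity) (by
      have e : 3 * (4 * exp 3 * D / 3 * L) / (4 * exp 3 * D) = L := by field_simp
      rw [e, hexp]
      calc (m : ℝ) / exp 1 ≤ m := div_le_self hm0.le (Real.one_le_exp zero_le_one)
        _ = √m ^ 2 := (Real.sq_sqrt hm0.le).symm
        _ ≤ _ := by gcongr; exact le_add_of_nonneg_left hσ)
  refine h1.trans ?_
  have h2 : √m ≤ √m * L := le_mul_of_one_le_right (Real.sqrt_nonneg _) hL1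
  have h3 : k * √m ≤ k * (√m * L) := by gcongr
  have h4 : 0 ≤ 4 * exp 3 * D / 3 * sigmaX μ X p := by positivity
  linarith

end
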